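/- Let T be a geometric complete theory and T* be either the theory T_p of lovely pairs or the theory T^ind of H-structures associated with T. If T* has ATP, then T has ATP. Equivalently, if T is NATP, then T* is NATP. -/

import Mathlib

open FirstOrder FirstOrder.Language

universe u v w

namespace NATPPaper

section ATP

variable {L : FirstOrder.Language.{u, v}}

def TreeComparable (η ν : List Bool) : Prop := η <+: ν ∨ ν <+: η

def IsTreeAntichain (X : Set (List Bool)) : Prop :=
  ∀ η ∈ X, ∀ ν ∈ X, η ≠ ν → ¬ TreeComparable η ν

def ATPWitness {M : Type w} [L.Structure M] {n m : ℕ}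
    (φ : L.Formula (Fin n ⊕ Fin m)) (a : List Bool → Fin m → M) : Prop :=
  (∀ X : Finset (List Bool), IsTreeAntichain ↑X →
      ∃ b : Fin n → M, ∀ η ∈ X, φ.Realize (Sum.elim b (a η))) ∧
  (∀ η ν : List Bool, η ≠ ν → TreeComparable η ν →
      ¬ ∃ b : Fin n → M, φ.Realize (Sum.elim b (a η)) ∧ φ.Realize (Sum.elim b (a ν)))

def _root_.FirstOrder.Language.Theory.HasATP (T : L.Theory) : Prop :=
  ∃ (M : Theory.ModelType.{u, v, max u v} T) (n m : ℕ)
    (φ : L.Formula (Fin n ⊕ Fin m)) (a : List Bool → Fin m → M), ATPWitness φ a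

def _root_.FirstOrder.Language.Theory.IsNATP (T : L.Theory) : Prop := ¬ T.HasATP

end ATP

section Acl

variable {L : FirstOrder.Language.{u, v}}

/-- Model-theoretic algebraic closure. -/
def acl (L : FirstOrder.Language.{u, v}) (M : Type w) [L.Structure M] (A : Set M) : Set M :=
  {x | ∃ (k : ℕ) (φ : L.Formula (Fin 1 ⊕ Fin k)) (c : Fin k → M),
        (∀ j, c j ∈ A) ∧ φ.Realize (Sum.elim (fun _ => x) c) ∧
        {y : M | φ.Realize (Sum.elim (fun _ => y) c)}.Finite}

/-- `T` eliminates the quantifier `∃^∞`. -/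
def EliminatesExInf (T : L.Theory) : Prop :=
  ∀ (k : ℕ) (φ : L.Formula (Fin 1 ⊕ Fin k)), ∃ N : ℕ,
    ∀ (M : Theory.ModelType.{u, v, max u v} T) (c : Fin k → M),
      (∃ s : Finset M, N ≤ s.card ∧ ∀ x ∈ s, φ.Realize (Sum.elim (fun _ => x) c)) →
      {x : (M : Type (max u v)) | φ.Realize (Sum.elim (fun _ => x) c)}.Infinite

/-- Algebraic closure satisfies the exchange property in every model of `T`. -/
def AclExchange (T : L.Theory) : Prop :=
  ∀ (M : Theory.ModelType.{u, v, max u v} T) (A : Set M) (a b : M),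
    a ∈ acl L M (A ∪ {b}) → a ∉ acl L M A → b ∈ acl L M (A ∪ {a})

/-- A geometric theory: complete, eliminates `∃^∞`, and `acl` satisfies exchange. -/
def IsGeometric (T : L.Theory) : Prop :=
  T.IsComplete ∧ EliminatesExInf T ∧ AclExchange T

end Acl

section Types

variable {L : FirstOrder.Language.{u, v}}

structure ParamFormula (L : FirstOrder.Language.{u, v}) (N : Type w) : Type (max u v w) where
  k : ℕ
  toFormula : L.Formula (Fin 1 ⊕ Fin k)
  params : Fin k → N

def ParamFormula.RealizeIn {N : Type w} (S : L.Structure N)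
    (pf : ParamFormula L N) (x : N) : Prop :=
  @Formula.Realize L N S _ pf.toFormula (Sum.elim (fun _ => x) pf.params)

def ParamFormula.neg {N : Type w} (pf : ParamFormula L N) : ParamFormula L N :=
  ⟨pf.k, pf.toFormula.not, pf.params⟩

def IsCompleteTypeOver {N : Type w} (S : L.Structure N) (C : Set N)
    (q : Set (ParamFormula L N)) : Prop :=
  (∀ pf ∈ q, ∀ j, pf.params j ∈ C) ∧
  (∀ pf : ParamFormula L N, (∀ j, pf.params j ∈ C) → (pf ∈ q ∨ pf.neg ∈ q)) ∧
  (∀ F : Finset (ParamFormula L N), ↑F ⊆ q → ∃ x : N, ∀ pf ∈ F, pf.RealizeIn S x)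

def IsNonAlgebraic {N : Type w} (S : L.Structure N) (q : Set (ParamFormula L N)) : Prop :=
  ∀ pf ∈ q, {x : N | pf.RealizeIn S x}.Infinite

end Types

section Lovely

/-- The language consisting of a single unary predicate `H`. -/
def hLang : FirstOrder.Language.{u, v} := ⟨fun _ => PEmpty, fun n => ULift (PLift (n = 1))⟩

/-- The language `L_H = L ∪ {H}`. -/
abbrev LH (L : FirstOrder.Language.{u, v}) : FirstOrder.Language.{u, v} := L.sum hLang

/-- The predicate symbol `H`. -/
def hSym (L : FirstOrder.Language.{u, v}) : (LH L).Relations 1 := Sum.inr ⟨⟨rfl⟩⟩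

variable (L : FirstOrder.Language.{u, v}) (M : Type w) [(LH L).Structure M]

/-- The set `H(M)`. -/
def HSet : Set M := {x | Structure.RelMap (hSym L) ![x]}

/-- The `L`-reduct of an `L_H`-structure. -/
def lred : L.Structure M := (LHom.sumInl : L →ᴸ LH L).reduct M

/-- `(M, H(M))` is a dense/co-dense expansion: every non-algebraic 1-type in `L` over a
finite-dimensional set `A` has realizations both in `H(M)` and in `M ∖ acl_T(A ∪ H(M))`. -/
def IsDenseCodense : Prop :=
  ∀ A : Set M, (∃ B : Finset M, A ⊆ @acl L M (lred L M) ↑B) →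
    ∀ q : Set (ParamFormula L M), IsCompleteTypeOver (lred L M) A q →
      IsNonAlgebraic (lred L M) q →
      (∃ x ∈ HSet L M, ∀ pf ∈ q, pf.RealizeIn (lred L M) x) ∧
      (∃ y : M, y ∉ @acl L M (lred L M) (A ∪ HSet L M) ∧
        ∀ pf ∈ q, pf.RealizeIn (lred L M) y)

/-- `(M, H(M))` is a lovely pair of models of `T`: the `L`-reduct models `T`, it is a
dense/co-dense expansion, and `H(M)` is (the underlying set of) an elementary
`L`-substructure. -/
def IsLovelyPair (T : L.Theory) : Prop :=
  (@Theory.Model L M (lred L M) T) ∧ IsDenseCodense L M ∧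
    ∃ S : @Language.ElementarySubstructure L M (lred L M), (S : Set M) = HSet L M

/-- `(M, H(M))` is an H-structure associated with `T`: the `L`-reduct models `T`, it is a
dense/co-dense expansion, and `H(M)` is an `L`-algebraically independent set. -/
def IsHStructureExp (T : L.Theory) : Prop :=
  (@Theory.Model L M (lred L M) T) ∧ IsDenseCodense L M ∧
    ∀ x ∈ HSet L M, x ∉ @acl L M (lred L M) (HSet L M \ {x})

end Lovely


section Copies

/-- A labelling of the binary tree by relative addresses; `ev` turns it into a strong
embedding of the binary tree in itself. -/
abbrev Copy := List Bool → List Bool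

def shift (F : Copy) (s : List Bool) : Copy := fun x => F (s ++ x)

def ev : Copy → List Bool → List Bool
  | F, [] => F []
  | F, b :: η => F [] ++ b :: ev (shift F [b]) η

def comp : Copy → Copy → List Bool → List Bool
  | F, e, [] => ev F (e [])
  | F, e, b :: x => comp (shift F (e [] ++ [b])) (shift e [b]) x

def node (r : List Bool) (e₀ e₁ : Copy) : Copy
  | [] => r
  | false :: x => e₀ x
  | true :: x => e₁ x

def pre (b : Bool) (e : Copy) : Copy
  | [] => b :: e []
  | c :: x => e (c :: x)

def Bd (F : Copy) (n N : ℕ) : Prop := ∀ η : List Bool, η.length < n → (ev F η).length < N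

def Loc {γ : Type*} (k : ℕ) (χ : Copy → γ) : Prop :=
  ∀ e e' : Copy, (∀ η : List Bool, η.length < k → e η = e' η) → χ e = χ e'

@[simp] theorem ev_nil (F : Copy) : ev F [] = F [] := by simp [ev]

@[simp] theorem ev_cons (F : Copy) (b : Bool) (η : List Bool) :
    ev F (b :: η) = F [] ++ b :: ev (shift F [b]) η := by simp [ev]

@[simp] theorem shift_nil (F : Copy) : shift F [] = F := rfl

theorem shift_shift (F : Copy) (s t : List Bool) : shift (shift F s) t = shift F (s ++ t) := by
  funext x; simp [shift]

theorem ev_append (F : Copy) (s : List Bool) (b : Bool) (y : List Bool) :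
    ev F (s ++ b :: y) = ev F s ++ b :: ev (shift F (s ++ [b])) y := by
  induction s generalizing F with
  | nil => simp
  | cons c s ih => simp [ih, shift_shift]

theorem ev_comp (F e : Copy) (η : List Bool) : ev (comp F e) η = ev F (ev e η) := by
  induction η generalizing F e with
  | nil => simp [comp]
  | cons b η ih =>
    have : shift (comp F e) [b] = comp (shift F (e [] ++ [b])) (shift e [b]) := by
      funext x; simp [shift, comp]
    simp [this, ih, ev_append, comp]

theorem ev_injective {F F' : Copy} (h : ∀ η, ev F η = ev F' η) : F = F' := by
  funext η
  induction η generalizing F F' with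
  | nil => simpa using h []
  | cons b η ih =>
    have h0 : F [] = F' [] := by simpa using h []
    have := ih (F := shift F [b]) (F' := shift F' [b]) (fun x => by
      have := h (b :: x)
      simpa [h0] using this)
    simpa [shift] using this

theorem comp_assoc (F G e : Copy) : comp (comp F G) e = comp F (comp G e) :=
  ev_injective fun η => by simp only [ev_comp]

theorem ev_congr {k : ℕ} {e e' : Copy} (h : ∀ η : List Bool, η.length < k → e η = e' η)
    {η : List Bool} (hη : η.length < k) : ev e η = ev e' η := by
  induction η generalizing k e e' with
  | nil => simpa using h [] hη
  | cons b η ih =>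
    have h0 := h [] (by simp at hη ⊢; omega)
    obtain ⟨k, rfl⟩ : ∃ k', k = k' + 1 := ⟨k - 1, by simp at hη; omega⟩
    rw [ev_cons, ev_cons, h0, ih (k := k) (e := shift e [b]) (e' := shift e' [b])
      (fun x hx => h _ (by simpa using hx)) (by simpa using hη)]

theorem comp_congr {k : ℕ} (F : Copy) {e e' : Copy}
    (h : ∀ η : List Bool, η.length < k → e η = e' η)
    {η : List Bool} (hη : η.length < k) : comp F e η = comp F e' η := by
  induction η generalizing k F e e' with
  | nil => simp [comp, h [] hη]
  | cons b η ih =>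
    have h0 := h [] (by simp at hη ⊢; omega)
    obtain ⟨k, rfl⟩ : ∃ k', k = k' + 1 := ⟨k - 1, by simp at hη; omega⟩
    simp only [comp, h0]
    exact ih (k := k) _ (fun x hx => h _ (by simpa using hx)) (by simpa using hη)

@[simp] theorem node_nil (r e₀ e₁) : node r e₀ e₁ [] = r := rfl
@[simp] theorem shift_node_false (r e₀ e₁) : shift (node r e₀ e₁) [false] = e₀ := rfl
@[simp] theorem shift_node_true (r e₀ e₁) : shift (node r e₀ e₁) [true] = e₁ := rfl
@[simp] theorem pre_nil (b e) : pre b e [] = b :: e [] := rfl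
@[simp] theorem shift_pre (b c e) : shift (pre b e) [c] = shift e [c] := rfl

@[simp] theorem ev_pre (b : Bool) (e : Copy) (η) : ev (pre b e) η = b :: ev e η := by
  cases η <;> simp

theorem ev_const (η : List Bool) : ev (fun _ => []) η = η := by
  induction η with
  | nil => simp
  | cons b η ih =>
    have : shift (fun _ => []) [b] = fun _ => [] := rfl
    simp [this, ih]

theorem node_congr {k : ℕ} {e₀ e₁ e₀' e₁' : Copy} {r : List Bool}
    (h₀ : ∀ η : List Bool, η.length < k → e₀ η = e₀' η)
    (h₁ : ∀ η : List Bool, η.length < k → e₁ η = e₁' η)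
    {η : List Bool} (hη : η.length < k + 1) : node r e₀ e₁ η = node r e₀' e₁' η := by
  match η with
  | [] => rfl
  | false :: x => exact h₀ x (by simpa using hη)
  | true :: x => exact h₁ x (by simpa using hη)

theorem pre_congr {k : ℕ} {e e' : Copy} {b : Bool}
    (h : ∀ η : List Bool, η.length < k → e η = e' η)
    {η : List Bool} (hη : η.length < k) : pre b e η = pre b e' η := by
  match η with
  | [] => simp [pre, h [] hη]
  | c :: x => exact h _ hη

theorem Bd.comp {F e : Copy} {k n N : ℕ} (hF : Bd F n N) (he : Bd e k n) : Bd (comp F e) k N :=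
  fun η hη => by rw [ev_comp]; exact hF _ (he _ hη)

theorem Bd.mono {F : Copy} {n N N' : ℕ} (hF : Bd F n N) (h : N ≤ N') : Bd F n N' :=
  fun η hη => (hF η hη).trans_le h

theorem bd_const (n : ℕ) : Bd (fun _ => []) n n := fun η hη => by rwa [ev_const]

theorem length_le_ev (F : Copy) (η : List Bool) : (F η).length ≤ (ev F η).length := by
  induction η generalizing F with
  | nil => simp
  | cons b η ih =>
    have := ih (shift F [b])
    simp [shift] at this ⊢
    omega

theorem vertex_ramsey {γ : Type*} [Finite γ] (ns : γ → ℕ) :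
    ∃ m, ∀ c : List Bool → γ, ∃ i F, Bd F (ns i) m ∧
      ∀ η : List Bool, η.length < ns i → c (ev F η) = i := by
  classical
  have := Fintype.ofFinite γ
  induction hS : ∑ i, ns i using Nat.strong_induction_on generalizing ns with
  | _ S ih =>
  by_cases h0 : ∃ i, ns i = 0
  · obtain ⟨i, hi⟩ := h0
    refine ⟨0, fun c => ⟨i, fun _ => [], ?_, ?_⟩⟩
    · intro η hη; omega
    · intro η hη; omega
  push Not at h0
  have key : ∀ i, ∃ m, ∀ c : List Bool → γ, ∃ j F,
      Bd F (Function.update ns i (ns i - 1) j) m ∧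
      ∀ η : List Bool, η.length < Function.update ns i (ns i - 1) j → c (ev F η) = j := by
    intro i
    refine ih _ ?_ _ rfl
    rw [← hS]
    refine Finset.sum_lt_sum (fun j _ => ?_) ⟨i, Finset.mem_univ _, ?_⟩
    · by_cases hj : j = i
      · subst hj; simp
      · simp [Function.update_of_ne hj]
    · have := h0 i
      simp; omega
  choose m hm using key
  refine ⟨1 + ∑ i, m i, fun c => ?_⟩
  set i := c [] with hi
  have hmi : m i ≤ ∑ i, m i := Finset.single_le_sum (fun _ _ => Nat.zero_le _) (Finset.mem_univ i)
  have aux : ∀ b, (∃ j F, Bd F (ns j) (1 + ∑ i, m i) ∧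
      ∀ η : List Bool, η.length < ns j → c (ev F η) = j) ∨
      ∃ F, Bd F (ns i - 1) (m i) ∧ ∀ η : List Bool, η.length < ns i - 1 → c (b :: ev F η) = i := by
    intro b
    obtain ⟨j, F, h1, h2⟩ := hm i (fun x => c (b :: x))
    by_cases hj : j = i
    · subst hj
      right
      exact ⟨F, by simpa using h1, by simpa using h2⟩
    · left
      simp only [Function.update_of_ne hj] at h1 h2
      refine ⟨j, pre b F, fun η hη => ?_, fun η hη => ?_⟩
      · have := h1 η hη
        simp; omega
      · simpa using h2 η hη
  rcases aux false with h | ⟨F₀, h0a, h0b⟩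
  · exact h
  rcases aux true with h | ⟨F₁, h1a, h1b⟩
  · exact h
  refine ⟨i, node [] F₀ F₁, fun η hη => ?_, fun η hη => ?_⟩
  · match η with
    | [] => simp
    | false :: x => have := h0a x (by simp at hη; omega); simp; omega
    | true :: x => have := h1a x (by simp at hη; omega); simp; omega
  · match η with
    | [] => simp [hi]
    | false :: x => simpa using h0b x (by simp at hη; omega)
    | true :: x => simpa using h1b x (by simp at hη; omega)

instance finite_nd (n : ℕ) : Finite {η : List Bool // η.length < n} :=
  (List.finite_length_lt Bool n).to_subtype

def RamseyFor (k : ℕ) : Prop :=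
  ∀ (γ : Type) [Finite γ] (n : ℕ), ∃ N, ∀ χ : Copy → γ, Loc k χ → ∃ F, Bd F n N ∧
    ∀ e e', Bd e k n → Bd e' k n → χ (comp F e) = χ (comp F e')

theorem RamseyFor.prod {k : ℕ} (h : RamseyFor k) (γ : Type) [Finite γ] (n : ℕ) :
    ∃ N, ∀ χ : Copy → Copy → γ, (∀ e, Loc k (χ e)) → (∀ e, Loc k fun e' => χ e' e) →
      ∃ F₀ F₁, Bd F₀ n N ∧ Bd F₁ n N ∧ ∀ e₀ e₀' e₁ e₁', Bd e₀ k n → Bd e₀' k n → Bd e₁ k n →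
        Bd e₁' k n → χ (comp F₀ e₀) (comp F₁ e₁) = χ (comp F₀ e₀') (comp F₁ e₁') := by
  classical
  obtain ⟨N₁, hN₁⟩ := h γ n
  obtain ⟨N₀, hN₀⟩ := h
    (({η : List Bool // η.length < k} → {η : List Bool // η.length < N₁}) → γ) n
  refine ⟨max N₀ N₁, fun χ h1 h2 => ?_⟩
  obtain ⟨F₀, hF₀, hc₀⟩ := hN₀
    (fun e t => χ e fun η => if hη : η.length < k then (t ⟨η, hη⟩).1 else [])
    (fun e e' he => funext fun t => h2 _ _ _ he)
  have hc₀' : ∀ e₀ e₀' e₁, Bd e₀ k n → Bd e₀' k n → Bd e₁ k N₁ →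
      χ (comp F₀ e₀) e₁ = χ (comp F₀ e₀') e₁ := by
    intro e₀ e₀' e₁ h0 h0' hb
    have := congrFun (hc₀ e₀ e₀' h0 h0')
      fun η => ⟨e₁ η.1, (length_le_ev e₁ η.1).trans_lt (hb _ η.2)⟩
    rw [h1 (comp F₀ e₀) e₁ _ fun η hη => ?_, this, h1 (comp F₀ e₀') _ e₁ fun η hη => ?_]
    · simp [hη]
    · simp [hη]
  by_cases hex : ∃ e, Bd e k n
  swap
  · push Not at hex
    exact ⟨F₀, fun _ => [], hF₀.mono (le_max_left _ _),
      by
        obtain ⟨F, hF, -⟩ := hN₁ (fun e => χ e e) (fun e e' he => (h1 _ _ _ he).trans (h2 _ _ _ he))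
        intro η hη
        rw [ev_const]
        refine lt_of_le_of_lt ?_ ((hF.mono (le_max_right N₀ N₁)) η hη)
        clear hη hF
        induction η generalizing F with
        | nil => simp
        | cons b η ih => have := ih (shift F [b]); simp; omega, fun e₀ _ _ _ he => (hex _ he).elim⟩
  obtain ⟨e, he⟩ := hex
  obtain ⟨F₁, hF₁, hc₁⟩ := hN₁ (fun e₁ => χ (comp F₀ e) e₁) (h1 _)
  refine ⟨F₀, F₁, hF₀.mono (le_max_left _ _), hF₁.mono (le_max_right _ _),
    fun e₀ e₀' e₁ e₁' a b c d => ?_⟩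
  rw [hc₀' e₀ e _ a he (hF₁.comp c), hc₁ e₁ e₁' c d, hc₀' e₀' e _ b he (hF₁.comp d)]

theorem RamseyFor.fusion {k : ℕ} (h : RamseyFor k) (γ : Type) [Finite γ] (m : ℕ) :
    ∃ N, ∀ χ : Copy → γ, Loc (k + 1) χ → ∃ F, Bd F m N ∧
      ∀ e e', Bd e (k + 1) m → Bd e' (k + 1) m → e [] = e' [] →
        χ (comp F e) = χ (comp F e') := by
  induction m with
  | zero => exact ⟨0, fun χ _ => ⟨fun _ => [], bd_const 0, fun e e' he => by
      have := he [] (by simp); omega⟩⟩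
  | succ m ih =>
    obtain ⟨Nm, hNm⟩ := ih
    obtain ⟨N', hN'⟩ := h.prod γ Nm
    refine ⟨N' + 1, fun χ hχ => ?_⟩
    obtain ⟨F₀, F₁, hF₀, hF₁, hc⟩ := hN' (fun e₀ e₁ => χ (node [] e₀ e₁))
      (fun e₀ e₁ e₁' he => hχ _ _ fun η hη => node_congr (fun _ _ => rfl) he hη)
      (fun e₁ e₀ e₀' he => hχ _ _ fun η hη => node_congr he (fun _ _ => rfl) hη)
    obtain ⟨G₀, hG₀, hg₀⟩ := hNm (fun e => χ (pre false (comp F₀ e)))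
      (fun e e' he => hχ _ _ fun η hη => pre_congr (fun _ h' => comp_congr F₀ he h') hη)
    obtain ⟨G₁, hG₁, hg₁⟩ := hNm (fun e => χ (pre true (comp F₁ e)))
      (fun e e' he => hχ _ _ fun η hη => pre_congr (fun _ h' => comp_congr F₁ he h') hη)
    refine ⟨node [] (comp F₀ G₀) (comp F₁ G₁), fun η hη => ?_, fun e e' he he' hr => ?_⟩
    · match η with
      | [] => simp
      | false :: x =>
        have := (hF₀.comp hG₀) x (by simpa using hη)
        simpa using this
      | true :: x =>
        have := (hF₁.comp hG₁) x (by simpa using hη)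
        simpa using this
    · have hnode : ∀ e, Bd e (k + 1) (m + 1) → e [] = [] →
          comp (node [] (comp F₀ G₀) (comp F₁ G₁)) e =
            node [] (comp F₀ (comp G₀ (shift e [false]))) (comp F₁ (comp G₁ (shift e [true]))) ∧
          Bd (shift e [false]) k m ∧ Bd (shift e [true]) k m := by
        intro e he h0
        refine ⟨ev_injective fun η => ?_, fun η hη => ?_, fun η hη => ?_⟩
        · rw [ev_comp]
          match η with
          | [] => simp [h0]
          | false :: x => simp [h0, ev_comp]
          | true :: x => simp [h0, ev_comp]
        · have := he (false :: η) (by simpa using hη)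
          simpa [h0] using this
        · have := he (true :: η) (by simpa using hη)
          simpa [h0] using this
      have hpre : ∀ e, Bd e (k + 1) (m + 1) → ∀ b r, e [] = b :: r →
          ∃ e'', e = pre b e'' ∧ e'' [] = r ∧ Bd e'' (k + 1) m := by
        intro e he b r h0
        have heq : e = pre b (fun x => if x = [] then r else e x) := by
          funext x
          cases x <;> simp [pre, h0]
        refine ⟨fun x => if x = [] then r else e x, heq, by simp, fun η hη => ?_⟩
        have := he η hη
        rw [heq] at this
        simpa using this
      match h0 : e [] with
      | [] =>
        obtain ⟨h1, h2, h3⟩ := hnode e he h0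
        obtain ⟨h1', h2', h3'⟩ := hnode e' he' (hr ▸ h0)
        rw [h1, h1']
        exact hc _ _ _ _ (hG₀.comp h2) (hG₀.comp h2') (hG₁.comp h3) (hG₁.comp h3')
      | b :: r =>
        obtain ⟨d, rfl, hd, hdb⟩ := hpre e he b r h0
        obtain ⟨d', rfl, hd', hdb'⟩ := hpre e' he' b r (hr ▸ h0)
        have hpc : ∀ d, comp (node [] (comp F₀ G₀) (comp F₁ G₁)) (pre b d) =
            pre b (comp (bif b then F₁ else F₀) (comp (bif b then G₁ else G₀) d)) := by
          intro d
          apply ev_injective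
          intro η
          cases b <;> simp [ev_comp]
        rw [hpc, hpc]
        cases b
        · exact hg₀ _ _ hdb hdb' (hd.trans hd'.symm)
        · exact hg₁ _ _ hdb hdb' (hd.trans hd'.symm)

theorem ramseyFor (k : ℕ) : RamseyFor k := by
  classical
  induction k with
  | zero =>
    intro γ _ n
    exact ⟨n, fun χ hχ => ⟨fun _ => [], bd_const n, fun e e' _ _ => hχ _ _ fun η hη => by omega⟩⟩
  | succ k ih =>
    intro γ _ n
    obtain ⟨m, hm⟩ := vertex_ramsey (fun _ : γ => n)
    obtain ⟨N, hN⟩ := ih.fusion γ m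
    refine ⟨N, fun χ hχ => ?_⟩
    obtain ⟨F, hF, hc⟩ := hN χ hχ
    obtain ⟨i, G, hG, hi⟩ := hm fun η =>
      if h : ∃ e, Bd e (k + 1) m ∧ e [] = η then χ (comp F h.choose) else χ fun _ => []
    have key : ∀ e, Bd e (k + 1) n → χ (comp (comp F G) e) = i := by
      intro e he
      have hb := hG.comp he
      have hx : ∃ e', Bd e' (k + 1) m ∧ e' [] = ev G (e []) :=
        ⟨comp G e, hb, by simp [comp]⟩
      have h1 := hi (e []) (by simpa using he [] (by simp))
      rw [dif_pos hx] at h1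
      rw [comp_assoc, ← h1]
      exact hc _ _ hb hx.choose_spec.1 (by rw [hx.choose_spec.2]; simp [comp])
    exact ⟨comp F G, hF.comp hG, fun e e' he he' => (key e he).trans (key e' he').symm⟩

theorem list_trichotomy (η ν : List Bool) :
    η = ν ∨ (∃ b y, ν = η ++ b :: y) ∨ (∃ b y, η = ν ++ b :: y) ∨
      ∃ s b y y', η = s ++ b :: y ∧ ν = s ++ (!b) :: y' := by
  induction η generalizing ν with
  | nil => cases ν <;> simp
  | cons b η ih =>
    cases ν with
    | nil => simp
    | cons c ν =>
      by_cases hbc : c = b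
      · subst hbc
        rcases ih ν with h | ⟨b, y, h⟩ | ⟨b, y, h⟩ | ⟨s, b, y, y', h, h'⟩
        · simp [h]
        · right; left; exact ⟨b, y, by simp [h]⟩
        · right; right; left; exact ⟨b, y, by simp [h]⟩
        · right; right; right; exact ⟨c :: s, b, y, y', by simp [h], by simp [h']⟩
      · right; right; right
        refine ⟨[], b, η, ν, rfl, ?_⟩
        cases b <;> cases c <;> simp_all

theorem not_comparable_split (s y y' : List Bool) (b : Bool) :
    ¬ TreeComparable (s ++ b :: y) (s ++ (!b) :: y') := by
  rintro (h | h) <;> simp [List.prefix_append_right_inj] at h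

theorem ev_comparable (F : Copy) (η ν : List Bool) :
    TreeComparable (ev F η) (ev F ν) ↔ TreeComparable η ν := by
  rcases list_trichotomy η ν with h | ⟨b, y, rfl⟩ | ⟨b, y, rfl⟩ | ⟨s, b, y, y', rfl, rfl⟩
  · subst h; simp [TreeComparable]
  · simp [TreeComparable, ev_append]
  · simp [TreeComparable, ev_append]
  · simp only [ev_append, not_comparable_split]

theorem ev_inj (F : Copy) {η ν : List Bool} (h : ev F η = ev F ν) : η = ν := by
  rcases list_trichotomy η ν with h' | ⟨b, y, rfl⟩ | ⟨b, y, rfl⟩ | ⟨s, b, y, y', rfl, rfl⟩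
  · exact h'
  · simp [ev_append] at h
  · simp [ev_append] at h
  · simp [ev_append] at h

end Copies

section Patterns

variable {B B₁ B₂ A : Type*}

/-- A pattern of height `n` for the relation `R`. -/
def Pat (R : B → A → Prop) (n : ℕ) (a : List Bool → A) : Prop :=
  (∀ X : Set (List Bool), (∀ η ∈ X, η.length < n) → IsTreeAntichain X →
    ∃ b, ∀ η ∈ X, R b (a η)) ∧
  (∀ η ν : List Bool, η.length < n → ν.length < n → η ≠ ν → TreeComparable η ν →
    ¬ ∃ b, R b (a η) ∧ R b (a ν))

def HasPat (R : B → A → Prop) : Prop := ∀ n, ∃ a, Pat R n a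

theorem TreeComparable.symm {η ν : List Bool} (h : TreeComparable η ν) : TreeComparable ν η :=
  Or.symm h

theorem Pat.comp {R : B → A → Prop} {n N : ℕ} {a : List Bool → A} (h : Pat R N a)
    (f : List Bool → List Bool) (hlen : ∀ η : List Bool, η.length < n → (f η).length < N)
    (hf : ∀ η ν : List Bool, η.length < n → ν.length < n →
      (TreeComparable (f η) (f ν) ↔ TreeComparable η ν))
    (hinj : ∀ η ν : List Bool, f η = f ν → η = ν) :
    Pat R n (a ∘ f) := by
  refine ⟨fun X hX hA => ?_, fun η ν hη hν hne hc => ?_⟩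
  · obtain ⟨b, hb⟩ := h.1 (f '' X) (by rintro _ ⟨x, hx, rfl⟩; exact hlen x (hX x hx)) (by
      rintro _ ⟨x, hx, rfl⟩ _ ⟨y, hy, rfl⟩ hne hc
      exact hA x hx y hy (fun h => hne (by rw [h])) ((hf x y (hX x hx) (hX y hy)).1 hc))
    exact ⟨b, fun η hη => hb _ ⟨η, hη, rfl⟩⟩
  · exact h.2 _ _ (hlen η hη) (hlen ν hν) (fun h => hne (hinj _ _ h)) ((hf η ν hη hν).2 hc)

theorem Pat.ev {R : B → A → Prop} {n N : ℕ} {a : List Bool → A} (h : Pat R N a)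
    {F : Copy} (hF : Bd F n N) : Pat R n (a ∘ ev F) :=
  h.comp _ hF (fun η ν _ _ => ev_comparable F η ν) fun _ _ => ev_inj F

theorem Pat.mono {R : B → A → Prop} {n N : ℕ} {a : List Bool → A} (h : Pat R N a)
    (hn : n ≤ N) : Pat R n a :=
  h.comp id (fun _ hη => hη.trans_le hn) (fun _ _ _ _ => Iff.rfl) fun _ _ h => h

theorem HasPat.of_frequently {R : B → A → Prop} (h : ∀ n, ∃ N, n ≤ N ∧ ∃ a, Pat R N a) :
    HasPat R := fun n => by
  obtain ⟨N, hN, a, ha⟩ := h n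
  exact ⟨a, ha.mono hN⟩

/-! ### Incomparability lemmas -/

theorem incomp_append {x y : List Bool} (h : ¬ TreeComparable x y) (a b : List Bool) :
    ¬ TreeComparable (x ++ a) (y ++ b) := by
  rcases list_trichotomy x y with rfl | ⟨c, z, rfl⟩ | ⟨c, z, rfl⟩ | ⟨s, c, z, z', rfl, rfl⟩
  · simp [TreeComparable] at h
  · simp [TreeComparable] at h
  · simp [TreeComparable] at h
  · simpa using not_comparable_split s (z ++ a) (z' ++ b) c

theorem incomp_append_right {x y : List Bool} (h : ¬ TreeComparable x y) (b : List Bool) :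
    ¬ TreeComparable x (y ++ b) := by
  simpa using incomp_append h [] b

theorem comparable_append_left (p x y : List Bool) :
    TreeComparable (p ++ x) (p ++ y) ↔ TreeComparable x y := by
  simp [TreeComparable, List.prefix_append_right_inj]

theorem comparable_cons (b : Bool) (x y : List Bool) :
    TreeComparable (b :: x) (b :: y) ↔ TreeComparable x y :=
  comparable_append_left [b] x y

theorem IsTreeAntichain.mono {X Y : Set (List Bool)} (h : IsTreeAntichain Y) (hXY : X ⊆ Y) :
    IsTreeAntichain X := fun η hη ν hν => h η (hXY hη) ν (hXY hν)

/-- Insert the word `u` before each letter. -/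
def spread (u : List Bool) (x : List Bool) : List Bool := x.flatMap fun b => u ++ [b]

@[simp] theorem spread_nil (u) : spread u [] = [] := rfl
@[simp] theorem spread_cons (u b x) : spread u (b :: x) = u ++ b :: spread u x := by
  simp [spread]
@[simp] theorem spread_append (u x y) : spread u (x ++ y) = spread u x ++ spread u y := by
  simp [spread]

theorem spread_comparable (u η ν : List Bool) :
    TreeComparable (spread u η) (spread u ν) ↔ TreeComparable η ν := by
  rcases list_trichotomy η ν with rfl | ⟨b, y, rfl⟩ | ⟨b, y, rfl⟩ | ⟨s, b, y, y', rfl, rfl⟩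
  · simp [TreeComparable]
  · simp [TreeComparable]
  · simp [TreeComparable]
  · have := not_comparable_split (spread u s ++ u) (spread u y) (spread u y') b
    simp only [List.append_assoc] at this
    simp only [spread_append, spread_cons, this, not_comparable_split]

theorem spread_injective (u : List Bool) {η ν : List Bool} (h : spread u η = spread u ν) :
    η = ν := by
  rcases list_trichotomy η ν with h' | ⟨b, y, rfl⟩ | ⟨b, y, rfl⟩ | ⟨s, b, y, y', rfl, rfl⟩
  · exact h'
  · simp at h
  · simp at h
  · simp at h

theorem length_spread (u x : List Bool) : (spread u x).length = x.length * (u.length + 1) := by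
  induction x with
  | nil => simp
  | cons b x ih => simp [ih]; ring

/-! ### The copy used in the fibration lemma -/

def rootLabel (s : List Bool) : Copy
  | [] => s
  | _ :: _ => []

@[simp] theorem ev_rootLabel (s x : List Bool) : ev (rootLabel s) x = s ++ x := by
  cases x with
  | nil => simp [rootLabel]
  | cons b x =>
    have : shift (rootLabel s) [b] = fun _ => [] := rfl
    simp [this, ev_const, rootLabel]

/-- Apply the copy `e` inside the cone above `p`. -/
def ins : List Bool → Copy → Copy
  | [], e => e
  | false :: p, e => node [] (ins p e) fun _ => []
  | true :: p, e => node [] (fun _ => []) (ins p e)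

theorem ev_ins_append (p : List Bool) (e : Copy) (y : List Bool) :
    ev (ins p e) (p ++ y) = p ++ ev e y := by
  induction p with
  | nil => simp [ins]
  | cons b p ih => cases b <;> simp [ins, ih]

theorem ev_ins_of_not_above (p : List Bool) (e : Copy) (x : List Bool) (h : ¬ p <+: x) :
    ev (ins p e) x = x := by
  induction p generalizing x with
  | nil => simp at h
  | cons b p ih =>
    match b, x with
    | false, [] => simp [ins]
    | true, [] => simp [ins]
    | false, true :: x => simp [ins, ev_const]
    | true, false :: x => simp [ins, ev_const]
    | false, false :: x => simp [ins, ih x (by simpa using h)]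
    | true, true :: x => simp [ins, ih x (by simpa using h)]

/-! ### Families of sets of nodes -/

def treeSet (l : Finset (List Bool × ℕ)) : Set (List Bool) :=
  {x | ∃ a ∈ l, ∃ y : List Bool, y.length < a.2 ∧ x = a.1 ++ spread [false] y}

def antichainsIn (V : Set (List Bool)) : Set (Set (List Bool)) :=
  {Z | Z ⊆ V ∧ IsTreeAntichain Z}

def BddFam (𝒵 : Set (Set (List Bool))) : Prop :=
  ∃ s : ℕ, ∀ Z ∈ 𝒵, ∀ x ∈ Z, x.length < s

def cone (p u x : List Bool) : List Bool :=
  if p = x then u ++ [false] else if p <+: x then u ++ true :: x.drop (p.length + 1) else x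

@[simp] theorem cone_self (p u) : cone p u p = u ++ [false] := by simp [cone]
@[simp] theorem cone_append (p u c y) : cone p u (p ++ c :: y) = u ++ true :: y := by
  simp [cone, List.drop_append]
theorem cone_of_not_above {p u x} (h : ¬ p <+: x) : cone p u x = x := by
  have : p ≠ x := by rintro rfl; simp at h
  simp [cone, h, this]

theorem bddFam_antichainsIn_treeSet (l : Finset (List Bool × ℕ)) :
    BddFam (antichainsIn (treeSet l)) := by
  refine ⟨∑ a ∈ l, (a.1.length + 2 * a.2 + 1), ?_⟩
  rintro Z ⟨hZ, -⟩ x hx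
  obtain ⟨a, ha, y, hy, rfl⟩ := hZ hx
  have : a.1.length + 2 * a.2 + 1 ≤ ∑ a ∈ l, (a.1.length + 2 * a.2 + 1) :=
    Finset.single_le_sum (f := fun a : List Bool × ℕ => a.1.length + 2 * a.2 + 1)
      (fun _ _ => Nat.zero_le _) ha
  simp [length_spread]
  omega

theorem good_antichainsIn (G : Set (Set (List Bool)) → Prop)
    (hsing : ∀ X : Set (List Bool), BddFam {X} → IsTreeAntichain X → G {X})
    (hmono : ∀ 𝒵 𝒵', G 𝒵' → (∀ Z ∈ 𝒵, ∃ Z' ∈ 𝒵', Z ⊆ Z') → G 𝒵)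
    (hcopy : ∀ (e : Copy) 𝒵, BddFam 𝒵 → (∃ c, ∀ x, (ev e x).length ≤ x.length + c) →
      G (Set.image (ev e) '' 𝒵) → G 𝒵)
    (hpair : ∀ (t : List Bool → List Bool → List Bool) 𝒵, BddFam 𝒵 →
      (∀ Q : Finset (List Bool), IsTreeAntichain ↑Q → G (⋃ η ∈ Q, Set.image (t η) '' 𝒵)) →
      ∃ η b y, G (Set.image (t η) '' 𝒵 ∪ Set.image (t (η ++ b :: y)) '' 𝒵))
    (k : ℕ) (hk : 1 ≤ k) (l : Finset (List Bool × ℕ))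
    (hl : ∀ a ∈ l, ∀ b ∈ l, a ≠ b → ¬ TreeComparable a.1 b.1) (hlk : ∀ a ∈ l, a.2 ≤ k) :
    G (antichainsIn (treeSet l)) := by
  classical
  induction k, hk using Nat.le_induction generalizing l with
  | base =>
    have hb := bddFam_antichainsIn_treeSet l
    have hmem : treeSet l ∈ antichainsIn (treeSet l) := by
      refine ⟨subset_rfl, ?_⟩
      rintro _ ⟨a, ha, y, hy, rfl⟩ _ ⟨b, hb, z, hz, rfl⟩ hne
      have hy0 : y = [] := List.length_eq_zero_iff.1 (by have := hlk a ha; omega)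
      have hz0 : z = [] := List.length_eq_zero_iff.1 (by have := hlk b hb; omega)
      subst hy0 hz0
      simp only [spread_nil, List.append_nil] at hne ⊢
      exact hl a ha b hb fun h => hne (by rw [h])
    refine hmono _ _ (hsing (treeSet l) ?_ hmem.2) fun Z hZ => ⟨_, rfl, hZ.1⟩
    obtain ⟨s, hs⟩ := hb
    exact ⟨s, by rintro Z rfl; exact hs _ hmem⟩
  | succ k hk ih =>
    induction hj : (l.filter fun a => a.2 = k + 1).card using Nat.strong_induction_on
      generalizing l with
    | _ j ihj =>
    by_cases hex : ∃ a ∈ l, a.2 = k + 1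
    swap
    · push Not at hex
      exact ih l hl fun a ha => by have := hlk a ha; have := hex a ha; omega
    obtain ⟨⟨p, h⟩, hpl, rfl⟩ := hex
    set 𝒵 := antichainsIn (treeSet l) with h𝒵
    let u : List Bool → List Bool := fun η => p ++ spread [false, false] η
    -- every element of the family is `p`, in the left cone of `p`, or incomparable with `p`
    have hcases : ∀ x ∈ treeSet l, x = p ∨
        (∃ b y, y.length < k ∧ x = p ++ false :: b :: spread [false] y) ∨
        (¬ TreeComparable x p ∧ x ∈ treeSet (l.erase (p, k + 1))) := by
      rintro x ⟨a, ha, y, hy, rfl⟩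
      by_cases hap : a = (p, k + 1)
      · subst hap
        match y with
        | [] => simp
        | b :: y => exact Or.inr (Or.inl ⟨b, y, by simpa using hy, by simp⟩)
      · refine Or.inr (Or.inr ⟨?_, a, Finset.mem_erase.2 ⟨hap, ha⟩, y, hy, rfl⟩)
        simpa using incomp_append (hl a ha _ hpl hap) (spread [false] y) []
    have hnp : ∀ x, ¬ TreeComparable x p → ¬ p <+: x := fun x hx h => hx (Or.inr h)
    have hQ : ∀ Q : Finset (List Bool), IsTreeAntichain ↑Q →
        G (⋃ η ∈ Q, Set.image (cone p (u η)) '' 𝒵) := by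
      intro Q hQ
      let new : List Bool → Finset (List Bool × ℕ) := fun η =>
        {(u η ++ [false], 1), (u η ++ [true, false], k), (u η ++ [true, true], k)}
      set l' := l.erase (p, k + 1) ∪ Q.biUnion new with hl'
      have hnew : ∀ a ∈ Q.biUnion new, ∃ η ∈ Q, a = (u η ++ [false], 1) ∨
          a = (u η ++ [true, false], k) ∨ a = (u η ++ [true, true], k) := by
        intro a ha
        simpa [new] using ha
      have hpw : ∀ a ∈ l', ∀ b ∈ l', a ≠ b → ¬ TreeComparable a.1 b.1 := by
        have h1 : ∀ a ∈ l.erase (p, k + 1), ∀ b ∈ Q.biUnion new, ¬ TreeComparable a.1 b.1 := by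
          intro a ha b hb
          obtain ⟨hap, ha⟩ := Finset.mem_erase.1 ha
          have := hl a ha _ hpl hap
          obtain ⟨η, -, rfl | rfl | rfl⟩ := hnew b hb
          all_goals
            simp only [u, List.append_assoc]
            exact incomp_append_right this _
        have h2 : ∀ a ∈ Q.biUnion new, ∀ b ∈ Q.biUnion new, a ≠ b →
            ¬ TreeComparable a.1 b.1 := by
          intro a ha b hb hab
          obtain ⟨η, hη, ha⟩ := hnew a ha
          obtain ⟨ν, hν, hb⟩ := hnew b hb
          by_cases hην : η = ν
          · subst hην
            rcases ha with rfl | rfl | rfl <;> rcases hb with rfl | rfl | rfl <;>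
              simp [comparable_append_left] at hab ⊢ <;> simp [TreeComparable]
          · have h3 := hQ η hη ν hν hην
            rw [← spread_comparable [false, false], ← comparable_append_left p] at h3
            rcases ha with rfl | rfl | rfl <;> rcases hb with rfl | rfl | rfl <;>
              exact incomp_append h3 _ _
        intro a ha b hb hab
        rcases Finset.mem_union.1 ha with ha | ha <;> rcases Finset.mem_union.1 hb with hb | hb
        · exact hl a (Finset.mem_of_mem_erase ha) b (Finset.mem_of_mem_erase hb) hab
        · exact h1 a ha b hb
        · exact fun h => h1 b hb a ha h.symm
        · exact h2 a ha b hb hab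
      have hle : ∀ a ∈ l', a.2 ≤ k + 1 := by
        intro a ha
        rcases Finset.mem_union.1 ha with ha | ha
        · exact hlk a (Finset.mem_of_mem_erase ha)
        · obtain ⟨η, -, rfl | rfl | rfl⟩ := hnew a ha <;> simp
      have hcard : (l'.filter fun a => a.2 = k + 1).card < j := by
        rw [← hj]
        refine Finset.card_lt_card ⟨fun a ha => ?_, fun hsub => ?_⟩
        · obtain ⟨ha, hak⟩ := Finset.mem_filter.1 ha
          rcases Finset.mem_union.1 ha with ha | ha
          · exact Finset.mem_filter.2 ⟨Finset.mem_of_mem_erase ha, hak⟩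
          · obtain ⟨η, -, rfl | rfl | rfl⟩ := hnew a ha <;> simp at hak <;> omega
        · have := hsub (Finset.mem_filter.2 ⟨hpl, rfl⟩)
          obtain ⟨ha, hak⟩ := Finset.mem_filter.1 this
          rcases Finset.mem_union.1 ha with ha | ha
          · simp at ha
          · obtain ⟨η, -, h | h | h⟩ := hnew _ ha <;> simp [Prod.ext_iff] at h <;> omega
      refine hmono _ _ (ihj _ hcard l' hpw hle rfl) fun Z' hZ' => ⟨Z', ?_, subset_rfl⟩
      simp only [Set.mem_iUnion] at hZ'
      obtain ⟨η, hη, Z, ⟨hZV, hZA⟩, rfl⟩ := hZ'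
      refine ⟨?_, ?_⟩
      · rintro _ ⟨x, hx, rfl⟩
        rcases hcases x (hZV hx) with rfl | ⟨b, y, hy, rfl⟩ | ⟨hxp, a, ha, y, hy, rfl⟩
        · refine ⟨(u η ++ [false], 1), ?_, [], by simp, by simp⟩
          refine Finset.mem_union_right _ (Finset.mem_biUnion.2 ⟨η, hη, by simp [new]⟩)
        · refine ⟨(u η ++ [true, b], k), ?_, y, by simpa using hy, by simp⟩
          refine Finset.mem_union_right _ (Finset.mem_biUnion.2 ⟨η, hη, ?_⟩)
          cases b <;> simp [new]
        · rw [cone_of_not_above (hnp _ hxp)]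
          exact ⟨a, Finset.mem_union_left _ ha, y, hy, rfl⟩
      · have hout : ∀ x, ¬ TreeComparable x p → ∀ z, ¬ TreeComparable x (u η ++ z) := by
          intro x hx z
          simp only [u, List.append_assoc]
          exact incomp_append_right hx _
        rintro _ ⟨x, hx, rfl⟩ _ ⟨x', hx', rfl⟩ hne
        have hxx : x ≠ x' := fun h => hne (by rw [h])
        have hxx' := hZA x hx x' hx' hxx
        rcases hcases x (hZV hx) with rfl | ⟨b, y, hy, rfl⟩ | ⟨hxp, -⟩ <;>
          rcases hcases x' (hZV hx') with rfl | ⟨b', y', hy', rfl⟩ | ⟨hxp', -⟩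
        · exact (hxx rfl).elim
        · exact (hxx' (by simp [TreeComparable])).elim
        · rw [cone_of_not_above (hnp _ hxp'), cone_self]
          exact fun h => hout _ hxp' _ h.symm
        · exact (hxx' (by simp [TreeComparable])).elim
        · simpa [comparable_append_left, comparable_cons] using hxx'
        · rw [cone_of_not_above (hnp _ hxp'), cone_append]
          exact fun h => hout _ hxp' _ h.symm
        · rw [cone_of_not_above (hnp _ hxp), cone_self]
          exact hout _ hxp _
        · rw [cone_of_not_above (hnp _ hxp), cone_append]
          exact hout _ hxp _
        · rwa [cone_of_not_above (hnp _ hxp), cone_of_not_above (hnp _ hxp')]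
    have hbdd : BddFam 𝒵 := bddFam_antichainsIn_treeSet l
    obtain ⟨η, b, y, hG⟩ := hpair (fun η => cone p (u η)) 𝒵 hbdd hQ
    set e : Copy := ins p (node (spread [false, false] η ++ [false])
      (rootLabel (b :: spread [false, false] y ++ [true])) fun _ => []) with he
    have ep : ev e p = u η ++ [false] := by
      have := ev_ins_append p (node (spread [false, false] η ++ [false])
        (rootLabel (b :: spread [false, false] y ++ [true])) fun _ => []) []
      rw [List.append_nil] at this
      rw [he, this]; simp [u]
    have e0 : ∀ z, ev e (p ++ false :: z) = u (η ++ b :: y) ++ true :: z := by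
      intro z
      rw [he, ev_ins_append]
      simp [u]
    have e1 : ∀ z, ev e (p ++ true :: z) = u η ++ false :: true :: z := by
      intro z
      rw [he, ev_ins_append]
      simp [u, ev_const]
    have eo : ∀ z, ¬ p <+: z → ev e z = z := fun z hz => ev_ins_of_not_above _ _ _ hz
    refine hcopy e 𝒵 hbdd ⟨(u (η ++ b :: y)).length + (u η).length + 2, fun x => ?_⟩
      (hmono _ _ hG ?_)
    · by_cases hx : p <+: x
      · obtain ⟨z, rfl⟩ := hx
        match z with
        | [] => simp [ep]; omega
        | false :: z => simp only [e0]; simp; omega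
        | true :: z => simp only [e1]; simp; omega
      · rw [eo x hx]; omega
    · rintro _ ⟨Z, hZ, rfl⟩
      by_cases hpZ : p ∈ Z
      · refine ⟨cone p (u η) '' Z, Or.inl ⟨Z, hZ, rfl⟩, ?_⟩
        rintro _ ⟨x, hx, rfl⟩
        refine ⟨x, hx, ?_⟩
        by_cases hxp : x = p
        · subst hxp; simp [ep]
        · have := hnp x (hZ.2 x hx p hpZ hxp)
          rw [cone_of_not_above this, eo x this]
      · refine ⟨cone p (u (η ++ b :: y)) '' Z, Or.inr ⟨Z, hZ, rfl⟩, ?_⟩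
        rintro _ ⟨x, hx, rfl⟩
        refine ⟨x, hx, ?_⟩
        rcases hcases x (hZ.1 hx) with rfl | ⟨b', y', hy, rfl⟩ | ⟨hxp, -⟩
        · exact (hpZ hx).elim
        · rw [cone_append, e0]
        · rw [cone_of_not_above (hnp _ hxp), eo x (hnp _ hxp)]

end Patterns

section Fibration

variable {B B₁ B₂ A A' : Type*}

theorem Pat.map {R : B → A → Prop} {R' : B → A' → Prop} {n : ℕ} {a : List Bool → A}
    (h : Pat R n a) (g : A → A') (hg : ∀ b η, R b (a η) ↔ R' b (g (a η))) :
    Pat R' n (g ∘ a) := by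
  simpa only [Pat, hg, Function.comp] using h

def Cons (R : B₁ → B₂ → A → Prop) (b₁ : B₁) (𝒵 : Set (Set (List Bool))) (f : List Bool → A) :
    Prop :=
  ∀ Z ∈ 𝒵, ∃ b₂, ∀ η ∈ Z, R b₁ b₂ (f η)

theorem exists_invariant_pattern (R : B₁ → B₂ → A → Prop)
    (h : HasPat fun (b : B₁ × B₂) a => R b.1 b.2 a) (n : ℕ) :
    ∃ α : List Bool → A, Pat (fun (b : B₁ × B₂) a => R b.1 b.2 a) (2 * n) α ∧
      ∀ e, Bd e n (2 * n) → ∀ 𝒵 : Set (Set (List Bool)), (∀ Z ∈ 𝒵, ∀ x ∈ Z, x.length < n) →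
        (∃ c, Cons R c 𝒵 (α ∘ ev e)) → ∃ c, Cons R c 𝒵 α := by
  obtain ⟨N, hN⟩ := ramseyFor n (Set (Set (Set {η : List Bool // η.length < n}))) (2 * n)
  obtain ⟨a, ha⟩ := h N
  obtain ⟨F, hF, hinv⟩ := hN
    (fun e => {𝒵 : Set (Set {η : List Bool // η.length < n}) | ∃ c, ∀ Z ∈ 𝒵, ∃ b₂, ∀ η ∈ Z, R c b₂ (a (ev e η.1))}) (fun e e' he => by
      have : ∀ η : {η : List Bool // η.length < n}, ev e η.1 = ev e' η.1 :=
        fun η => ev_congr he η.2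
      simp only [this])
  refine ⟨a ∘ ev F, ha.ev hF, fun e he 𝒵 h𝒵 hc => ?_⟩
  have key : ∀ e', (∃ c, Cons R c 𝒵 (a ∘ ev F ∘ ev e')) ↔
      (Set.image (fun Z : Set (List Bool) => {η : {η : List Bool // η.length < n} | η.1 ∈ Z}) 𝒵) ∈
        {𝒵 : Set (Set {η : List Bool // η.length < n}) |
          ∃ c, ∀ Z ∈ 𝒵, ∃ b₂, ∀ η ∈ Z, R c b₂ (a (ev (comp F e') η.1))} := by
    intro e'
    simp only [Cons, Set.mem_ofPred_eq, Set.forall_mem_image, ev_comp, Function.comp]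
    refine exists_congr fun c => forall₂_congr fun Z hZ => exists_congr fun b₂ => ?_
    exact ⟨fun h η hη => h _ hη, fun h η hη => h ⟨η, h𝒵 Z hZ η hη⟩ hη⟩
  have h1 := (key e).1 hc
  rw [hinv e (fun _ => []) he ((bd_const n).mono (by omega)), ← key] at h1
  simpa [Function.comp_def, ev_const] using h1

theorem fibration (R : B₁ → B₂ → A → Prop) (h : HasPat fun (b : B₁ × B₂) a => R b.1 b.2 a) :
    (∃ (s : ℕ) (𝒵 : Set (Set {η : List Bool // η.length < s})),
      HasPat fun b₁ (t : {η : List Bool // η.length < s} → A) =>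
        ∀ Z ∈ 𝒵, ∃ b₂, ∀ η ∈ Z, R b₁ b₂ (t η)) ∨
    ∀ k, ∃ b₁ a, Pat (R b₁) k a := by
  classical
  by_contra! hcon
  obtain ⟨hno, k, hk⟩ := hcon
  have hneg : ∀ 𝒵, BddFam 𝒵 → ¬ HasPat fun b₁ (f : List Bool → A) => Cons R b₁ 𝒵 f := by
    rintro 𝒵 ⟨s, hs⟩ hp
    refine hno s ((fun Z : Set (List Bool) =>
      {η : {η : List Bool // η.length < s} | η.1 ∈ Z}) '' 𝒵) fun n => ?_
    obtain ⟨a, ha⟩ := hp n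
    refine ⟨_, ha.map (fun f η => f η.1) fun b η => ?_⟩
    simp only [Cons, Set.forall_mem_image]
    refine forall₂_congr fun Z hZ => exists_congr fun b₂ => ?_
    exact ⟨fun h η hη => h _ hη, fun h η hη => h ⟨η, hs Z hZ η hη⟩ hη⟩
  choose α hα hinv using exists_invariant_pattern R h
  let G : Set (Set (List Bool)) → Prop := fun 𝒵 =>
    ∀ᶠ n in (Filter.hyperfilter ℕ : Filter ℕ), ∃ c, Cons R c 𝒵 (α n)
  have hlarge : ∀ s : ℕ, ∀ᶠ n in (Filter.hyperfilter ℕ : Filter ℕ), s ≤ n := fun s =>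
    Nat.hyperfilter_le_atTop (Filter.eventually_ge_atTop s)
  have hgood := good_antichainsIn G ?_ ?_ ?_ ?_ (k + 1) (by omega) {([], k)} (by simp)
    (by simp)
  · obtain ⟨n, ⟨c, hc⟩, hn⟩ := (hgood.and (hlarge (k + 1))).exists
    refine hk c (α n ∘ spread [false]) ⟨fun X hX hA => ?_, fun η ν hη hν hne hcomp => ?_⟩
    · have hX' : spread [false] '' X ∈ antichainsIn (treeSet {([], k)}) := by
        refine ⟨?_, ?_⟩
        · rintro _ ⟨x, hx, rfl⟩
          exact ⟨([], k), by simp, x, hX x hx, rfl⟩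
        · rintro _ ⟨x, hx, rfl⟩ _ ⟨y, hy, rfl⟩ hne hcomp
          exact hA x hx y hy (fun h => hne (by rw [h])) ((spread_comparable _ _ _).1 hcomp)
      obtain ⟨b₂, hb₂⟩ := hc _ hX'
      exact ⟨b₂, fun η hη => hb₂ _ ⟨η, hη, rfl⟩⟩
    · rintro ⟨b₂, h1, h2⟩
      refine (hα n).2 _ _ ?_ ?_ (fun h => hne (spread_injective _ h))
        ((spread_comparable [false] _ _).2 hcomp) ⟨(c, b₂), h1, h2⟩
      · simp [length_spread]; omega
      · simp [length_spread]; omega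
  · rintro X ⟨s, hs⟩ hX
    filter_upwards [hlarge s] with n hn
    obtain ⟨b, hb⟩ := (hα n).1 X (fun η hη => by have := hs X rfl η hη; omega) hX
    exact ⟨b.1, by rintro Z rfl; exact ⟨b.2, hb⟩⟩
  · intro 𝒵 𝒵' hG hsub
    filter_upwards [hG] with n hn
    obtain ⟨c, hc⟩ := hn
    refine ⟨c, fun Z hZ => ?_⟩
    obtain ⟨Z', hZ', hZZ⟩ := hsub Z hZ
    obtain ⟨b₂, hb⟩ := hc Z' hZ'
    exact ⟨b₂, fun η hη => hb η (hZZ hη)⟩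
  · rintro e 𝒵 ⟨s, hs⟩ ⟨c, hc⟩ hG
    filter_upwards [hG, hlarge (s + c + 1)] with n hn hn'
    refine hinv n e (fun η hη => ?_) 𝒵 (fun Z hZ x hx => ?_) ?_
    · have := hc η; omega
    · have := hs Z hZ x hx; omega
    · simpa [Cons, Set.forall_mem_image] using hn
  · intro t 𝒵 h𝒵 hQ
    have := hneg 𝒵 h𝒵
    simp only [HasPat, not_forall, not_exists] at this
    obtain ⟨n₀, hn₀⟩ := this
    have hev : ∀ᶠ n in (Filter.hyperfilter ℕ : Filter ℕ),
        ∀ X : Set {η : List Bool // η.length < n₀}, IsTreeAntichain (Subtype.val '' X) →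
          ∃ c, Cons R c (⋃ η ∈ Subtype.val '' X, Set.image (t η) '' 𝒵) (α n) := by
      rw [Filter.eventually_all]
      intro X
      by_cases hX : IsTreeAntichain (Subtype.val '' X)
      · have hfin : (Subtype.val '' X).Finite := (Set.toFinite X).image _
        have := hQ hfin.toFinset (by simpa using hX)
        filter_upwards [this] with n hn _
        simpa using hn
      · exact Filter.Eventually.of_forall fun _ h => (hX h).elim
    have hex : ∀ᶠ n in (Filter.hyperfilter ℕ : Filter ℕ),
        ∃ q : {η : List Bool // η.length < n₀} × {η : List Bool // η.length < n₀},
          (∃ b y, q.2.1 = q.1.1 ++ b :: y) ∧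
          ∃ c, Cons R c (Set.image (t q.1) '' 𝒵 ∪ Set.image (t q.2) '' 𝒵) (α n) := by
      filter_upwards [hev] with n hn
      have hnp := hn₀ fun η x => α n (t η x)
      have hcons : ∀ X : Set (List Bool), (∀ η ∈ X, η.length < n₀) → IsTreeAntichain X →
          ∃ b, ∀ η ∈ X, Cons R b 𝒵 fun x => α n (t η x) := by
        intro X hX hA
        have hXX : Subtype.val '' {η : {η : List Bool // η.length < n₀} | η.1 ∈ X} = X := by
          ext η; simpa using hX η
        obtain ⟨c, hc⟩ := hn {η | η.1 ∈ X} (by rwa [hXX])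
        rw [hXX] at hc
        refine ⟨c, fun η hη Z hZ => ?_⟩
        obtain ⟨b₂, hb⟩ := hc (t η '' Z) (Set.mem_biUnion hη ⟨Z, hZ, rfl⟩)
        exact ⟨b₂, fun x hx => hb _ ⟨x, hx, rfl⟩⟩
      simp only [Pat, not_and, not_forall, not_not] at hnp
      obtain ⟨η, ν, hη, hν, hne, hcomp, b, h1, h2⟩ := hnp hcons
      have hE : ∀ η ν, Cons R b 𝒵 (fun x => α n (t η x)) → Cons R b 𝒵 (fun x => α n (t ν x)) →
          Cons R b (Set.image (t η) '' 𝒵 ∪ Set.image (t ν) '' 𝒵) (α n) := by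
        rintro η ν h1 h2 _ (⟨Z, hZ, rfl⟩ | ⟨Z, hZ, rfl⟩)
        · simpa using h1 Z hZ
        · simpa using h2 Z hZ
      have hpre : ∀ η ν : List Bool, η ≠ ν → η <+: ν → ∃ b y, ν = η ++ b :: y := by
        rintro η _ hne ⟨z, rfl⟩
        match z with
        | [] => simp at hne
        | b :: y => exact ⟨b, y, rfl⟩
      rcases hcomp with hp | hp
      · exact ⟨(⟨η, hη⟩, ⟨ν, hν⟩), hpre _ _ hne hp, b, hE _ _ h1 h2⟩
      · exact ⟨(⟨ν, hν⟩, ⟨η, hη⟩), hpre _ _ hne.symm hp, b, hE _ _ h2 h1⟩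
    rw [Ultrafilter.eventually_exists_iff] at hex
    obtain ⟨⟨η, ν⟩, hq⟩ := hex
    obtain ⟨n, ⟨b, y, hby⟩, -⟩ := hq.exists
    refine ⟨η.1, b, y, ?_⟩
    filter_upwards [hq] with n hn
    simpa [← hby] using hn.2

/-- A relation with patterns, whose realizations carry a color in a finite set, has patterns
with constant color. -/
theorem HasPat.const_color {J : Type*} [Finite J] (R : J → B → A → Prop)
    (h : HasPat fun (b : J × B) a => R b.1 b.2 a) : ∃ j, HasPat (R j) := by
  have key : ∀ k, ∃ b₁ a, Pat (R b₁) k a := by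
    rcases fibration R h with ⟨s, 𝒵, hp⟩ | hk
    · exfalso
      obtain ⟨a, ha⟩ := hp (Nat.card J + 1)
      have hx : ∀ i : Fin (Nat.card J + 1), ∃ j : J, ∀ Z ∈ 𝒵, ∃ b₂, ∀ η ∈ Z,
          R j b₂ (a (List.replicate i true) η) := by
        intro i
        obtain ⟨b, hb⟩ := ha.1 {List.replicate i true} (by simp; omega)
          (by rintro _ rfl _ rfl h; exact (h rfl).elim)
        exact ⟨b, hb _ rfl⟩
      choose g hg using hx
      have : Function.Injective g := by
        intro i i' hii
        by_contra hne
        refine ha.2 (List.replicate i true) (List.replicate i' true) (by simp; omega)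
          (by simp; omega) ?_ ?_
          ⟨g i, hg i, hii ▸ hg i'⟩
        · intro h
          apply hne
          have := congrArg List.length h
          simpa [Fin.ext_iff] using this
        · rcases le_total i.1 i'.1 with h | h
          · exact Or.inl ⟨List.replicate (i'.1 - i.1) true, by simp [h]⟩
          · exact Or.inr ⟨List.replicate (i.1 - i'.1) true, by simp [h]⟩
      have := Nat.card_le_card_of_injective g this
      simp at this
    · exact hk
  choose g a ha using key
  obtain ⟨j, hj⟩ : ∃ j, ∃ᶠ n in Filter.atTop, g n = j := by
    by_contra! hcon
    obtain ⟨n, hn⟩ := (Filter.eventually_all.2 hcon).exists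
    exact hn (g n) rfl
  refine ⟨j, HasPat.of_frequently fun n => ?_⟩
  obtain ⟨N, hN, hgN⟩ := Filter.frequently_atTop.1 hj n
  exact ⟨N, hN, a N, hgN ▸ ha N⟩

/-- Patterns whose parameters carry a color in a finite set can be chosen with parameters of a
constant color. -/
theorem HasPat.const_param_color {J : Type} [Finite J] {R : B → A → Prop} (P : J → A → Prop)
    (h : ∀ n, ∃ a, Pat R n a ∧ ∀ η : List Bool, η.length < n → ∃ j, P j (a η)) :
    ∃ j, ∀ n, ∃ a, Pat R n a ∧ ∀ η : List Bool, η.length < n → P j (a η) := by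
  classical
  have key : ∀ n, ∃ j, ∃ a, Pat R n a ∧ ∀ η : List Bool, η.length < n → P j (a η) := by
    intro n
    by_cases hJ : Nonempty J
    · obtain ⟨m, hm⟩ := vertex_ramsey fun _ : J => n
      obtain ⟨a, ha, hP⟩ := h m
      obtain ⟨j, F, hF, hj⟩ := hm fun η => if hη : η.length < m then (hP η hη).choose
        else Classical.choice hJ
      refine ⟨j, a ∘ ev F, ha.ev hF, fun η hη => ?_⟩
      have := hj η hη
      rw [dif_pos (hF η hη)] at this
      rw [← this]
      exact (hP _ (hF η hη)).choose_spec
    · obtain ⟨a, -, hP⟩ := h 1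
      exact (hJ ⟨(hP [] (by simp)).choose⟩).elim
  choose g hg using key
  obtain ⟨j, hj⟩ : ∃ j, ∃ᶠ n in Filter.atTop, g n = j := by
    by_contra! hcon
    obtain ⟨n, hn⟩ := (Filter.eventually_all.2 hcon).exists
    exact hn (g n) rfl
  refine ⟨j, fun n => ?_⟩
  obtain ⟨N, hN, hgN⟩ := Filter.frequently_atTop.1 hj n
  obtain ⟨a, ha, hP⟩ := hgN ▸ hg N
  exact ⟨a, ha.mono hN, fun η hη => hP η (hη.trans_le hN)⟩

end Fibration

section Compactness

/-- Compactness, in the form of realization of partial types in elementary extensions. -/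
theorem exists_realization_formula {K : FirstOrder.Language.{u, v}} {T' : K.Theory} {γ β : Type}
    {ι : Type (max u v)} (φ : ι → K.Formula (γ ⊕ β)) (N : Theory.ModelType.{u, v, max u v} T')
    (w : γ → N) (h : ∀ s : Finset ι, ∃ z : β → N, ∀ i ∈ s, (φ i).Realize (Sum.elim w z)) :
    ∃ (N' : Theory.ModelType.{u, v, max u v} T') (e : N ↪ₑ[K] N') (z : β → N'),
      ∀ i, (φ i).Realize (Sum.elim (e ∘ w) z) := by
  classical
  choose z hz using h
  let U : Ultrafilter (Finset ι) := Ultrafilter.of Filter.atTop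
  let D : Type (max u v) := (U : Filter (Finset ι)).Product fun _ => (N : Type (max u v))
  let q : (Finset ι → N) → D :=
    Quotient.mk ((U : Filter (Finset ι)).productSetoid fun _ => (N : Type (max u v)))
  have key : ∀ {δ : Type} (ψ : K.Formula δ) (x : δ → Finset ι → N),
      ψ.Realize (fun i => q (x i)) ↔ ∀ᶠ a in (U : Filter (Finset ι)), ψ.Realize fun i => x i a :=
    fun ψ x => Ultraproduct.realize_formula_cast (M := fun _ => (N : Type (max u v))) (u := U) ψ x
  have hmod : D ⊨ T' := by
    refine ⟨fun ψ hψ => ?_⟩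
    refine (Ultraproduct.sentence_realize (M := fun _ => (N : Type (max u v))) (u := U) ψ).2 ?_
    exact Filter.Eventually.of_forall fun _ => Theory.realize_sentence_of_mem T' hψ
  have : Nonempty D := Ultraproduct.Product.instNonempty
  let e : N ↪ₑ[K] D :=
    { toFun := fun x => q fun _ => x
      map_formula' := fun n ψ x => by
        refine (key ψ fun i _ => x i).trans ?_
        exact Filter.eventually_const }
  refine ⟨Theory.ModelType.of T' D, e, fun i => q fun a => z a i, fun i => ?_⟩
  have h1 : (Sum.elim (e ∘ w) fun i => q fun a => z a i) =
      fun j => q fun a => Sum.elim w (z a) j := by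
    funext j; cases j <;> rfl
  have hmem : ∀ᶠ a in (Filter.atTop : Filter (Finset ι)), i ∈ a :=
    Filter.eventually_atTop.2 ⟨{i}, fun a ha => ha (Finset.mem_singleton_self i)⟩
  have h2 := (key (φ i) fun j a => Sum.elim w (z a) j).2
    ((hmem.filter_mono (Ultrafilter.of_le _)).mono fun a ha => by
      have := hz a i ha
      exact this)
  rw [← h1] at h2
  exact h2

end Compactness

section Definable

variable {L : FirstOrder.Language.{u, v}} {T' : (LH L).Theory}

/-- Models of an `L_H`-theory in the universe of the language. -/
abbrev Mdl (T' : (LH L).Theory) := Theory.ModelType.{u, v, max u v} T'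

instance redStr (N : Mdl T') : L.Structure N := lred L N

instance redStr_expansion (N : Mdl T') : (LHom.sumInl : L →ᴸ LH L).IsExpansionOn N :=
  (LHom.sumInl : L →ᴸ LH L).isExpansionOn_reduct N

/-- Uniform definability in the models of `T'`, by a single `K`-formula. -/
def UDef (K : FirstOrder.Language.{u, v}) [∀ N : Mdl T', K.Structure N] {γ : Type}
    (P : ∀ N : Mdl T', (γ → N) → Prop) : Prop :=
  ∃ φ : K.Formula γ, ∀ N v, φ.Realize v ↔ P N v

namespace UDef

variable {K : FirstOrder.Language.{u, v}} [∀ N : Mdl T', K.Structure N] {γ β : Type}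
  {P Q : ∀ N : Mdl T', (γ → N) → Prop}

theorem congr (hP : UDef K P) (h : ∀ N v, P N v ↔ Q N v) : UDef K Q := by
  obtain ⟨φ, hφ⟩ := hP
  exact ⟨φ, fun N v => (hφ N v).trans (h N v)⟩

theorem of_formula (φ : K.Formula γ) : UDef K fun (_ : Mdl T') v => φ.Realize v :=
  ⟨φ, fun _ _ => Iff.rfl⟩

theorem relabel (f : γ → β) (hP : UDef K P) : UDef K fun (N : Mdl T') v => P N fun i => v (f i) := by
  obtain ⟨φ, hφ⟩ := hP
  refine ⟨φ.relabel f, fun N v => ?_⟩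
  rw [Formula.realize_relabel, hφ]; rfl

theorem not (hP : UDef K P) : UDef K fun N v => ¬ P N v := by
  obtain ⟨φ, hφ⟩ := hP
  exact ⟨φ.not, fun N v => by rw [Formula.realize_not, hφ]⟩

theorem imp (hP : UDef K P) (hQ : UDef K Q) : UDef K fun N v => P N v → Q N v := by
  obtain ⟨φ, hφ⟩ := hP
  obtain ⟨ψ, hψ⟩ := hQ
  exact ⟨φ.imp ψ, fun N v => by rw [Formula.realize_imp, hφ, hψ]⟩

theorem and (hP : UDef K P) (hQ : UDef K Q) : UDef K fun N v => P N v ∧ Q N v :=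
  (hP.imp hQ.not).not.congr fun N v => by tauto

theorem or (hP : UDef K P) (hQ : UDef K Q) : UDef K fun N v => P N v ∨ Q N v :=
  (hP.not.imp hQ).congr fun N v => by tauto

theorem iff (hP : UDef K P) (hQ : UDef K Q) : UDef K fun N v => (P N v ↔ Q N v) :=
  ((hP.imp hQ).and (hQ.imp hP)).congr fun N v => by tauto

theorem const (p : Prop) : UDef K fun (N : Mdl T') (_ : γ → N) => p := by
  by_cases hp : p
  · exact ⟨⊤, fun N v => by simp [hp]⟩
  · exact ⟨⊥, fun N v => by simp [hp]⟩

theorem eq (i j : γ) : UDef K fun (N : Mdl T') (v : γ → N) => v i = v j :=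
  ⟨(Term.var i).equal (Term.var j), fun N v => by simp [Formula.realize_equal]⟩

theorem ex [Finite β] {P : ∀ N : Mdl T', (γ ⊕ β → N) → Prop} (hP : UDef K P) :
    UDef K fun N v => ∃ z : β → N, P N (Sum.elim v z) := by
  obtain ⟨φ, hφ⟩ := hP
  exact ⟨φ.iExs β, fun N v => by simp only [Formula.realize_iExs, hφ]⟩

theorem all [Finite β] {P : ∀ N : Mdl T', (γ ⊕ β → N) → Prop} (hP : UDef K P) :
    UDef K fun N v => ∀ z : β → N, P N (Sum.elim v z) :=
  hP.not.ex.not.congr fun N v => by simp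

theorem allFin {J : Type*} [Finite J] {P : J → ∀ N : Mdl T', (γ → N) → Prop}
    (hP : ∀ j, UDef K (P j)) : UDef K fun N v => ∀ j, P j N v := by
  have : ∀ s : Set J, UDef K fun N v => ∀ j ∈ s, P j N v := by
    intro s
    induction s, s.toFinite using Set.Finite.induction_on with
    | empty => exact (const True).congr fun N v => by simp
    | @insert a _ _ _ ih => exact ((hP a).and ih).congr fun N v => by simp
  exact (this Set.univ).congr fun N v => by simp

theorem exFin {J : Type*} [Finite J] {P : J → ∀ N : Mdl T', (γ → N) → Prop}
    (hP : ∀ j, UDef K (P j)) : UDef K fun N v => ∃ j, P j N v :=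
  (allFin fun j => (hP j).not).not.congr fun N v => by simp

theorem ofL {P : ∀ N : Mdl T', (γ → N) → Prop} (hP : UDef L P) : UDef (LH L) P := by
  obtain ⟨φ, hφ⟩ := hP
  refine ⟨(LHom.sumInl : L →ᴸ LH L).onFormula φ, fun N v => ?_⟩
  rw [← hφ, LHom.realize_onFormula]

theorem memH (i : γ) : UDef (LH L) fun (N : Mdl T') (v : γ → N) => v i ∈ HSet L N := by
  refine ⟨(hSym L).formula ![Term.var i], fun N v => ?_⟩
  rw [Formula.realize_rel]
  simp only [HSet, Set.mem_ofPred_eq]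
  have : (fun j => Term.realize v ((![Term.var i] : Fin 1 → (LH L).Term γ) j)) = ![v i] := by
    funext j; simp [Fin.fin_one_eq_zero j]
  rw [this]

theorem map_iff {P : ∀ N : Mdl T', (γ → N) → Prop} (hP : UDef (LH L) P) {N N' : Mdl T'}
    (e : N ↪ₑ[LH L] N') (w : γ → N) : P N' (e ∘ w) ↔ P N w := by
  obtain ⟨φ, hφ⟩ := hP
  rw [← hφ, ← hφ, e.map_formula]

/-- Truth transfers from one model to all models of a complete theory. -/
theorem transfer [Finite γ] {M₀ : Type (max u v)} [(LH L).Structure M₀] [Nonempty M₀]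
    {P : ∀ N : Mdl ((LH L).completeTheory M₀), (γ → N) → Prop} (hP : UDef (LH L) P)
    (N₁ N₂ : Mdl ((LH L).completeTheory M₀)) (h : ∀ v, P N₁ v) (v : γ → N₂) : P N₂ v := by
  have h2 : UDef (γ := Empty) (LH L) fun N _ => ∀ v, P N v :=
    (all (γ := Empty) (hP.relabel Sum.inr)).congr fun N w => by simp
  obtain ⟨φ, hφ⟩ := h2
  have e1 : N₁ ⊨ φ := (hφ N₁ default).2 h
  have hc := completeTheory.isComplete (LH L) M₀
  have e2 : N₂ ⊨ φ := by
    have := (hc.realize_sentence_iff φ N₁).1 e1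
    exact (hc.realize_sentence_iff φ N₂).2 this
  exact (hφ N₂ default).1 e2 v

end UDef

theorem exists_realization {γ β : Type} {ι : Type (max u v)}
    (P : ι → ∀ N : Mdl T', (γ ⊕ β → N) → Prop)
    (hP : ∀ i, UDef (LH L) (P i)) (N : Mdl T') (w : γ → N)
    (h : ∀ s : Finset ι, ∃ z : β → N, ∀ i ∈ s, P i N (Sum.elim w z)) :
    ∃ (N' : Mdl T') (e : N ↪ₑ[LH L] N') (z : β → N'), ∀ i, P i N' (Sum.elim (e ∘ w) z) := by
  choose φ hφ using hP
  obtain ⟨N', e, z, hz⟩ := exists_realization_formula φ N w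
    (by simpa only [hφ] using h)
  exact ⟨N', e, z, fun i => (hφ i N' _).1 (hz i)⟩

end Definable

section Closure

variable {L : FirstOrder.Language.{u, v}} {T' : (LH L).Theory}

/-- The reducts of the models of `T'` uniformly eliminate `∃^∞` and satisfy exchange. -/
structure Geo (T' : (LH L).Theory) : Prop where
  inf : ∀ {γ : Type} [Finite γ] {P : ∀ N : Mdl T', (Fin 1 ⊕ γ → N) → Prop}, UDef L P →
    UDef L fun N w => {x : N | P N (Sum.elim (fun _ => x) w)}.Infinite
  exch : ∀ (N : Mdl T') (A : Set N) (a b : N),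
    a ∈ acl L N (A ∪ {b}) → a ∉ acl L N A → b ∈ acl L N (A ∪ {a})

theorem UDef.many {K : FirstOrder.Language.{u, v}} [∀ N : Mdl T', K.Structure N] {γ : Type}
    {P : ∀ N : Mdl T', (Fin 1 ⊕ γ → N) → Prop} (hP : UDef K P) (n : ℕ) :
    UDef K fun N w => ∃ y : Fin n → N, Function.Injective y ∧
      ∀ i, P N (Sum.elim (fun _ => y i) w) := by
  refine UDef.ex (γ := γ) (β := Fin n) (P := fun N v => Function.Injective (fun i => v (Sum.inr i)) ∧
      ∀ i, P N (Sum.elim (fun _ => v (Sum.inr i)) fun j => v (Sum.inl j))) (UDef.and ?_ ?_)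
  · refine (UDef.allFin (J := Fin n) fun i => UDef.allFin (J := Fin n) fun j =>
      (UDef.eq (Sum.inr i) (Sum.inr j)).imp (UDef.const (i = j))).congr fun N v => ?_
    exact ⟨fun h i j => h i j, fun h i j hij => h hij⟩
  · refine UDef.allFin fun i => (hP.relabel (Sum.elim (fun _ => Sum.inr i) Sum.inl)).congr
      fun N v => ?_
    refine iff_of_eq (congrArg _ ?_)
    funext j; cases j <;> rfl

theorem geo_of {T : L.Theory} (hT : ∀ N : Mdl T', N ⊨ T) (hE : EliminatesExInf T)
    (hX : AclExchange T) : Geo T' where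
  inf := by
    intro γ _ P hP
    obtain ⟨θ, hθ⟩ := id hP
    obtain ⟨k, ⟨e⟩⟩ := Finite.exists_equiv_fin γ
    obtain ⟨n, hn⟩ := hE k (θ.relabel (Sum.map id e))
    refine (hP.many n).congr fun N w => ⟨?_, ?_⟩
    · rintro ⟨y, hy, h⟩
      have := hT N
      have h1 : ∀ x : N, (θ.relabel (Sum.map id e)).Realize
          (Sum.elim (fun _ => x) (w ∘ e.symm)) ↔ P N (Sum.elim (fun _ => x) w) := by
        intro x
        rw [Formula.realize_relabel, ← hθ]
        refine iff_of_eq (congrArg _ ?_)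
        funext j; cases j <;> simp
      have h2 := hn (Theory.ModelType.of T N) (w ∘ e.symm)
        ⟨Finset.univ.map ⟨y, hy⟩, by simp, fun x hx => by
          obtain ⟨i, -, rfl⟩ := Finset.mem_map.1 hx
          exact (h1 _).2 (h i)⟩
      refine h2.mono fun x hx => (h1 x).1 hx
    · intro h
      obtain ⟨s, hs, hc⟩ := h.exists_subset_card_eq n
      refine ⟨fun i => ((Finset.equivFinOfCardEq hc).symm i : N), ?_, ?_⟩
      · exact Subtype.val_injective.comp (Finset.equivFinOfCardEq hc).symm.injective
      · intro i
        exact hs ((Finset.equivFinOfCardEq hc).symm i).2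
  exch := fun N A a b => by
    have := hT N
    exact hX (Theory.ModelType.of T N) A a b

section Generic

variable {M : Type w} [L.Structure M]

theorem acl_mono {A B : Set M} (h : A ⊆ B) : acl L M A ⊆ acl L M B :=
  fun _ ⟨k, φ, c, hc, h1, h2⟩ => ⟨k, φ, c, fun j => h (hc j), h1, h2⟩

theorem subset_acl (A : Set M) : A ⊆ acl L M A := fun x hx =>
  ⟨1, (Term.var (Sum.inl 0)).equal (Term.var (Sum.inr 0)), fun _ => x, fun _ => hx,
    by simp [Formula.realize_equal], by simp [Formula.realize_equal]⟩

theorem acl_finite_char {A : Set M} {x : M} (h : x ∈ acl L M A) :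
    ∃ (k : ℕ) (c : Fin k → M), (∀ j, c j ∈ A) ∧ x ∈ acl L M (Set.range c) := by
  obtain ⟨k, φ, c, hc, h1, h2⟩ := h
  exact ⟨k, c, hc, k, φ, c, fun j => ⟨j, rfl⟩, h1, h2⟩

theorem mem_acl_range {γ : Type} [Finite γ] {w : γ → M} {x : M} :
    x ∈ acl L M (Set.range w) ↔ ∃ θ : L.Formula (Fin 1 ⊕ γ),
      θ.Realize (Sum.elim (fun _ => x) w) ∧
      {y : M | θ.Realize (Sum.elim (fun _ => y) w)}.Finite := by
  constructor
  · rintro ⟨k, φ, c, hc, h1, h2⟩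
    choose s hs using hc
    have : ∀ y : M, (φ.relabel (Sum.map id s)).Realize (Sum.elim (fun _ => y) w) ↔
        φ.Realize (Sum.elim (fun _ => y) c) := by
      intro y
      rw [Formula.realize_relabel]
      refine iff_of_eq (congrArg _ ?_)
      funext j; cases j <;> simp [hs]
    exact ⟨φ.relabel (Sum.map id s), (this x).2 h1, by simpa only [this] using h2⟩
  · rintro ⟨θ, h1, h2⟩
    obtain ⟨k, ⟨e⟩⟩ := Finite.exists_equiv_fin γ
    have : ∀ y : M, (θ.relabel (Sum.map id e)).Realize (Sum.elim (fun _ => y) (w ∘ e.symm)) ↔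
        θ.Realize (Sum.elim (fun _ => y) w) := by
      intro y
      rw [Formula.realize_relabel]
      refine iff_of_eq (congrArg _ ?_)
      funext j; cases j <;> simp
    exact ⟨k, θ.relabel (Sum.map id e), w ∘ e.symm, fun j => ⟨_, rfl⟩, (this x).2 h1,
      by simpa only [this] using h2⟩

end Generic

/-- Algebraicity over a finite tuple, through uniformly definable predicates. -/
theorem mem_acl_range_iff {γ : Type} [Finite γ] {N : Mdl T'} {w : γ → N} {x : N} :
    x ∈ acl L N (Set.range w) ↔ ∃ P : ∀ N : Mdl T', (Fin 1 ⊕ γ → N) → Prop, UDef L P ∧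
      P N (Sum.elim (fun _ => x) w) ∧ {y : N | P N (Sum.elim (fun _ => y) w)}.Finite := by
  rw [mem_acl_range]
  constructor
  · rintro ⟨θ, h⟩
    exact ⟨fun N v => θ.Realize v, UDef.of_formula θ, h⟩
  · rintro ⟨P, ⟨θ, hθ⟩, h⟩
    exact ⟨θ, by simpa only [hθ] using h⟩

namespace Geo

theorem acl_trans (hG : Geo T') {N : Mdl T'} {A B : Set N} (h : B ⊆ acl L N A) : acl L N B ⊆ acl L N A := by
  intro x hx
  obtain ⟨k, θ, c, hc, h1, h2⟩ := hx
  choose m χ d hd hχ hfin using fun j => h (hc j)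
  let δ : Type := Σ j : Fin k, Fin (m j)
  let w : δ → N := fun p => d p.1 p.2
  have hw : Set.range w ⊆ A := by rintro _ ⟨p, rfl⟩; exact hd _ _
  refine acl_mono hw (mem_acl_range_iff.2 ?_)
  let P : ∀ N : Mdl T', (Fin 1 ⊕ δ → N) → Prop := fun N v =>
    ∃ c' : Fin k → N, (∀ j, (χ j).Realize (Sum.elim (fun _ => c' j) fun i => v (Sum.inr ⟨j, i⟩))) ∧
      θ.Realize (Sum.elim (fun i => v (Sum.inl i)) c') ∧
      ¬ {y : N | θ.Realize (Sum.elim (fun _ => y) c')}.Infinite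
  refine ⟨P, ?_, ⟨c, hχ, h1, Set.not_infinite.2 h2⟩, ?_⟩
  · refine UDef.ex (γ := Fin 1 ⊕ δ) (β := Fin k) (P := fun N v =>
      (∀ j, (χ j).Realize (Sum.elim (fun _ => v (Sum.inr j))
        fun i => v (Sum.inl (Sum.inr ⟨j, i⟩)))) ∧
      θ.Realize (Sum.elim (fun i => v (Sum.inl (Sum.inl i))) fun i => v (Sum.inr i)) ∧
      ¬ {y : N | θ.Realize (Sum.elim (fun _ => y) fun i => v (Sum.inr i))}.Infinite) ?_
    refine UDef.and (UDef.allFin fun j => ?_) (UDef.and ?_ (UDef.not ?_))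
    · refine ((UDef.of_formula (χ j)).relabel
        (Sum.elim (fun _ => Sum.inr j) fun i => Sum.inl (Sum.inr ⟨j, i⟩))).congr fun N v => ?_
      refine iff_of_eq (congrArg _ ?_)
      funext j; cases j <;> rfl
    · refine ((UDef.of_formula θ).relabel
        (Sum.map Sum.inl id)).congr fun N v => ?_
      refine iff_of_eq (congrArg _ ?_)
      funext j; cases j <;> rfl
    · exact (hG.inf (UDef.of_formula θ)).relabel Sum.inr
  · have hF : (Set.pi Set.univ fun j => {y : N | (χ j).Realize (Sum.elim (fun _ => y) (d j))}).Finite :=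
      Set.Finite.pi fun j => hfin j
    refine (hF.biUnion (t := fun c' => {y : N | ({y : N | θ.Realize (Sum.elim (fun _ => y) c')}).Finite
      ∧ θ.Realize (Sum.elim (fun _ => y) c')}) fun c' _ => ?_).subset ?_
    · by_cases hc' : ({y : N | θ.Realize (Sum.elim (fun _ => y) c')}).Finite
      · exact hc'.subset fun y hy => hy.2
      · exact (Set.finite_empty).subset fun y hy => (hc' hy.1).elim
    · rintro y ⟨c', h3, h4, h5⟩
      exact Set.mem_biUnion (x := c') (fun j _ => h3 j) ⟨Set.not_infinite.1 h5, h4⟩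

end Geo

end Closure

section ExpansionDefinability

variable {L : FirstOrder.Language.{u, v}} {T' : (LH L).Theory}

/-- `x` satisfies, together with `w` and some tuple of `H`, the formula `χ`, and `χ` has only
finitely many solutions over these parameters. -/
def Sig {γ : Type} {m : ℕ} (χ : L.Formula (Fin 1 ⊕ (γ ⊕ Fin m))) (N : Mdl T') (w : γ → N)
    (x : N) : Prop :=
  ∃ z : Fin m → N, (∀ i, z i ∈ HSet L N) ∧ χ.Realize (Sum.elim (fun _ => x) (Sum.elim w z)) ∧
    {y : N | χ.Realize (Sum.elim (fun _ => y) (Sum.elim w z))}.Finite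

theorem mem_acl_union_H {γ : Type} [Finite γ] {N : Mdl T'} {w : γ → N} {x : N} :
    x ∈ acl L N (Set.range w ∪ HSet L N) ↔
      ∃ (m : ℕ) (χ : L.Formula (Fin 1 ⊕ (γ ⊕ Fin m))), Sig χ N w x := by
  classical
  constructor
  · rintro ⟨k, φ, c, hc, h1, h2⟩
    have hz : ∃ (m : ℕ) (z : Fin m → N), (∀ i, z i ∈ HSet L N) ∧
        ∀ j, c j ∈ Set.range w ∨ ∃ i, z i = c j := by
      obtain ⟨m, ⟨e⟩⟩ := Finite.exists_equiv_fin {j // c j ∈ HSet L N}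
      refine ⟨m, fun i => c (e.symm i), fun i => (e.symm i).2, fun j => ?_⟩
      refine (hc j).imp_right fun h => ⟨e ⟨j, h⟩, by simp⟩
    obtain ⟨m, z, hzH, hz⟩ := hz
    have hr : ∀ j, ∃ s, Sum.elim w z s = c j := fun j => by
      rcases hz j with ⟨i, hi⟩ | ⟨i, hi⟩
      · exact ⟨Sum.inl i, hi⟩
      · exact ⟨Sum.inr i, hi⟩
    choose s hs using hr
    have key : ∀ y : N, (φ.relabel (Sum.map id s)).Realize
        (Sum.elim (fun _ => y) (Sum.elim w z)) ↔ φ.Realize (Sum.elim (fun _ => y) c) := by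
      intro y
      rw [Formula.realize_relabel]
      refine iff_of_eq (congrArg _ ?_)
      funext j; cases j <;> simp [hs]
    exact ⟨m, φ.relabel (Sum.map id s), z, hzH, (key x).2 h1, by simpa only [key] using h2⟩
  · rintro ⟨m, χ, z, hz, h1, h2⟩
    refine acl_mono ?_ ((mem_acl_range (w := Sum.elim w z)).2 ⟨χ, h1, h2⟩)
    rintro _ ⟨i | i, rfl⟩
    · exact Or.inl ⟨i, rfl⟩
    · exact Or.inr (hz i)

theorem Geo.udef_sig (hG : Geo T') {γ : Type} [Finite γ] {m : ℕ}
    (χ : L.Formula (Fin 1 ⊕ (γ ⊕ Fin m))) :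
    UDef (LH L) fun (N : Mdl T') (v : Fin 1 ⊕ γ → N) =>
      Sig χ N (fun i => v (Sum.inr i)) (v (Sum.inl 0)) := by
  refine UDef.ex (γ := Fin 1 ⊕ γ) (β := Fin m) (P := fun N v =>
    (∀ i, v (Sum.inr i) ∈ HSet L N) ∧
    χ.Realize (Sum.elim (fun _ => v (Sum.inl (Sum.inl 0)))
      (Sum.elim (fun i => v (Sum.inl (Sum.inr i))) fun i => v (Sum.inr i))) ∧
    {y : N | χ.Realize (Sum.elim (fun _ => y)
      (Sum.elim (fun i => v (Sum.inl (Sum.inr i))) fun i => v (Sum.inr i)))}.Finite)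
    (UDef.and (UDef.allFin fun i => UDef.memH _) (UDef.and (UDef.ofL ?_) (UDef.ofL ?_)))
  · refine ((UDef.of_formula χ).relabel (Sum.elim (fun _ => Sum.inl (Sum.inl 0))
      (Sum.elim (fun i => Sum.inl (Sum.inr i)) fun i => Sum.inr i))).congr fun N v => ?_
    refine iff_of_eq (congrArg _ ?_)
    funext j; rcases j with j | j | j <;> rfl
  · refine ((hG.inf (UDef.of_formula χ)).relabel
      (Sum.elim (fun i => Sum.inl (Sum.inr i)) fun i => Sum.inr i)).not.congr fun N v => ?_
    rw [Set.not_infinite]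
    refine iff_of_eq (congrArg _ (congrArg _ (funext fun y => congrArg _ ?_)))
    funext j; rcases j with j | j | j <;> rfl

/-- The consequences of density, codensity and of the nature of `H` used below. -/
structure Good (T' : (LH L).Theory) (lov : Prop) : Prop extends Geo T' where
  dens : ∀ {γ : Type} [Finite γ] (ψ : L.Formula (Fin 1 ⊕ γ)) (N : Mdl T') (w : γ → N),
    {x : N | ψ.Realize (Sum.elim (fun _ => x) w)}.Infinite →
      ∃ x ∈ HSet L N, ψ.Realize (Sum.elim (fun _ => x) w)
  codens : ∀ {γ : Type} [Finite γ] (ψ : L.Formula (Fin 1 ⊕ γ))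
    (s : Finset (Σ m, L.Formula (Fin 1 ⊕ (γ ⊕ Fin m)))) (N : Mdl T') (w : γ → N),
    {x : N | ψ.Realize (Sum.elim (fun _ => x) w)}.Infinite →
      ∃ x, ψ.Realize (Sum.elim (fun _ => x) w) ∧ ∀ p ∈ s, ¬ Sig p.2 N w x
  hacl : ∀ (N : Mdl T') {m : ℕ} (z : Fin m → N), (∀ i, z i ∈ HSet L N) →
    ∀ c ∈ acl L N (Set.range z), c ∈ HSet L N ↔ lov ∨ c ∈ Set.range z

theorem IsDenseCodense.exists_of_infinite {M : Type w} [(LH L).Structure M]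
    (h : IsDenseCodense L M) {γ : Type} [Finite γ] (ψ : L.Formula (Fin 1 ⊕ γ)) (w : γ → M)
    (hinf : {x : M | @Formula.Realize L M (lred L M) _ ψ (Sum.elim (fun _ => x) w)}.Infinite) :
    (∃ x ∈ HSet L M, @Formula.Realize L M (lred L M) _ ψ (Sum.elim (fun _ => x) w)) ∧
    ∃ x ∉ @acl L M (lred L M) (Set.range w ∪ HSet L M),
      @Formula.Realize L M (lred L M) _ ψ (Sum.elim (fun _ => x) w) := by
  classical
  let _ := lred L M
  obtain ⟨k, ⟨e⟩⟩ := Finite.exists_equiv_fin γ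
  let D := {x : M | ψ.Realize (Sum.elim (fun _ => x) w)}
  have : (Filter.cofinite ⊓ Filter.principal D).NeBot := by
    rw [Filter.neBot_iff, Ne, Filter.inf_principal_eq_bot]
    intro hD
    exact hinf (by simpa using Filter.mem_cofinite.1 hD)
  let U : Ultrafilter M := Ultrafilter.of (Filter.cofinite ⊓ Filter.principal D)
  have hU := Ultrafilter.of_le (Filter.cofinite ⊓ Filter.principal D)
  let q : Set (ParamFormula L M) := {pf | (∀ j, pf.params j ∈ Set.range w) ∧
    {x | pf.RealizeIn (lred L M) x} ∈ U}
  let p₀ : ParamFormula L M := ⟨k, ψ.relabel (Sum.map id e), w ∘ e.symm⟩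
  have hp : ∀ x, p₀.RealizeIn (lred L M) x ↔ ψ.Realize (Sum.elim (fun _ => x) w) := by
    intro x
    change (ψ.relabel (Sum.map id e)).Realize _ ↔ _
    rw [Formula.realize_relabel]
    refine iff_of_eq (congrArg _ ?_)
    funext j; cases j <;> simp [p₀]
  have hp₀ : p₀ ∈ q := by
    refine ⟨fun j => ⟨_, rfl⟩, ?_⟩
    simp only [hp]
    exact hU (Filter.mem_inf_of_right (Filter.mem_principal_self D))
  have hq : IsCompleteTypeOver (lred L M) (Set.range w) q := by
    refine ⟨fun pf h => h.1, fun pf h => ?_, fun F hF => ?_⟩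
    · by_cases hpf : {x | pf.RealizeIn (lred L M) x} ∈ U
      · exact Or.inl ⟨h, hpf⟩
      · refine Or.inr ⟨h, ?_⟩
        have := Ultrafilter.compl_mem_iff_notMem.2 hpf
        refine Filter.mem_of_superset this fun x hx => ?_
        exact Formula.realize_not.2 hx
    · have h1 : (⋂ pf ∈ F, {x | pf.RealizeIn (lred L M) x}) ∈ U :=
        (Filter.biInter_finset_mem F).2 fun pf hpf => (hF hpf).2
      obtain ⟨x, hx⟩ := Filter.nonempty_of_mem h1
      exact ⟨x, fun pf hpf => by simpa using Set.mem_iInter₂.1 hx pf hpf⟩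
  have hna : IsNonAlgebraic (lred L M) q := by
    intro pf hpf hfin
    have h1 : {x | pf.RealizeIn (lred L M) x}ᶜ ∈ U :=
      hU (Filter.mem_inf_of_left hfin.compl_mem_cofinite)
    exact Ultrafilter.compl_mem_iff_notMem.1 h1 hpf.2
  obtain ⟨⟨x, hx, hx'⟩, y, hy, hy'⟩ := h (Set.range w)
    ⟨(Set.finite_range w).toFinset, by simpa using subset_acl _⟩ q hq hna
  exact ⟨⟨x, hx, (hp x).1 (hx' _ hp₀)⟩, y, hy, (hp y).1 (hy' _ hp₀)⟩

end ExpansionDefinability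

section Transfer

variable {L : FirstOrder.Language.{u, v}}

theorem acl_subset_of_elementarySubstructure {M : Type w} [L.Structure M]
    (S : L.ElementarySubstructure M) : acl L M (S : Set M) ⊆ S := by
  rintro c ⟨k, χ, z, hz, h1, h2⟩
  by_contra hc
  obtain ⟨r, ⟨e⟩⟩ := (h2.inter_of_left (S : Set M)).to_subtype.exists_equiv_fin
  let s : Fin r → S := fun i => ⟨(e.symm i).1, (e.symm i).2.2⟩
  let z' : Fin k → S := fun j => ⟨z j, hz j⟩
  let φ : L.Formula ((Fin k ⊕ Fin r) ⊕ Fin 1) :=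
    (χ.relabel (Sum.elim (fun _ => Sum.inr 0) fun j => Sum.inl (Sum.inl j))) ⊓
      Formula.iInf fun i : Fin r =>
        ((Term.var (Sum.inr 0)).equal (Term.var (Sum.inl (Sum.inr i)))).not
  have hφ : ∀ (M' : Type w) [L.Structure M'] (x : Fin 1 → M') (a : Fin k → M') (b : Fin r → M'),
      φ.Realize (Sum.elim (Sum.elim a b) x) ↔
        χ.Realize (Sum.elim (fun _ => x 0) a) ∧ ∀ i, x 0 ≠ b i := by
    intro M' _ x a b
    simp only [φ, Formula.realize_inf, Formula.realize_relabel, Formula.realize_iInf,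
      Formula.realize_not, Formula.realize_equal, Term.realize_var, Sum.elim_inl, Sum.elim_inr]
    refine and_congr (iff_of_eq (congrArg _ ?_)) Iff.rfl
    funext j; cases j <;> rfl
  have hM : (φ.iExs (Fin 1)).Realize (Sum.elim z fun i => (s i : M)) := by
    rw [Formula.realize_iExs]
    refine ⟨fun _ => c, (hφ M _ _ _).2 ⟨h1, fun i hi => hc ?_⟩⟩
    rw [hi]; exact (s i).2
  have hS : (φ.iExs (Fin 1)).Realize (Sum.elim z' s) := by
    rw [← S.subtype.map_formula]
    refine (iff_of_eq (congrArg _ ?_)).1 hM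
    funext j; cases j <;> rfl
  rw [Formula.realize_iExs] at hS
  obtain ⟨x, hx⟩ := hS
  obtain ⟨hx1, hx2⟩ := (hφ S _ _ _).1 hx
  have hx3 : χ.Realize (Sum.elim (fun _ => (x 0 : M)) z) := by
    rw [← S.subtype.map_formula] at hx1
    refine (iff_of_eq (congrArg _ ?_)).1 hx1
    funext j; cases j <;> rfl
  refine hx2 (e ⟨x 0, hx3, (x 0).2⟩) (Subtype.ext ?_)
  simp [s]

theorem exists_good (T : L.Theory) (hgeo : IsGeometric T)
    (M₀ : Type (max u v)) [(LH L).Structure M₀] [Nonempty M₀]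
    (h : IsLovelyPair L M₀ T ∨ IsHStructureExp L M₀ T) :
    (∀ N : Mdl ((LH L).completeTheory M₀), N ⊨ T) ∧
      ∃ lov, Good ((LH L).completeTheory M₀) lov := by
  let M : Mdl ((LH L).completeTheory M₀) := Theory.ModelType.of _ M₀
  have hMT : M ⊨ T := by
    rcases h with h | h <;> exact h.1
  have hdc : IsDenseCodense L M := by
    rcases h with h | h <;> exact h.2.1
  have hT : ∀ N : Mdl ((LH L).completeTheory M₀), N ⊨ T := by
    intro N
    refine ⟨fun φ hφ => ?_⟩
    exact (UDef.ofL (UDef.of_formula (φ : L.Formula Empty))).transfer M N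
      (fun v => by
        have := Theory.realize_sentence_of_mem (M := M) T hφ
        rw [Subsingleton.elim v default]
        exact this) default
  have hG : Geo ((LH L).completeTheory M₀) := geo_of hT hgeo.2.1 hgeo.2.2
  refine ⟨hT, IsLovelyPair L M₀ T, { hG with dens := ?_, codens := ?_, hacl := ?_ }⟩
  · intro γ _ ψ N w hw
    refine (UDef.transfer (γ := γ) (P := fun N w =>
      {x : N | ψ.Realize (Sum.elim (fun _ => x) w)}.Infinite →
        ∃ z : Fin 1 → N, z 0 ∈ HSet L N ∧ ψ.Realize (Sum.elim z w)) (UDef.imp ?_ ?_)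
        M N (fun w hw => ?_) w hw).elim fun z hz => ⟨z 0, hz.1, ?_⟩
    · exact (hG.inf (UDef.of_formula ψ)).ofL
    · refine UDef.ex (β := Fin 1) (P := fun N v => v (Sum.inr 0) ∈ HSet L N ∧
        ψ.Realize (Sum.elim (fun i => v (Sum.inr i)) fun i => v (Sum.inl i)))
        ((UDef.memH _).and (UDef.ofL ?_))
      refine ((UDef.of_formula ψ).relabel (Sum.elim Sum.inr Sum.inl)).congr fun N v => ?_
      refine iff_of_eq (congrArg _ ?_)
      funext j; cases j <;> rfl
    · obtain ⟨⟨x, hx, hx'⟩, -⟩ := hdc.exists_of_infinite ψ w hw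
      exact ⟨fun _ => x, hx, hx'⟩
    · have : (fun _ => z 0) = z := by funext i; rw [Fin.fin_one_eq_zero i]
      rw [this]; exact hz.2
  · intro γ _ ψ s N w hw
    refine (UDef.transfer (γ := γ) (P := fun N w =>
      {x : N | ψ.Realize (Sum.elim (fun _ => x) w)}.Infinite →
        ∃ z : Fin 1 → N, ψ.Realize (Sum.elim z w) ∧ ∀ p : s, ¬ Sig p.1.2 N w (z 0))
        (UDef.imp ?_ ?_) M N (fun w hw => ?_) w hw).elim
        fun z hz => ⟨z 0, ?_, fun p hp => hz.2 ⟨p, hp⟩⟩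
    · exact (hG.inf (UDef.of_formula ψ)).ofL
    · refine UDef.ex (β := Fin 1) (P := fun N v =>
        ψ.Realize (Sum.elim (fun i => v (Sum.inr i)) fun i => v (Sum.inl i)) ∧
        ∀ p : s, ¬ Sig p.1.2 N (fun i => v (Sum.inl i)) (v (Sum.inr 0)))
        (UDef.and (UDef.ofL ?_) (UDef.allFin fun p => UDef.not ?_))
      · refine ((UDef.of_formula ψ).relabel (Sum.elim Sum.inr Sum.inl)).congr fun N v => ?_
        refine iff_of_eq (congrArg _ ?_)
        funext j; cases j <;> rfl
      · exact (hG.udef_sig p.1.2).relabel (Sum.elim Sum.inr Sum.inl)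
    · obtain ⟨-, x, hx, hx'⟩ := hdc.exists_of_infinite ψ w hw
      exact ⟨fun _ => x, hx', fun p hp => hx (mem_acl_union_H.2 ⟨_, _, hp⟩)⟩
    · have : (fun _ => z 0) = z := by funext i; rw [Fin.fin_one_eq_zero i]
      rw [this]; exact hz.1
  · intro N m z hz c hc
    obtain ⟨χ, h1, h2⟩ := mem_acl_range.1 hc
    refine UDef.transfer (γ := Fin 1 ⊕ Fin m) (P := fun N v =>
      (∀ i, v (Sum.inr i) ∈ HSet L N) → χ.Realize v →
        ¬ {y : N | χ.Realize (Sum.elim (fun _ => y) fun i => v (Sum.inr i))}.Infinite →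
        (v (Sum.inl 0) ∈ HSet L N ↔ IsLovelyPair L M₀ T ∨ ∃ i, v (Sum.inr i) = v (Sum.inl 0)))
      (UDef.imp ?_ (UDef.imp ?_ (UDef.imp ?_ (UDef.iff ?_ ?_)))) M N (fun v hv h1 h2 => ?_)
      (Sum.elim (fun _ => c) z) hz h1 (Set.not_infinite.2 h2)
    · exact UDef.allFin fun i => UDef.memH _
    · exact (UDef.of_formula χ).ofL
    · exact ((hG.inf (UDef.of_formula χ)).relabel Sum.inr).not.ofL
    · exact UDef.memH _
    · exact (UDef.const _).or (UDef.exFin fun i => UDef.eq _ _)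
    · have hc : v (Sum.inl 0) ∈ acl L M (Set.range fun i => v (Sum.inr i)) := by
        refine mem_acl_range.2 ⟨χ, ?_, Set.not_infinite.1 h2⟩
        refine (iff_of_eq (congrArg _ ?_)).1 h1
        funext j
        rcases j with j | j
        · rw [Fin.fin_one_eq_zero j]; rfl
        · rfl
      have hr : (Set.range fun i => v (Sum.inr i)) ⊆ HSet L M := by rintro _ ⟨i, rfl⟩; exact hv i
      by_cases hl : IsLovelyPair L M₀ T
      · simp only [hl, true_or, iff_true]
        obtain ⟨S, hS⟩ := hl.2.2
        have := acl_subset_of_elementarySubstructure (M := M) S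
        have h3 := this (acl_mono (hr.trans hS.ge) hc)
        exact hS.le h3
      · have hH := (h.resolve_left hl).2.2
        simp only [hl, false_or]
        refine ⟨fun hcH => ?_, fun ⟨i, hi⟩ => hi ▸ hv i⟩
        by_contra hne
        refine hH _ hcH (acl_mono (M := M) ?_ hc)
        rintro _ ⟨i, rfl⟩
        exact ⟨hv i, fun hi => hne ⟨i, hi⟩⟩

end Transfer

section Independence

variable {L : FirstOrder.Language.{u, v}} {T' : (LH L).Theory}

/-- Finite sets that are independent from `H` over their intersection with `H`. -/
inductive Ind (N : Mdl T') : Set N → Prop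
  | empty : Ind N ∅
  | mem_H {A : Set N} {c : N} : Ind N A → c ∈ HSet L N → Ind N (insert c A)
  | alg {A : Set N} {c : N} : Ind N A → c ∈ acl L N A → Ind N (insert c A)
  | generic {A : Set N} {c : N} : Ind N A → c ∉ acl L N (A ∪ HSet L N) → Ind N (insert c A)

theorem Ind.finite {N : Mdl T'} {A : Set N} (h : Ind N A) : A.Finite := by
  induction h with
  | empty => exact Set.finite_empty
  | mem_H _ _ ih => exact ih.insert _
  | alg _ _ ih => exact ih.insert _
  | generic _ _ ih => exact ih.insert _

theorem Ind.mem_acl (hG : Geo T') {N : Mdl T'} {A : Set N} (h : Ind N A) :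
    ∀ C ⊆ HSet L N, ∀ y ∈ HSet L N, y ∈ acl L N (A ∪ C) → y ∈ acl L N (A ∩ HSet L N ∪ C) := by
  induction h with
  | empty =>
    intro C _ y _ hy
    exact acl_mono (by simp) hy
  | @mem_H A c _ hc ih =>
    intro C hC y hy hyA
    have h1 := ih (insert c C) (Set.insert_subset hc hC) y hy
      (acl_mono (by rw [Set.insert_union, Set.union_insert]) hyA)
    refine acl_mono ?_ h1
    rw [Set.insert_inter_of_mem hc, Set.insert_union, Set.union_insert]
  | @alg A c _ hc ih =>
    intro C hC y hy hyA
    have h1 : y ∈ acl L N (A ∪ C) := by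
      refine hG.acl_trans ?_ hyA
      rw [Set.insert_union]
      exact Set.insert_subset (acl_mono Set.subset_union_left hc) (subset_acl _)
    exact acl_mono (by gcongr; exact Set.subset_insert _ _) (ih C hC y hy h1)
  | @generic A c _ hc ih =>
    intro C hC y hy hyA
    have h1 : y ∈ acl L N (A ∪ C) := by
      by_contra hne
      refine hc ?_
      have h2 := hG.exch N (A ∪ C) y c
        (acl_mono (by rw [Set.insert_union, Set.union_singleton]) hyA) hne
      refine acl_mono ?_ h2
      rw [Set.union_singleton]
      refine Set.insert_subset (Or.inr hy) (Set.union_subset_union_right _ hC)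
    exact acl_mono (by gcongr; exact Set.subset_insert _ _) (ih C hC y hy h1)

section Map

variable {N N' : Mdl T'} (e : N ↪ₑ[LH L] N')

theorem Geo.mem_acl_map_iff (hG : Geo T') {γ : Type} [Finite γ] (w : γ → N) (c : N) :
    e c ∈ acl L N' (Set.range (e ∘ w)) ↔ c ∈ acl L N (Set.range w) := by
  rw [mem_acl_range, mem_acl_range]
  refine exists_congr fun θ => and_congr ?_ ?_
  · rw [← (UDef.of_formula θ).ofL.map_iff e]
    refine iff_of_eq (congrArg _ ?_)
    funext j; cases j <;> rfl
  · have := (hG.inf (UDef.of_formula θ)).ofL.map_iff e w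
    simpa only [Set.not_infinite] using not_congr this

theorem Geo.mem_acl_union_H_map_iff (hG : Geo T') {γ : Type} [Finite γ] (w : γ → N) (c : N) :
    e c ∈ acl L N' (Set.range (e ∘ w) ∪ HSet L N') ↔
      c ∈ acl L N (Set.range w ∪ HSet L N) := by
  rw [mem_acl_union_H, mem_acl_union_H]
  refine exists_congr fun m => exists_congr fun χ => ?_
  exact (hG.udef_sig χ).map_iff e (Sum.elim (fun _ => c) w)

theorem mem_HSet_map_iff (c : N) : e c ∈ HSet L N' ↔ c ∈ HSet L N :=
  (UDef.memH (0 : Fin 1)).map_iff e fun _ => c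

theorem exists_range_eq_of_finite {X : Type w} {A : Set X} (h : A.Finite) :
    ∃ (k : ℕ) (v : Fin k → X), Set.range v = A := by
  obtain ⟨k, ⟨f⟩⟩ := h.to_subtype.exists_equiv_fin
  refine ⟨k, fun i => f.symm i, ?_⟩
  ext x
  exact ⟨fun ⟨i, hi⟩ => hi ▸ (f.symm i).2, fun hx => ⟨f ⟨x, hx⟩, by simp⟩⟩

theorem Ind.map (hG : Geo T') {A : Set N} (h : Ind N A) : Ind N' (e '' A) := by
  induction h with
  | empty => simpa using Ind.empty
  | mem_H h hc ih =>
    rw [Set.image_insert_eq]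
    exact ih.mem_H ((mem_HSet_map_iff e _).2 hc)
  | alg h hc ih =>
    rw [Set.image_insert_eq]
    refine ih.alg ?_
    obtain ⟨k, w, rfl⟩ := exists_range_eq_of_finite h.finite
    rw [← Set.range_comp]
    exact (hG.mem_acl_map_iff e w _).2 hc
  | generic h hc ih =>
    rw [Set.image_insert_eq]
    refine ih.generic ?_
    obtain ⟨k, w, rfl⟩ := exists_range_eq_of_finite h.finite
    rw [← Set.range_comp, hG.mem_acl_union_H_map_iff e w _]
    exact hc

end Map

/-- Partial `L`-elementary maps, given by their graph. -/
def PMap (N₁ N₂ : Mdl T') (S : Set (N₁ × N₂)) : Prop :=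
  ∀ (γ : Type) [Finite γ] (φ : L.Formula γ) (v : γ → N₁ × N₂), (∀ i, v i ∈ S) →
    (φ.Realize (fun i => (v i).1) ↔ φ.Realize fun i => (v i).2)

section PMap

variable {N₁ N₂ : Mdl T'} {S : Set (N₁ × N₂)}

theorem PMap.symm (h : PMap N₁ N₂ S) : PMap N₂ N₁ (Prod.swap '' S) := by
  intro γ _ φ v hv
  refine (h γ φ (fun i => (v i).swap) fun i => ?_).symm
  obtain ⟨p, hp, hpv⟩ := hv i
  rwa [← hpv, Prod.swap_swap]

theorem PMap.udef (h : PMap N₁ N₂ S) {γ : Type} [Finite γ] {P : ∀ N : Mdl T', (γ → N) → Prop}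
    (hP : UDef L P) (v : γ → N₁ × N₂) (hv : ∀ i, v i ∈ S) :
    P N₁ (fun i => (v i).1) ↔ P N₂ fun i => (v i).2 := by
  obtain ⟨φ, hφ⟩ := hP
  rw [← hφ, ← hφ]
  exact h γ φ v hv

theorem PMap.eq_iff (h : PMap N₁ N₂ S) {p q : N₁ × N₂} (hp : p ∈ S) (hq : q ∈ S) :
    p.1 = q.1 ↔ p.2 = q.2 :=
  h.udef (γ := Bool) (UDef.eq true false) (fun b => if b then p else q) (by
    intro b; cases b <;> assumption)

theorem PMap.of_insert {γ : Type} [Finite γ] {v : γ → N₁ × N₂} {c : N₁} {c' : N₂}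
    (h : ∀ ψ : L.Formula (Fin 1 ⊕ γ), ψ.Realize (Sum.elim (fun _ => c) fun i => (v i).1) ↔
      ψ.Realize (Sum.elim (fun _ => c') fun i => (v i).2)) :
    PMap N₁ N₂ (insert (c, c') (Set.range v)) := by
  intro δ _ φ u hu
  have : ∀ j, ∃ s : Fin 1 ⊕ γ, u j = Sum.elim (fun _ => (c, c')) v s := by
    intro j
    rcases hu j with h | ⟨i, hi⟩
    · exact ⟨Sum.inl 0, h⟩
    · exact ⟨Sum.inr i, hi.symm⟩
  choose s hs using this
  have h1 := h (φ.relabel s)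
  rw [Formula.realize_relabel, Formula.realize_relabel] at h1
  convert h1 using 2
  · funext j
    rw [hs]; simp only [Function.comp]
    cases s j <;> rfl
  · funext j
    rw [hs]; simp only [Function.comp]
    cases s j <;> rfl

theorem PMap.mem_acl (hG : Geo T') (h : PMap N₁ N₂ S) {γ : Type} [Finite γ] (v : γ → N₁ × N₂)
    (hv : ∀ i, v i ∈ S) {c : N₁} {c' : N₂} (hc : (c, c') ∈ S)
    (hac : c ∈ acl L N₁ (Set.range fun i => (v i).1)) :
    c' ∈ acl L N₂ (Set.range fun i => (v i).2) := by
  obtain ⟨θ, h1, h2⟩ := mem_acl_range.1 hac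
  refine mem_acl_range.2 ⟨θ, ?_, ?_⟩
  · have := h _ θ (Sum.elim (fun _ => (c, c')) v) (by rintro (i | i); exacts [hc, hv i])
    convert this.1 (by convert h1 using 2 with j; cases j <;> rfl) using 2 with j
    cases j <;> rfl
  · have := h.udef (hG.inf (UDef.of_formula θ)) v hv
    exact Set.not_infinite.1 fun hi => (this.2 hi) h2

end PMap

/-- Partial `L`-elementary maps between independent finite sets which respect `H`. -/
structure HMap (N₁ N₂ : Mdl T') (S : Set (N₁ × N₂)) : Prop where
  fin : S.Finite
  pmap : PMap N₁ N₂ S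
  mem_H : ∀ p ∈ S, (p.1 ∈ HSet L N₁ ↔ p.2 ∈ HSet L N₂)
  ind₁ : Ind N₁ (Prod.fst '' S)
  ind₂ : Ind N₂ (Prod.snd '' S)

namespace HMap

variable {N₁ N₂ : Mdl T'} {S : Set (N₁ × N₂)} {lov : Prop}

theorem symm (h : HMap N₁ N₂ S) : HMap N₂ N₁ (Prod.swap '' S) where
  fin := h.fin.image _
  pmap := h.pmap.symm
  mem_H := by
    rintro _ ⟨p, hp, rfl⟩
    exact (h.mem_H p hp).symm
  ind₁ := by
    rw [← Set.image_comp]; exact h.ind₂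
  ind₂ := by
    rw [← Set.image_comp]; exact h.ind₁

theorem map (hG : Geo T') (h : HMap N₁ N₂ S) {N' : Mdl T'} (e : N₂ ↪ₑ[LH L] N') :
    HMap N₁ N' (Prod.map id e '' S) where
  fin := h.fin.image _
  pmap := by
    intro γ _ φ v hv
    choose p hp hpv using hv
    have h1 := (UDef.of_formula φ).ofL.map_iff e fun i => (p i).2
    have h2 := h.pmap γ φ p hp
    have h3 : (fun i => (v i).1) = fun i => (p i).1 := by funext i; rw [← hpv]; rfl
    have h4 : (fun i => (v i).2) = e ∘ fun i => (p i).2 := by funext i; rw [← hpv]; rfl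
    rw [h3, h4, h1, h2]
  mem_H := by
    rintro _ ⟨p, hp, rfl⟩
    exact (h.mem_H p hp).trans (mem_HSet_map_iff e _).symm
  ind₁ := by
    rw [← Set.image_comp]; exact h.ind₁
  ind₂ := by
    have := h.ind₂.map e hG
    rw [← Set.image_comp] at this ⊢
    exact this

theorem mem_H_of_mem_acl (hG : Good T' lov) (h : HMap N₁ N₂ S) {c : N₁} {c' : N₂}
    (hc : PMap N₁ N₂ (insert (c, c') S)) (hac : c ∈ acl L N₁ (Prod.fst '' S))
    (hcH : c ∈ HSet L N₁) : c' ∈ HSet L N₂ := by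
  have h1 := h.ind₁.mem_acl hG.toGeo ∅ (Set.empty_subset _) c hcH (by simpa using hac)
  obtain ⟨k, v, hv⟩ := exists_range_eq_of_finite (h.fin.subset (Set.sep_subset S fun p => p.1 ∈ HSet L N₁))
  have hvS : ∀ i, v i ∈ S ∧ (v i).1 ∈ HSet L N₁ := fun i => hv.le ⟨i, rfl⟩
  have hr : c ∈ acl L N₁ (Set.range fun i => (v i).1) := by
    refine acl_mono ?_ h1
    rw [Set.union_empty]
    rintro _ ⟨⟨p, hp, rfl⟩, hpH⟩
    obtain ⟨i, hi⟩ := hv.ge ⟨hp, hpH⟩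
    exact ⟨i, congrArg Prod.fst hi⟩
  have hvS' : ∀ i, v i ∈ insert (c, c') S := fun i => Set.mem_insert_of_mem _ (hvS i).1
  have hr' := hc.mem_acl hG.toGeo v hvS' (Set.mem_insert _ _) hr
  refine (hG.hacl N₂ _ (fun i => (h.mem_H _ (hvS i).1).1 (hvS i).2) _ hr').2 ?_
  refine ((hG.hacl N₁ _ (fun i => (hvS i).2) _ hr).1 hcH).imp_right ?_
  rintro ⟨i, hi⟩
  exact ⟨i, (hc.eq_iff (hvS' i) (Set.mem_insert _ _)).1 hi⟩

theorem mem_acl_snd (hG : Geo T') (h : HMap N₁ N₂ S) {c : N₁} {c' : N₂}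
    (hc : PMap N₁ N₂ (insert (c, c') S)) (hac : c ∈ acl L N₁ (Prod.fst '' S)) :
    c' ∈ acl L N₂ (Prod.snd '' S) := by
  obtain ⟨k, v, rfl⟩ := exists_range_eq_of_finite h.fin
  rw [← Set.range_comp] at hac ⊢
  exact hc.mem_acl hG v (fun i => Set.mem_insert_of_mem _ ⟨i, rfl⟩) (Set.mem_insert _ _) hac

theorem insert_alg (hG : Good T' lov) (h : HMap N₁ N₂ S) {c : N₁} {c' : N₂}
    (hc : PMap N₁ N₂ (insert (c, c') S)) (hac : c ∈ acl L N₁ (Prod.fst '' S)) :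
    HMap N₁ N₂ (insert (c, c') S) where
  fin := h.fin.insert _
  pmap := hc
  mem_H := by
    rintro p (rfl | hp)
    · refine ⟨h.mem_H_of_mem_acl hG hc hac, h.symm.mem_H_of_mem_acl hG ?_ ?_⟩
      · have := hc.symm
        rwa [Set.image_insert_eq] at this
      · have := h.mem_acl_snd hG.toGeo hc hac
        rwa [← Set.image_comp]
    · exact h.mem_H p hp
  ind₁ := by
    rw [Set.image_insert_eq]; exact h.ind₁.alg hac
  ind₂ := by
    rw [Set.image_insert_eq]; exact h.ind₂.alg (h.mem_acl_snd hG.toGeo hc hac)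

theorem insert_H (h : HMap N₁ N₂ S) {c : N₁} {c' : N₂}
    (hc : PMap N₁ N₂ (insert (c, c') S)) (h1 : c ∈ HSet L N₁) (h2 : c' ∈ HSet L N₂) :
    HMap N₁ N₂ (insert (c, c') S) where
  fin := h.fin.insert _
  pmap := hc
  mem_H := by
    rintro p (rfl | hp)
    · exact iff_of_true h1 h2
    · exact h.mem_H p hp
  ind₁ := by
    rw [Set.image_insert_eq]; exact h.ind₁.mem_H h1
  ind₂ := by
    rw [Set.image_insert_eq]; exact h.ind₂.mem_H h2

theorem insert_generic (h : HMap N₁ N₂ S) {c : N₁} {c' : N₂}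
    (hc : PMap N₁ N₂ (insert (c, c') S)) (h1 : c ∉ acl L N₁ (Prod.fst '' S ∪ HSet L N₁))
    (h2 : c' ∉ acl L N₂ (Prod.snd '' S ∪ HSet L N₂)) :
    HMap N₁ N₂ (insert (c, c') S) where
  fin := h.fin.insert _
  pmap := hc
  mem_H := by
    rintro p (rfl | hp)
    · exact iff_of_false (fun h => h1 (subset_acl _ (Or.inr h))) fun h =>
        h2 (subset_acl _ (Or.inr h))
    · exact h.mem_H p hp
  ind₁ := by
    rw [Set.image_insert_eq]; exact h.ind₁.generic h1
  ind₂ := by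
    rw [Set.image_insert_eq]; exact h.ind₂.generic h2

end HMap

end Independence

section BackAndForth

variable {L : FirstOrder.Language.{u, v}} {T' : (LH L).Theory}

theorem exists_realization_type {γ : Type} {N₁ N₂ : Mdl T'} (w₁ : γ → N₁) (w₂ : γ → N₂) (c : N₁)
    {ι : Type (max u v)} (Q : ι → ∀ N : Mdl T', (γ ⊕ Fin 1 → N) → Prop)
    (hQ : ∀ i, UDef (LH L) (Q i))
    (h : ∀ ψ : L.Formula (Fin 1 ⊕ γ), ψ.Realize (Sum.elim (fun _ => c) w₁) → ∀ s : Finset ι,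
      ∃ x : N₂, ψ.Realize (Sum.elim (fun _ => x) w₂) ∧ ∀ i ∈ s, Q i N₂ (Sum.elim w₂ fun _ => x)) :
    ∃ (N' : Mdl T') (e : N₂ ↪ₑ[LH L] N') (c' : N'),
      (∀ ψ : L.Formula (Fin 1 ⊕ γ), ψ.Realize (Sum.elim (fun _ => c) w₁) ↔
        ψ.Realize (Sum.elim (fun _ => c') (e ∘ w₂))) ∧
      ∀ i, Q i N' (Sum.elim (e ∘ w₂) fun _ => c') := by
  classical
  let κ : Type (max u v) := {ψ : L.Formula (Fin 1 ⊕ γ) // ψ.Realize (Sum.elim (fun _ => c) w₁)}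
  let P : κ ⊕ ι → ∀ N : Mdl T', (γ ⊕ Fin 1 → N) → Prop :=
    Sum.elim (fun ψ N v => ψ.1.Realize (Sum.elim (fun i => v (Sum.inr i)) fun i => v (Sum.inl i))) Q
  obtain ⟨N', e, z, hz⟩ := exists_realization P (by
    rintro (ψ | i)
    · refine UDef.ofL (((UDef.of_formula ψ.1).relabel (Sum.elim Sum.inr Sum.inl)).congr
        fun N v => ?_)
      refine iff_of_eq (congrArg _ ?_)
      funext j; cases j <;> rfl
    · exact hQ i) N₂ w₂ (by
    intro s
    let t : Finset κ := s.toLeft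
    obtain ⟨x, hx1, hx2⟩ := h (Formula.iInf fun ψ : t => ψ.1.1)
      (by rw [Formula.realize_iInf]; exact fun ψ => ψ.1.2) s.toRight
    rw [Formula.realize_iInf] at hx1
    refine ⟨fun _ => x, ?_⟩
    rintro (ψ | i) hi
    · exact hx1 ⟨ψ, Finset.mem_toLeft.2 hi⟩
    · exact hx2 i (Finset.mem_toRight.2 hi))
  have hz0 : z = fun _ => z 0 := by funext i; rw [Fin.fin_one_eq_zero i]
  rw [hz0] at hz
  have h1 : ∀ ψ : L.Formula (Fin 1 ⊕ γ), ψ.Realize (Sum.elim (fun _ => c) w₁) →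
      ψ.Realize (Sum.elim (fun _ => z 0) (e ∘ w₂)) := fun ψ hψ => hz (Sum.inl ⟨ψ, hψ⟩)
  refine ⟨N', e, z 0, fun ψ => ⟨h1 ψ, fun h2 => ?_⟩, fun i => hz (Sum.inr i)⟩
  by_contra h3
  exact Formula.realize_not.1 (h1 ψ.not (Formula.realize_not.2 h3)) h2

namespace HMap

variable {N₁ N₂ : Mdl T'} {S : Set (N₁ × N₂)} {lov : Prop}

/-- The back-and-forth extension property. -/
theorem exists_insert (hG : Good T' lov) (h : HMap N₁ N₂ S) (c : N₁)
    (hc : c ∈ acl L N₁ (Prod.fst '' S) ∨ c ∈ HSet L N₁ ∨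
      c ∉ acl L N₁ (Prod.fst '' S ∪ HSet L N₁)) :
    ∃ (N' : Mdl T') (e : N₂ ↪ₑ[LH L] N') (c' : N'),
      HMap N₁ N' (insert (c, c') (Prod.map id e '' S)) := by
  obtain ⟨k, v, rfl⟩ := exists_range_eq_of_finite h.fin
  have hv : ∀ i, v i ∈ Set.range v := fun i => ⟨i, rfl⟩
  have hfst : Prod.fst '' Set.range v = Set.range fun i => (v i).1 := by rw [← Set.range_comp]; rfl
  have hsnd : Prod.snd '' Set.range v = Set.range fun i => (v i).2 := by rw [← Set.range_comp]; rfl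
  have hpm : ∀ {N' : Mdl T'} {e : N₂ ↪ₑ[LH L] N'} {c' : N'},
      (∀ ψ : L.Formula (Fin 1 ⊕ Fin k), ψ.Realize (Sum.elim (fun _ => c) fun i => (v i).1) ↔
        ψ.Realize (Sum.elim (fun _ => c') (e ∘ fun i => (v i).2))) →
      PMap N₁ N' (insert (c, c') (Prod.map id e '' Set.range v)) := by
    intro N' e c' hψ
    rw [← Set.range_comp]
    exact PMap.of_insert hψ
  have himg : ∀ {N' : Mdl T'} {e : N₂ ↪ₑ[LH L] N'},
      Prod.fst '' (Prod.map id e '' Set.range v) = Prod.fst '' Set.range v := by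
    intro N' e
    rw [← Set.image_comp]; rfl
  have himg' : ∀ {N' : Mdl T'} {e : N₂ ↪ₑ[LH L] N'},
      Prod.snd '' (Prod.map id e '' Set.range v) = Set.range (e ∘ fun i => (v i).2) := by
    intro N' e
    rw [← Set.range_comp, ← Set.range_comp]; rfl
  by_cases hac : c ∈ acl L N₁ (Prod.fst '' Set.range v)
  · obtain ⟨N', e, c', hψ, -⟩ := exists_realization_type (fun i => (v i).1) (fun i => (v i).2) c
      (ι := PEmpty) (fun i => i.elim) (fun i => i.elim) (by
        intro ψ hψ _
        have h1 : UDef L fun (N : Mdl T') (w : Fin k → N) =>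
            ∃ z : Fin 1 → N, ψ.Realize (Sum.elim z w) := by
          refine UDef.ex (P := fun N w => ψ.Realize (Sum.elim (fun i => w (Sum.inr i))
            fun i => w (Sum.inl i))) ?_
          refine ((UDef.of_formula ψ).relabel (Sum.elim Sum.inr Sum.inl)).congr fun N v => ?_
          refine iff_of_eq (congrArg _ ?_)
          funext j; cases j <;> rfl
        obtain ⟨z, hz⟩ := (h.pmap.udef h1 v hv).1 ⟨fun _ => c, hψ⟩
        have hz0 : z = fun _ => z 0 := by funext i; rw [Fin.fin_one_eq_zero i]
        rw [hz0] at hz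
        exact ⟨z 0, hz, fun i => i.elim⟩)
    exact ⟨N', e, c', (h.map hG.toGeo e).insert_alg hG (hpm hψ) (by rwa [himg])⟩
  · have hinf : ∀ ψ : L.Formula (Fin 1 ⊕ Fin k),
        ψ.Realize (Sum.elim (fun _ => c) fun i => (v i).1) →
        {x : N₂ | ψ.Realize (Sum.elim (fun _ => x) fun i => (v i).2)}.Infinite := by
      intro ψ hψ
      refine (h.pmap.udef (hG.inf (UDef.of_formula ψ)) v hv).1 fun hfin => hac ?_
      rw [hfst]
      exact mem_acl_range.2 ⟨ψ, hψ, hfin⟩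
    rcases hc.resolve_left hac with hcH | hcH
    · obtain ⟨N', e, c', hψ, hQ⟩ := exists_realization_type (fun i => (v i).1)
        (fun i => (v i).2) c (ι := PUnit) (fun _ N w => w (Sum.inr 0) ∈ HSet L N)
        (fun _ => UDef.memH _) (by
          intro ψ hψ _
          obtain ⟨x, hx, hx'⟩ := hG.dens ψ N₂ _ (hinf ψ hψ)
          exact ⟨x, hx', fun _ _ => hx⟩)
      exact ⟨N', e, c', (h.map hG.toGeo e).insert_H (hpm hψ) hcH (hQ PUnit.unit)⟩
    · obtain ⟨N', e, c', hψ, hQ⟩ := exists_realization_type (fun i => (v i).1)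
        (fun i => (v i).2) c (ι := Σ m, L.Formula (Fin 1 ⊕ (Fin k ⊕ Fin m)))
        (fun p N w => ¬ Sig p.2 N (fun i => w (Sum.inl i)) (w (Sum.inr 0)))
        (fun p => ((hG.udef_sig p.2).relabel (Sum.elim (fun _ => Sum.inr 0) Sum.inl)).not) (by
          intro ψ hψ s
          exact hG.codens ψ s N₂ _ (hinf ψ hψ))
      refine ⟨N', e, c', (h.map hG.toGeo e).insert_generic (hpm hψ) (by rwa [himg]) ?_⟩
      rw [himg', mem_acl_union_H]
      rintro ⟨m, χ, hχ⟩
      exact hQ ⟨m, χ⟩ hχ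

theorem exists_extend_H (hG : Good T' lov) {m : ℕ} (z : Fin m → N₁) (hz : ∀ i, z i ∈ HSet L N₁)
    (h : HMap N₁ N₂ S) :
    ∃ (N' : Mdl T') (e : N₂ ↪ₑ[LH L] N') (S' : Set (N₁ × N')), HMap N₁ N' S' ∧
      (∀ p ∈ S, (p.1, e p.2) ∈ S') ∧ ∀ i, z i ∈ Prod.fst '' S' := by
  induction m with
  | zero => exact ⟨N₂, ElementaryEmbedding.refl _ _, S, h, fun p hp => hp, fun i => i.elim0⟩
  | succ m ih =>
    obtain ⟨N', e, S', h1, h2, h3⟩ := ih (fun i => z i.castSucc) fun i => hz _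
    obtain ⟨N'', e', c', h4⟩ := h1.exists_insert hG (z (Fin.last m)) (Or.inr (Or.inl (hz _)))
    refine ⟨N'', e'.comp e, _, h4, fun p hp => Set.mem_insert_of_mem _ ⟨_, h2 p hp, rfl⟩,
      fun i => ?_⟩
    refine Fin.lastCases ?_ (fun i => ?_) i
    · exact ⟨_, Set.mem_insert _ _, rfl⟩
    · obtain ⟨p, hp, hpi⟩ := h3 i
      exact ⟨_, Set.mem_insert_of_mem _ ⟨p, hp, rfl⟩, hpi⟩

theorem exists_extend (hG : Good T' lov) (h : HMap N₁ N₂ S) (c : N₁) :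
    ∃ (N' : Mdl T') (e : N₂ ↪ₑ[LH L] N') (S' : Set (N₁ × N')), HMap N₁ N' S' ∧
      (∀ p ∈ S, (p.1, e p.2) ∈ S') ∧ ∃ c', (c, c') ∈ S' := by
  by_cases hc : c ∈ acl L N₁ (Prod.fst '' S ∪ HSet L N₁)
  · have h0 : ∃ (m : ℕ) (z : Fin m → N₁), (∀ i, z i ∈ HSet L N₁) ∧
        c ∈ acl L N₁ (Prod.fst '' S ∪ Set.range z) := by
      obtain ⟨k, w, hw, hcw⟩ := acl_finite_char hc
      obtain ⟨m, z, hz⟩ := exists_range_eq_of_finite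
        ((Set.finite_range w).inter_of_left (HSet L N₁))
      refine ⟨m, z, fun i => (hz.le ⟨i, rfl⟩).2, acl_mono ?_ hcw⟩
      rw [hz]
      rintro _ ⟨i, rfl⟩
      exact (hw i).imp id fun h => ⟨⟨i, rfl⟩, h⟩
    obtain ⟨m, z, hz, hcz⟩ := h0
    obtain ⟨N', e, S', h1, h2, h3⟩ := exists_extend_H hG z hz h
    obtain ⟨N'', e', c', h4⟩ := h1.exists_insert hG c (Or.inl (acl_mono (by
      refine Set.union_subset ?_ (by rintro _ ⟨i, rfl⟩; exact h3 i)
      rintro _ ⟨p, hp, rfl⟩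
      exact ⟨_, h2 p hp, rfl⟩) hcz))
    exact ⟨N'', e'.comp e, _, h4, fun p hp => Set.mem_insert_of_mem _ ⟨_, h2 p hp, rfl⟩,
      c', Set.mem_insert _ _⟩
  · obtain ⟨N'', e', c', h4⟩ := h.exists_insert hG c (Or.inr (Or.inr hc))
    exact ⟨N'', e', _, h4, fun p hp => Set.mem_insert_of_mem _ ⟨_, hp, rfl⟩,
      c', Set.mem_insert _ _⟩

end HMap

theorem exists_term_reduct {α : Type} (t : (LH L).Term α) :
    ∃ t' : L.Term α, ∀ (N : Mdl T') (v : α → N), t'.realize v = t.realize v := by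
  induction t with
  | var a => exact ⟨Term.var a, fun N v => rfl⟩
  | @func l f ts ih =>
    choose ts' hts using ih
    rcases f with f | f
    · refine ⟨Term.func f ts', fun N v => ?_⟩
      simp only [Term.realize_func, hts]
      rfl
    · exact f.elim

theorem HMap.term_mem_H {lov : Prop} (hG : Good T' lov) {α : Type} [Finite α]
    {N₁ N₂ : Mdl T'} {S : Set (N₁ × N₂)} (h : HMap N₁ N₂ S) (t : L.Term α) (u : α → N₁ × N₂)
    (hu : ∀ i, u i ∈ S) :
    t.realize (fun i => (u i).1) ∈ HSet L N₁ ↔ t.realize (fun i => (u i).2) ∈ HSet L N₂ := by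
  obtain ⟨k, v, rfl⟩ := exists_range_eq_of_finite h.fin
  choose s hs using hu
  have hp : PMap N₁ N₂ (insert (t.realize (fun i => (u i).1), t.realize (fun i => (u i).2))
      (Set.range v)) := by
    refine PMap.of_insert fun ψ => ?_
    have := h.pmap _ (ψ.subst (Sum.elim (fun _ => t.relabel s) Term.var)) v fun i => ⟨i, rfl⟩
    rw [Formula.Realize, Formula.Realize, BoundedFormula.realize_subst,
      BoundedFormula.realize_subst] at this
    refine Iff.trans (iff_of_eq (congrArg (fun w => BoundedFormula.Realize ψ w default) ?_))
      (this.trans (iff_of_eq (congrArg (fun w => BoundedFormula.Realize ψ w default) ?_)))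
    · funext j
      cases j
      · simp only [Sum.elim_inl, Term.realize_relabel]
        congr 1; funext j; simp [hs]
      · rfl
    · funext j
      cases j
      · simp only [Sum.elim_inl, Term.realize_relabel]
        congr 1; funext j; simp [hs]
      · rfl
  refine (h.insert_alg hG hp ?_).mem_H _ (Set.mem_insert _ _)
  rw [← Set.range_comp]
  have : t.realize (fun i => (u i).1) ∈ acl L N₁ (Set.range fun i => (u i).1) := by
    refine mem_acl_range.2 ⟨(Term.var (Sum.inl 0)).equal (t.relabel Sum.inr), ?_, ?_⟩
    · simp [Formula.realize_equal, Term.realize_relabel, Function.comp_def]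
    · simp [Formula.realize_equal, Term.realize_relabel, Function.comp_def]
  refine acl_mono ?_ this
  rintro _ ⟨i, rfl⟩
  exact ⟨s i, congrArg Prod.fst (hs i)⟩

theorem HMap.realize_iff {lov : Prop} (hG : Good T' lov) {α : Type} [Finite α] {n : ℕ}
    (φ : (LH L).BoundedFormula α n) : ∀ {N₁ N₂ : Mdl T'} {S : Set (N₁ × N₂)}, HMap N₁ N₂ S →
      ∀ (v : α → N₁ × N₂) (xs : Fin n → N₁ × N₂), (∀ i, v i ∈ S) → (∀ i, xs i ∈ S) →
      (φ.Realize (fun i => (v i).1) (fun i => (xs i).1) ↔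
        φ.Realize (fun i => (v i).2) fun i => (xs i).2) := by
  induction φ with
  | falsum => intros; rfl
  | equal t₁ t₂ =>
    intro N₁ N₂ S h v xs hv hxs
    obtain ⟨t₁', h₁⟩ := exists_term_reduct (T' := T') t₁
    obtain ⟨t₂', h₂⟩ := exists_term_reduct (T' := T') t₂
    simp only [BoundedFormula.Realize, ← h₁, ← h₂]
    have := h.pmap _ (t₁'.equal t₂') (Sum.elim v xs) (by rintro (i | i); exacts [hv i, hxs i])
    simp only [Formula.realize_equal] at this
    convert this using 3 <;> (funext j; cases j <;> rfl)
  | @rel n l R ts =>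
    intro N₁ N₂ S h v xs hv hxs
    choose ts' hts using fun i => exists_term_reduct (T' := T') (ts i)
    simp only [BoundedFormula.Realize, ← hts]
    have hm : ∀ i, Sum.elim v xs i ∈ S := by rintro (i | i); exacts [hv i, hxs i]
    have e1 : (Sum.elim (fun i => (v i).1) fun i => (xs i).1) =
        fun i => (Sum.elim v xs i).1 := by funext j; cases j <;> rfl
    have e2 : (Sum.elim (fun i => (v i).2) fun i => (xs i).2) =
        fun i => (Sum.elim v xs i).2 := by funext j; cases j <;> rfl
    rw [e1, e2]
    rcases R with R | R
    · have := h.pmap _ (R.formula ts') (Sum.elim v xs) hm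
      rw [Formula.realize_rel, Formula.realize_rel] at this
      exact this
    · obtain ⟨R⟩ := R
      obtain ⟨rfl⟩ := R
      have := h.term_mem_H hG (ts' 0) (Sum.elim v xs) hm
      simp only [HSet, Set.mem_ofPred_eq] at this
      have e3 : ∀ {N : Mdl T'} (y : Fin 1 → N), y = ![y 0] := fun y => by
        funext j; rw [Fin.fin_one_eq_zero j]; rfl
      rw [e3 fun i => Term.realize (fun i => (Sum.elim v xs i).1) (ts' i),
        e3 fun i => Term.realize (fun i => (Sum.elim v xs i).2) (ts' i)]
      exact this
  | imp φ ψ ih₁ ih₂ =>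
    intro N₁ N₂ S h v xs hv hxs
    simp only [BoundedFormula.realize_imp]
    rw [ih₁ h v xs hv hxs, ih₂ h v xs hv hxs]
  | @all n φ ih =>
    have key : ∀ {N₁ N₂ : Mdl T'} {S : Set (N₁ × N₂)}, HMap N₁ N₂ S →
        ∀ (v : α → N₁ × N₂) (xs : Fin n → N₁ × N₂), (∀ i, v i ∈ S) → (∀ i, xs i ∈ S) →
        φ.all.Realize (fun i => (v i).2) (fun i => (xs i).2) →
        φ.all.Realize (fun i => (v i).1) fun i => (xs i).1 := by
      intro N₁ N₂ S h v xs hv hxs h2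
      rw [BoundedFormula.realize_all]
      intro c
      obtain ⟨N', e, S', h', hS', c', hc'⟩ := h.exists_extend hG c
      have h3 : φ.all.Realize (e ∘ fun i => (v i).2) (e ∘ fun i => (xs i).2) :=
        (e.map_boundedFormula φ.all _ _).2 h2
      have h4 := ih h' (fun i => ((v i).1, e (v i).2))
        (Fin.snoc (α := fun _ => N₁ × N') (fun i => ((xs i).1, e (xs i).2)) (c, c'))
        (fun i => hS' _ (hv i)) (fun i => by
          refine Fin.lastCases ?_ (fun i => ?_) i
          · rw [Fin.snoc_last]; exact hc'
          · rw [Fin.snoc_castSucc]; exact hS' _ (hxs i))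
      have h5 := (BoundedFormula.realize_all.1 h3) c'
      have e1 : (fun i => ((Fin.snoc (α := fun _ => N₁ × N') (fun i => ((xs i).1, e (xs i).2))
          (c, c') : Fin (n + 1) → N₁ × N') i).1) =
          Fin.snoc (α := fun _ => (N₁ : Type (max u v))) (fun i => (xs i).1) c := by
        funext j
        refine Fin.lastCases ?_ (fun i => ?_) j <;> simp
      have e2 : (fun i => ((Fin.snoc (α := fun _ => N₁ × N') (fun i => ((xs i).1, e (xs i).2))
          (c, c') : Fin (n + 1) → N₁ × N') i).2) =
          Fin.snoc (α := fun _ => (N' : Type (max u v))) (e ∘ fun i => (xs i).2) c' := by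
        funext j
        refine Fin.lastCases ?_ (fun i => ?_) j <;> simp
      rw [e1, e2] at h4
      exact h4.2 h5
    intro N₁ N₂ S h v xs hv hxs
    refine ⟨fun h1 => ?_, key h v xs hv hxs⟩
    exact key h.symm (fun i => (v i).swap) (fun i => (xs i).swap)
      (fun i => ⟨_, hv i, rfl⟩) (fun i => ⟨_, hxs i, rfl⟩) h1

end BackAndForth

section Separation

variable {L : FirstOrder.Language.{u, v}} {T' : (LH L).Theory}

theorem Ind.union_H {N : Mdl T'} {A C : Set N} (h : Ind N A) (hC : C.Finite)
    (hCH : C ⊆ HSet L N) : Ind N (A ∪ C) := by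
  induction C, hC using Set.Finite.induction_on with
  | empty => simpa using h
  | @insert c C _ _ ih =>
    rw [Set.union_insert]
    exact (ih fun x hx => hCH (Set.mem_insert_of_mem _ hx)).mem_H (hCH (Set.mem_insert _ _))

theorem exists_ind_union {N : Mdl T'} {A : Set N} (hA : A.Finite) :
    ∃ C : Set N, C.Finite ∧ C ⊆ HSet L N ∧ Ind N (A ∪ C) := by
  induction A, hA using Set.Finite.induction_on with
  | empty => exact ⟨∅, Set.finite_empty, Set.empty_subset _, by simpa using Ind.empty⟩
  | @insert a A _ _ ih =>
    obtain ⟨C, hC, hCH, hI⟩ := ih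
    by_cases ha : a ∈ acl L N (A ∪ C ∪ HSet L N)
    · obtain ⟨k, w, hw, haw⟩ := acl_finite_char ha
      have hf : (Set.range w ∩ HSet L N).Finite := (Set.finite_range w).inter_of_left _
      refine ⟨C ∪ (Set.range w ∩ HSet L N), hC.union hf,
        Set.union_subset hCH Set.inter_subset_right, ?_⟩
      rw [Set.insert_union, ← Set.union_assoc]
      refine (hI.union_H hf Set.inter_subset_right).alg (acl_mono ?_ haw)
      rintro _ ⟨i, rfl⟩
      exact (hw i).imp id fun h => ⟨⟨i, rfl⟩, h⟩
    · refine ⟨C, hC, hCH, ?_⟩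
      rw [Set.insert_union]
      exact hI.generic ha

theorem exists_ind_tuple {N : Mdl T'} {β : Type} [Finite β] (a : β → N) :
    ∃ (m : ℕ) (h : Fin m → N), (∀ i, h i ∈ HSet L N) ∧ Ind N (Set.range (Sum.elim a h)) := by
  obtain ⟨C, hC, hCH, hI⟩ := exists_ind_union (Set.finite_range a)
  obtain ⟨m, h, rfl⟩ := exists_range_eq_of_finite hC
  exact ⟨m, h, fun i => hCH ⟨i, rfl⟩, by rwa [Set.Sum.elim_range]⟩

/-- Separation: if the `L`-type over `w` decides `F` among the realizations of `Q`, then `F` is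
given by an `L`-formula on the set defined by a finite part of `Q`. -/
theorem exists_separation {γ : Type} [Finite γ] {N : Mdl T'} (w : γ → N)
    {F : ∀ N : Mdl T', (Fin 1 ⊕ γ → N) → Prop} (hF : UDef (LH L) F) {ι : Type (max u v)}
    (Q : ι → ∀ N : Mdl T', (Fin 1 ⊕ γ → N) → Prop) (hQ : ∀ i, UDef (LH L) (Q i))
    (h : ∀ (N' : Mdl T') (e : N ↪ₑ[LH L] N') (x x' : N'),
      (∀ i, Q i N' (Sum.elim (fun _ => x) (e ∘ w))) →
      (∀ i, Q i N' (Sum.elim (fun _ => x') (e ∘ w))) →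
      (∀ ψ : L.Formula (Fin 1 ⊕ γ), ψ.Realize (Sum.elim (fun _ => x) (e ∘ w)) ↔
        ψ.Realize (Sum.elim (fun _ => x') (e ∘ w))) →
      F N' (Sum.elim (fun _ => x) (e ∘ w)) → F N' (Sum.elim (fun _ => x') (e ∘ w))) :
    ∃ (s : Finset ι) (ψ : L.Formula (Fin 1 ⊕ γ)), ∀ x : N,
      (∀ i ∈ s, Q i N (Sum.elim (fun _ => x) w)) →
      (F N (Sum.elim (fun _ => x) w) ↔ ψ.Realize (Sum.elim (fun _ => x) w)) := by
  classical
  let r : Bool → Fin 1 ⊕ γ → γ ⊕ Bool := fun b => Sum.elim (fun _ => Sum.inr b) Sum.inl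
  let P : Option (ι ⊕ L.Formula (Fin 1 ⊕ γ)) → ∀ N : Mdl T', (γ ⊕ Bool → N) → Prop := fun o N v =>
    o.elim (F N (v ∘ r true) ∧ ¬ F N (v ∘ r false)) (Sum.elim
      (fun i => Q i N (v ∘ r true) ∧ Q i N (v ∘ r false))
      fun ψ => ψ.Realize (v ∘ r true) ↔ ψ.Realize (v ∘ r false))
  have hr : ∀ {N : Mdl T'} (w : γ → N) (z : Bool → N) (b : Bool),
      Sum.elim w z ∘ r b = Sum.elim (fun _ => z b) w := by
    intro N w z b; funext j; cases j <;> rfl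
  have hP : ∀ o, UDef (LH L) (P o) := by
    rintro (_ | i | ψ)
    · exact (hF.relabel (r true)).and (hF.relabel (r false)).not
    · exact ((hQ i).relabel (r true)).and ((hQ i).relabel (r false))
    · exact (((UDef.of_formula ψ).relabel (r true)).iff
        ((UDef.of_formula ψ).relabel (r false))).ofL
  have hfin : ∃ s : Finset (Option (ι ⊕ L.Formula (Fin 1 ⊕ γ))),
      ¬ ∃ z : Bool → N, ∀ o ∈ s, P o N (Sum.elim w z) := by
    by_contra! hne
    obtain ⟨N', e, z, hz⟩ := exists_realization P hP N w hne
    have h0 := hz none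
    simp only [P, Option.elim, hr] at h0
    refine h0.2 (h N' e (z true) (z false) (fun i => ?_) (fun i => ?_) (fun ψ => ?_) h0.1)
    · have := hz (some (Sum.inl i))
      simp only [P, Option.elim, Sum.elim_inl, hr] at this
      exact this.1
    · have := hz (some (Sum.inl i))
      simp only [P, Option.elim, Sum.elim_inl, hr] at this
      exact this.2
    · have := hz (some (Sum.inr ψ))
      simpa only [P, Option.elim, Sum.elim_inr, hr] using this
  obtain ⟨s, hs⟩ := hfin
  let s₁ : Finset ι := s.eraseNone.toLeft
  let t : Finset (L.Formula (Fin 1 ⊕ γ)) := s.eraseNone.toRight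
  have key : ∀ x x' : N, (∀ i ∈ s₁, Q i N (Sum.elim (fun _ => x) w)) →
      (∀ i ∈ s₁, Q i N (Sum.elim (fun _ => x') w)) →
      (∀ ψ ∈ t, ψ.Realize (Sum.elim (fun _ => x) w) ↔ ψ.Realize (Sum.elim (fun _ => x') w)) →
      F N (Sum.elim (fun _ => x) w) → F N (Sum.elim (fun _ => x') w) := by
    intro x x' h1 h2 h3 h4
    by_contra h5
    refine hs ⟨fun b => if b then x else x', ?_⟩
    rintro (_ | i | ψ) ho
    · simp only [P, Option.elim, hr]
      exact ⟨h4, h5⟩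
    · simp only [P, Option.elim, Sum.elim_inl, hr]
      have : i ∈ s₁ := by simpa [s₁] using ho
      exact ⟨h1 i this, h2 i this⟩
    · simp only [P, Option.elim, Sum.elim_inr, hr]
      have : ψ ∈ t := by simpa [t] using ho
      exact h3 ψ this
  let E : Type := {ε : Fin t.card → Prop // ∃ x : N, (∀ i ∈ s₁, Q i N (Sum.elim (fun _ => x) w)) ∧
    F N (Sum.elim (fun _ => x) w) ∧
    ∀ j, (t.equivFin.symm j).1.Realize (Sum.elim (fun _ => x) w) ↔ ε j}
  obtain ⟨ψ, hψ⟩ : UDef L fun (N : Mdl T') (v : Fin 1 ⊕ γ → N) =>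
      ∃ ε : E, ∀ j, ((t.equivFin.symm j).1.Realize v ↔ ε.1 j) :=
    UDef.exFin fun ε => UDef.allFin fun j => (UDef.of_formula _).iff (UDef.const _)
  refine ⟨s₁, ψ, fun x hx => ?_⟩
  rw [hψ]
  constructor
  · intro hFx
    exact ⟨⟨_, x, hx, hFx, fun j => Iff.rfl⟩, fun j => Iff.rfl⟩
  · rintro ⟨⟨ε, y, hy, hFy, hyε⟩, hxε⟩
    refine key y x hy hx (fun χ hχ => ?_) hFy
    have := (hyε (t.equivFin ⟨χ, hχ⟩)).trans (hxε (t.equivFin ⟨χ, hχ⟩)).symm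
    simpa using this

theorem hmap_diag (hG : Geo T') {γ : Type} [Finite γ] {N N' : Mdl T'} (e : N ↪ₑ[LH L] N')
    {w : γ → N} (hw : Ind N (Set.range w)) :
    HMap N' N' (Set.range fun i => (e (w i), e (w i))) where
  fin := Set.finite_range _
  pmap := by
    intro δ _ φ v hv
    choose s hs using hv
    have : (fun i => (v i).1) = fun i => (v i).2 := by funext i; rw [← hs]
    rw [this]
  mem_H := by rintro _ ⟨i, rfl⟩; rfl
  ind₁ := by
    have := hw.map e hG
    rw [← Set.range_comp] at this ⊢
    exact this
  ind₂ := by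
    have := hw.map e hG
    rw [← Set.range_comp] at this ⊢
    exact this

theorem HMap.udef_iff {lov : Prop} (hG : Good T' lov) {γ : Type} [Finite γ] {N₁ N₂ : Mdl T'}
    {S : Set (N₁ × N₂)} (h : HMap N₁ N₂ S) {F : ∀ N : Mdl T', (γ → N) → Prop}
    (hF : UDef (LH L) F) (v : γ → N₁ × N₂) (hv : ∀ i, v i ∈ S) :
    F N₁ (fun i => (v i).1) ↔ F N₂ fun i => (v i).2 := by
  obtain ⟨φ, hφ⟩ := hF
  rw [← hφ, ← hφ]
  have := h.realize_iff hG φ v (fun i : Fin 0 => i.elim0) hv fun i => i.elim0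
  rw [Formula.Realize, Formula.Realize]
  convert this using 1 <;> congr! 1

theorem exists_separation_H {lov : Prop} (hG : Good T' lov) {γ : Type} [Finite γ] {N : Mdl T'}
    {w : γ → N} (hw : Ind N (Set.range w)) {F : ∀ N : Mdl T', (Fin 1 ⊕ γ → N) → Prop}
    (hF : UDef (LH L) F) :
    ∃ ψ : L.Formula (Fin 1 ⊕ γ), ∀ x ∈ HSet L N,
      (F N (Sum.elim (fun _ => x) w) ↔ ψ.Realize (Sum.elim (fun _ => x) w)) := by
  obtain ⟨s, ψ, hψ⟩ := exists_separation w hF (ι := PUnit)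
    (fun _ N v => v (Sum.inl 0) ∈ HSet L N) (fun _ => UDef.memH _) (by
      intro N' e x x' hx hx' hψ hFx
      have h1 := (hmap_diag hG.toGeo e hw).insert_H (PMap.of_insert hψ) (hx PUnit.unit)
        (hx' PUnit.unit)
      have h2 := h1.udef_iff hG hF (Sum.elim (fun _ => (x, x')) fun i => (e (w i), e (w i))) (by
        rintro (i | i)
        · exact Or.inl rfl
        · exact Or.inr ⟨i, rfl⟩)
      convert h2.1 (by convert hFx using 2 with j; cases j <;> rfl) using 2 with j
      cases j <;> rfl)
  exact ⟨ψ, fun x hx => hψ x fun _ _ => hx⟩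

theorem exists_separation_generic {lov : Prop} (hG : Good T' lov) {γ : Type} [Finite γ]
    {N : Mdl T'} {w : γ → N} (hw : Ind N (Set.range w))
    {F : ∀ N : Mdl T', (Fin 1 ⊕ γ → N) → Prop} (hF : UDef (LH L) F) :
    ∃ (s : Finset (Σ m, L.Formula (Fin 1 ⊕ (γ ⊕ Fin m)))) (ψ : L.Formula (Fin 1 ⊕ γ)), ∀ x : N,
      (∀ p ∈ s, ¬ Sig p.2 N w x) →
      (F N (Sum.elim (fun _ => x) w) ↔ ψ.Realize (Sum.elim (fun _ => x) w)) := by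
  obtain ⟨s, ψ, hψ⟩ := exists_separation w hF (ι := Σ m, L.Formula (Fin 1 ⊕ (γ ⊕ Fin m)))
    (fun p N v => ¬ Sig p.2 N (fun i => v (Sum.inr i)) (v (Sum.inl 0)))
    (fun p => (hG.udef_sig p.2).not) (by
      intro N' e x x' hx hx' hψ hFx
      have h1 := (hmap_diag hG.toGeo e hw).insert_generic (PMap.of_insert hψ)
        (by
          rw [← Set.range_comp]
          intro hac
          obtain ⟨m, χ, hχ⟩ := mem_acl_union_H.1 hac
          exact hx ⟨m, χ⟩ hχ)
        (by
          rw [← Set.range_comp]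
          intro hac
          obtain ⟨m, χ, hχ⟩ := mem_acl_union_H.1 hac
          exact hx' ⟨m, χ⟩ hχ)
      have h2 := h1.udef_iff hG hF (Sum.elim (fun _ => (x, x')) fun i => (e (w i), e (w i))) (by
        rintro (i | i)
        · exact Or.inl rfl
        · exact Or.inr ⟨i, rfl⟩)
      convert h2.1 (by convert hFx using 2 with j; cases j <;> rfl) using 2 with j
      cases j <;> rfl)
  exact ⟨s, ψ, hψ⟩

theorem exists_finset_of_cover {β : Type} {κ : Type (max u v)}
    (G : κ → ∀ N : Mdl T', (β → N) → Prop) (hGd : ∀ p, UDef (LH L) (G p))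
    (h : ∀ N a, ∃ p, G p N a) (M : Mdl T') : ∃ J : Finset κ, ∀ a, ∃ p ∈ J, G p M a := by
  by_contra! hne
  obtain ⟨N', e, z, hz⟩ := exists_realization (γ := Empty) (β := β)
    (fun p N v => ¬ G p N fun i => v (Sum.inr i)) (fun p => ((hGd p).relabel Sum.inr).not) M
    Empty.elim hne
  obtain ⟨p, hp⟩ := h N' z
  exact hz p hp

theorem exists_uniform_H {lov : Prop} (hG : Good T' lov) {β : Type} [Finite β]
    {F : ∀ N : Mdl T', (Fin 1 ⊕ β → N) → Prop} (hF : UDef (LH L) F) (M : Mdl T') :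
    ∃ J : Finset (Σ m, L.Formula (Fin 1 ⊕ (β ⊕ Fin m))), ∀ a : β → M, ∃ p ∈ J,
      ∃ h : Fin p.1 → M, ∀ x ∈ HSet L M, (F M (Sum.elim (fun _ => x) a) ↔
        p.2.Realize (Sum.elim (fun _ => x) (Sum.elim a h))) := by
  refine exists_finset_of_cover (κ := Σ m, L.Formula (Fin 1 ⊕ (β ⊕ Fin m)))
    (fun (p : Σ m, L.Formula (Fin 1 ⊕ (β ⊕ Fin m))) (N : Mdl T') (a : β → N) =>
    ∃ h : Fin p.1 → N, ∀ x ∈ HSet L N,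
    (F N (Sum.elim (fun _ => x) a) ↔
        p.2.Realize (Sum.elim (fun _ => x) (Sum.elim a h)))) (fun p => ?_) (fun N a => ?_) M
  · refine (UDef.ex (γ := β) (β := Fin p.1) (UDef.all (γ := β ⊕ Fin p.1) (β := Fin 1)
      (P := fun N v => v (Sum.inr 0) ∈ HSet L N →
        (F N (Sum.elim (fun i => v (Sum.inr i)) fun i => v (Sum.inl (Sum.inl i))) ↔
        p.2.Realize (Sum.elim (fun i => v (Sum.inr i)) fun i => v (Sum.inl i))))
      (UDef.imp (UDef.memH _) (UDef.iff ?_ (UDef.ofL ?_))))).congr fun N v => ?_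
    · refine (hF.relabel (Sum.elim Sum.inr fun i => Sum.inl (Sum.inl i))).congr fun N v => ?_
      refine iff_of_eq (congrArg _ ?_)
      funext j; cases j <;> rfl
    · refine ((UDef.of_formula p.2).relabel (Sum.elim Sum.inr Sum.inl)).congr fun N v => ?_
      refine iff_of_eq (congrArg _ ?_)
      funext j; cases j <;> rfl
    · refine exists_congr fun h => ⟨fun H x hx => H (fun _ => x) hx, fun H z hz => ?_⟩
      have hz0 : z = fun _ => z 0 := by funext i; rw [Fin.fin_one_eq_zero i]
      rw [hz0]
      exact H (z 0) hz
  · obtain ⟨m, h, -, hI⟩ := exists_ind_tuple a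
    obtain ⟨ψ, hψ⟩ := exists_separation_H hG hI
      (hF.relabel (Sum.map id Sum.inl : Fin 1 ⊕ β → Fin 1 ⊕ (β ⊕ Fin m)))
    refine ⟨⟨m, ψ⟩, h, fun x hx => ?_⟩
    rw [← hψ x hx]
    refine iff_of_eq (congrArg _ ?_)
    funext j; cases j <;> rfl

theorem exists_uniform_generic {lov : Prop} (hG : Good T' lov) {β : Type} [Finite β]
    {F : ∀ N : Mdl T', (Fin 1 ⊕ β → N) → Prop} (hF : UDef (LH L) F) (M : Mdl T') :
    ∃ J : Finset (Σ m, L.Formula (Fin 1 ⊕ (β ⊕ Fin m)) ×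
      Finset (Σ k, L.Formula (Fin 1 ⊕ ((β ⊕ Fin m) ⊕ Fin k)))), ∀ a : β → M, ∃ p ∈ J,
      ∃ h : Fin p.1 → M, ∀ x : M, (∀ q ∈ p.2.2, ¬ Sig q.2 M (Sum.elim a h) x) →
        (F M (Sum.elim (fun _ => x) a) ↔
          p.2.1.Realize (Sum.elim (fun _ => x) (Sum.elim a h))) := by
  refine exists_finset_of_cover (κ := Σ m, L.Formula (Fin 1 ⊕ (β ⊕ Fin m)) ×
      Finset (Σ k, L.Formula (Fin 1 ⊕ ((β ⊕ Fin m) ⊕ Fin k))))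
    (fun (p : Σ m, L.Formula (Fin 1 ⊕ (β ⊕ Fin m)) ×
      Finset (Σ k, L.Formula (Fin 1 ⊕ ((β ⊕ Fin m) ⊕ Fin k)))) (N : Mdl T') (a : β → N) =>
    ∃ h : Fin p.1 → N, ∀ x : N,
    (∀ q ∈ p.2.2, ¬ Sig q.2 N (Sum.elim a h) x) →
    (F N (Sum.elim (fun _ => x) a) ↔
        p.2.1.Realize (Sum.elim (fun _ => x) (Sum.elim a h)))) (fun p => ?_) (fun N a => ?_) M
  · refine (UDef.ex (γ := β) (β := Fin p.1) (UDef.all (γ := β ⊕ Fin p.1) (β := Fin 1)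
      (P := fun N v => (∀ q : p.2.2, ¬ Sig q.1.2 N (fun i => v (Sum.inl i)) (v (Sum.inr 0))) →
        (F N (Sum.elim (fun i => v (Sum.inr i)) fun i => v (Sum.inl (Sum.inl i))) ↔
        p.2.1.Realize (Sum.elim (fun i => v (Sum.inr i)) fun i => v (Sum.inl i))))
      (UDef.imp (UDef.allFin fun q => UDef.not ?_) (UDef.iff ?_ (UDef.ofL ?_))))).congr
        fun N v => ?_
    · exact (hG.udef_sig q.1.2).relabel (Sum.elim Sum.inr Sum.inl)
    · refine (hF.relabel (Sum.elim Sum.inr fun i => Sum.inl (Sum.inl i))).congr fun N v => ?_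
      refine iff_of_eq (congrArg _ ?_)
      funext j; cases j <;> rfl
    · refine ((UDef.of_formula p.2.1).relabel (Sum.elim Sum.inr Sum.inl)).congr fun N v => ?_
      refine iff_of_eq (congrArg _ ?_)
      funext j; cases j <;> rfl
    · refine exists_congr fun h => ⟨fun H x hx => H (fun _ => x) fun q => hx q.1 q.2,
        fun H z hz => ?_⟩
      have hz0 : z = fun _ => z 0 := by funext i; rw [Fin.fin_one_eq_zero i]
      rw [hz0]
      exact H (z 0) fun q hq => hz ⟨q, hq⟩
  · obtain ⟨m, h, -, hI⟩ := exists_ind_tuple a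
    obtain ⟨s, ψ, hψ⟩ := exists_separation_generic hG hI
      (hF.relabel (Sum.map id Sum.inl : Fin 1 ⊕ β → Fin 1 ⊕ (β ⊕ Fin m)))
    refine ⟨⟨m, ψ, s⟩, h, fun x hx => ?_⟩
    rw [← hψ x hx]
    refine iff_of_eq (congrArg _ ?_)
    funext j; cases j <;> rfl

end Separation

section Thicken

variable {B B' A A' : Type*}

theorem Pat.cons {R : B → A → Prop} {n : ℕ} {a : List Bool → A} (h : Pat R (n + 1) a)
    (c : Bool) : Pat R n fun η => a (c :: η) :=
  h.comp (fun η => c :: η) (fun η hη => by simpa using hη)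
    (fun η ν _ _ => comparable_cons c η ν) fun η ν h => by simpa using h

/-- Patterns only depend on the families of parameters realized together. -/
theorem Pat.transport {R : B → A → Prop} {R' : B' → A' → Prop} {n : ℕ} {a : List Bool → A}
    (h : Pat R n a) (hn : 0 < n) (g : A → A')
    (h₁ : ∀ b, (∃ a, R b a) → ∃ b', ∀ a, R b a → R' b' (g a))
    (h₂ : ∀ b', (∃ a, R' b' (g a)) → ∃ b, ∀ a, R' b' (g a) → R b a) : Pat R' n (g ∘ a) := by
  constructor
  · intro X hX hXa
    rcases X.eq_empty_or_nonempty with rfl | ⟨η, hη⟩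
    · obtain ⟨b, hb⟩ := h.1 {[]} (by simpa using hn)
        (by rintro _ rfl _ rfl h; exact (h rfl).elim)
      obtain ⟨b', -⟩ := h₁ b ⟨_, hb [] rfl⟩
      exact ⟨b', by simp⟩
    · obtain ⟨b, hb⟩ := h.1 X hX hXa
      obtain ⟨b', hb'⟩ := h₁ b ⟨_, hb η hη⟩
      exact ⟨b', fun ν hν => hb' _ (hb ν hν)⟩
  · rintro η ν hη hν hne hc ⟨b', h3, h4⟩
    obtain ⟨b, hb⟩ := h₂ b' ⟨_, h3⟩
    exact h.2 η ν hη hν hne hc ⟨b, hb _ h3, hb _ h4⟩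

theorem HasPat.transport {R : B → A → Prop} {R' : B' → A' → Prop} (h : HasPat R) (g : A → A')
    (h₁ : ∀ b, (∃ a, R b a) → ∃ b', ∀ a, R b a → R' b' (g a))
    (h₂ : ∀ b', (∃ a, R' b' (g a)) → ∃ b, ∀ a, R' b' (g a) → R b a) : HasPat R' := fun n => by
  obtain ⟨a, ha⟩ := h (n + 1)
  exact ⟨_, (ha.transport n.succ_pos g h₁ h₂).mono n.le_succ⟩

theorem IsTreeAntichain.join {X Y : Set (List Bool)} (hX : IsTreeAntichain X)
    (hY : IsTreeAntichain Y) :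
    IsTreeAntichain (List.cons false '' X ∪ List.cons true '' Y) := by
  rintro _ (⟨η, hη, rfl⟩ | ⟨η, hη, rfl⟩) _ (⟨ν, hν, rfl⟩ | ⟨ν, hν, rfl⟩) hne
  · rw [comparable_cons]
    exact hX η hη ν hν fun h => hne (by rw [h])
  · simp [TreeComparable]
  · simp [TreeComparable]
  · rw [comparable_cons]
    exact hY η hη ν hν fun h => hne (by rw [h])

theorem comparable_replicate (i j : ℕ) :
    TreeComparable (List.replicate i true) (List.replicate j true) := by
  rcases le_total i j with h | h
  · exact Or.inl ⟨List.replicate (j - i) true, by simp [h]⟩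
  · exact Or.inr ⟨List.replicate (i - j) true, by simp [h]⟩

/-- Any antichain of the left half of a pattern is realized by arbitrarily many elements. -/
theorem Pat.exists_many {R : B → A → Prop} {n k : ℕ} {a : List Bool → A}
    (h : Pat R (n + 1) a) (hk : k ≤ n) {X : Set (List Bool)} (hX : ∀ η ∈ X, η.length < n)
    (hXa : IsTreeAntichain X) : ∃ b : Fin k → B, Function.Injective b ∧
      ∀ i, ∀ η ∈ X, R (b i) (a (false :: η)) := by
  have hex : ∀ i : Fin k, ∃ b, R b (a (true :: List.replicate i true)) ∧
      ∀ η ∈ X, R b (a (false :: η)) := by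
    intro i
    obtain ⟨b, hb⟩ := h.1 (List.cons false '' X ∪ List.cons true '' {List.replicate i true})
      (by
        rintro _ (⟨η, hη, rfl⟩ | ⟨_, rfl, rfl⟩)
        · simpa using hX η hη
        · have := i.2
          simp; omega)
      (hXa.join (by rintro _ rfl _ rfl h; exact (h rfl).elim))
    exact ⟨b, hb _ (Or.inr ⟨_, rfl, rfl⟩), fun η hη => hb _ (Or.inl ⟨η, hη, rfl⟩)⟩
  choose b hb hb' using hex
  refine ⟨b, fun i j hij => ?_, hb'⟩
  by_contra hne
  have hi := i.2
  have hj := j.2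
  refine h.2 (true :: List.replicate i true) (true :: List.replicate j true) (by simp; omega)
    (by simp; omega) ?_ ((comparable_cons _ _ _).2 (comparable_replicate _ _))
    ⟨b i, hb i, hij ▸ hb j⟩
  intro h
  apply hne
  have := congrArg List.length h
  simpa [Fin.ext_iff] using this

/-- If the relation `R` of a pattern is contained in `S`, whose sections at comparable nodes have
fewer than `k` common points, then `k`-tuples of realizations of `S` have patterns. -/
theorem HasPat.thicken {R S : B → A → Prop} {G : A → Prop} (k : ℕ)
    (h : ∀ n, ∃ a, Pat R n a ∧ ∀ η : List Bool, η.length < n → G (a η))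
    (hRS : ∀ b a, G a → R b a → S b a)
    (hk : ∀ a a', G a → G a' → (¬ ∃ b, R b a ∧ R b a') →
      ¬ ∃ b : Fin k → B, Function.Injective b ∧ ∀ i, S (b i) a ∧ S (b i) a') :
    HasPat fun (b : Fin k → B) a => Function.Injective b ∧ ∀ i, S (b i) a := fun n => by
  obtain ⟨a, ha, hG⟩ := h (n + k + 1)
  have hG' : ∀ η : List Bool, η.length < n → G (a (false :: η)) :=
    fun η hη => hG _ (by simp; omega)
  refine ⟨fun η => a (false :: η), fun X hX hXa => ?_, fun η ν hη hν hne hc => ?_⟩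
  · obtain ⟨b, hb, hb'⟩ := ha.exists_many (k := k) (by omega)
      (fun η hη => (hX η hη).trans_le (by omega)) hXa
    exact ⟨b, fun η hη => ⟨hb, fun i => hRS _ _ (hG' η (hX η hη)) (hb' i η hη)⟩⟩
  · rintro ⟨b, h1, h2⟩
    refine hk _ _ (hG' η hη) (hG' ν hν) ?_ ⟨b, h1.1, fun i => ⟨h1.2 i, h2.2 i⟩⟩
    exact ha.2 _ _ (by simp; omega) (by simp; omega) (by simpa using hne)
      ((comparable_cons _ _ _).2 hc)

end Thicken

section Bound

variable {L : FirstOrder.Language.{u, v}} {T' : (LH L).Theory}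

/-- Uniform bounds on the finite fibres of definable families. -/
theorem Geo.exists_bound (hG : Geo T') {γ : Type} [Finite γ]
    {P : ∀ N : Mdl T', (Fin 1 ⊕ γ → N) → Prop} (hP : UDef L P) (M : Mdl T') :
    ∃ k : ℕ, ∀ w : γ → M, {x : M | P M (Sum.elim (fun _ => x) w)}.Finite →
      ¬ ∃ b : Fin k → M, Function.Injective b ∧ ∀ i, P M (Sum.elim (fun _ => b i) w) := by
  by_contra! hcon
  obtain ⟨N, e, z, hz⟩ := exists_realization (γ := Empty) (β := γ)
    (ι := ULift (Option ℕ)) (fun o N v => match o.down with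
      | none => ¬ {x : N | P N (Sum.elim (fun _ => x) fun i => v (Sum.inr i))}.Infinite
      | some n => ∃ y : Fin n → N, Function.Injective y ∧
        ∀ i, P N (Sum.elim (fun _ => y i) fun i => v (Sum.inr i)))
    (fun o => by
      rcases o with ⟨_ | n⟩
      · exact (UDef.ofL ((hG.inf hP).relabel Sum.inr)).not
      · exact UDef.ofL ((hP.many n).relabel Sum.inr)) M Empty.elim (fun s => by
      obtain ⟨k, hk⟩ : ∃ k, ∀ n, (⟨some n⟩ : ULift (Option ℕ)) ∈ s → n ≤ k := by
        obtain ⟨k, hk⟩ := (s.finite_toSet.preimage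
          (f := fun n : ℕ => (⟨some n⟩ : ULift (Option ℕ)))
          (fun n _ m _ h => by simpa using h)).bddAbove
        exact ⟨k, fun n hn => hk hn⟩
      obtain ⟨w, hw, b, hb, hb'⟩ := hcon k
      refine ⟨w, ?_⟩
      rintro ⟨_ | n⟩ ho
      · exact Set.not_infinite.2 hw
      · exact ⟨b ∘ Fin.castLE (hk n ho), hb.comp (Fin.castLE_injective _), fun i => hb' _⟩)
  refine hz ⟨none⟩ fun hfin => ?_
  obtain ⟨y, hy, hy'⟩ := hz ⟨some (Set.ncard {x | P N (Sum.elim (fun _ => x)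
    fun i => Sum.elim (e ∘ Empty.elim) z (Sum.inr i))} + 1)⟩
  have h1 := Set.ncard_le_ncard (s := Set.range y) (Set.range_subset_iff.2 fun i => hy' i) hfin
  rw [Set.ncard_range_of_injective hy, Nat.card_eq_fintype_card, Fintype.card_fin] at h1
  exact (Nat.lt_irrefl _) h1

end Bound

section OneVariable

variable {L : FirstOrder.Language.{u, v}} {T' : (LH L).Theory}

/-- Patterns of a definable relation on tuples of a definable set yield patterns of a definable
relation on the elements of this set. -/
theorem exists_one_variable {D : ∀ N : Mdl T', N → Prop}
    (hD : UDef (LH L) (γ := Fin 1) fun N v => D N (v 0)) (M : Mdl T') (n : ℕ) :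
    ∀ {γ : Type} [Finite γ] {P : ∀ N : Mdl T', (Fin n ⊕ γ → N) → Prop}, UDef (LH L) P →
    HasPat (fun (b : Fin n → {x // D M x}) (a : γ → M) => P M (Sum.elim (fun i => (b i).1) a)) →
    ∃ (γ' : Type) (_ : Finite γ') (P' : ∀ N : Mdl T', (Fin 1 ⊕ γ' → N) → Prop), UDef (LH L) P' ∧
      HasPat fun (b : {x // D M x}) (a : γ' → M) => P' M (Sum.elim (fun _ => b.1) a) := by
  induction n with
  | zero =>
    intro γ _ P _ h
    obtain ⟨a, ha⟩ := h 2
    have hs : ∀ η : List Bool, η.length < 2 → P M (Sum.elim (fun i : Fin 0 => i.elim0) (a η)) := by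
      intro η hη
      obtain ⟨b, hb⟩ := ha.1 {η} (by rintro _ rfl; exact hη)
        (by rintro _ rfl _ rfl h; exact (h rfl).elim)
      convert hb η rfl using 3
    refine (ha.2 [] [true] (by simp) (by simp) (by simp) (Or.inl (by simp))
      ⟨fun i => i.elim0, ?_, ?_⟩).elim
    · convert hs [] (by simp) using 3
    · convert hs [true] (by simp) using 3
  | succ n ih =>
    intro γ _ P hP h
    have h' : HasPat (fun (b : {x // D M x} × (Fin n → {x // D M x})) (a : γ → M) =>
        P M (Sum.elim (Fin.cons b.1.1 fun i => (b.2 i).1) a)) := by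
      refine h.transport id (fun b _ => ⟨(b 0, fun i => b i.succ), fun a ha => ?_⟩)
        fun b _ => ⟨Fin.cons b.1 b.2, fun a ha => ?_⟩
      · convert ha using 3 with i
        · refine Fin.cases ?_ (fun j => ?_) i <;> rfl
        · rfl
      · convert ha using 3 with i
        · refine Fin.cases ?_ (fun j => ?_) i <;> rfl
        · rfl
    rcases fibration (fun (b₁ : {x // D M x}) (b₂ : Fin n → {x // D M x}) (a : γ → M) =>
      P M (Sum.elim (Fin.cons b₁.1 fun i => (b₂ i).1) a)) h' with ⟨s, 𝒵, hp⟩ | hk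
    · refine ⟨{η : List Bool // η.length < s} × γ, inferInstance, fun N v => ∀ Z : 𝒵,
        ∃ b₂ : Fin n → N, (∀ i, D N (b₂ i)) ∧ ∀ η : Z.1,
          P N (Sum.elim (Fin.cons (v (Sum.inl 0)) b₂) fun i => v (Sum.inr (η.1, i))),
        UDef.allFin fun Z => ?_, hp.transport (fun t p => t p.1 p.2) ?_ ?_⟩
      · refine UDef.ex (β := Fin n) (P := fun N v => (∀ i, D N (v (Sum.inr i))) ∧ ∀ η : Z.1,
          P N (Sum.elim (Fin.cons (v (Sum.inl (Sum.inl 0))) fun i => v (Sum.inr i))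
            fun i => v (Sum.inl (Sum.inr (η.1, i))))) ?_
        refine UDef.and (UDef.allFin fun i => hD.relabel fun _ => Sum.inr i)
          (UDef.allFin fun η => ?_)
        refine (hP.relabel (Sum.elim (Fin.cons (Sum.inl (Sum.inl 0)) Sum.inr)
          fun i => Sum.inl (Sum.inr (η.1, i)))).congr fun N v => ?_
        refine iff_of_eq (congrArg _ ?_)
        funext j
        rcases j with j | j
        · refine Fin.cases ?_ (fun j => ?_) j <;> rfl
        · rfl
      · refine fun b _ => ⟨b, fun t ht Z => ?_⟩
        obtain ⟨b₂, hb₂⟩ := ht Z.1 Z.2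
        exact ⟨fun i => (b₂ i).1, fun i => (b₂ i).2, fun η => hb₂ _ η.2⟩
      · refine fun b _ => ⟨b, fun t ht Z hZ => ?_⟩
        obtain ⟨b₂, hD₂, hb₂⟩ := ht ⟨Z, hZ⟩
        exact ⟨fun i => ⟨b₂ i, hD₂ i⟩, fun η hη => hb₂ ⟨η, hη⟩⟩
    · refine ih (γ := Fin 1 ⊕ γ) (P := fun N v =>
        P N (Sum.elim (Fin.cons (v (Sum.inr (Sum.inl 0))) fun i => v (Sum.inl i))
          fun i => v (Sum.inr (Sum.inr i)))) ?_ fun k => ?_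
      · refine (hP.relabel (Sum.elim (Fin.cons (Sum.inr (Sum.inl 0)) Sum.inl)
          fun i => Sum.inr (Sum.inr i))).congr fun N v => ?_
        refine iff_of_eq (congrArg _ ?_)
        funext j
        rcases j with j | j
        · refine Fin.cases ?_ (fun j => ?_) j <;> rfl
        · rfl
      · obtain ⟨b₁, a, ha⟩ := hk k
        exact ⟨_, ha.map (fun a => Sum.elim (fun _ => b₁.1) a) fun b η => Iff.rfl⟩

end OneVariable

section Reduction

variable {L : FirstOrder.Language.{u, v}} {T' : (LH L).Theory}

theorem HasPat.exists_color {B : Type*} {A : Type*} {κ : Type*} {R : B → A → Prop}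
    (h : HasPat R) (J : Finset κ) (P : κ → A → Prop) (hP : ∀ a, ∃ p ∈ J, P p a) :
    ∃ p ∈ J, ∀ n, ∃ a, Pat R n a ∧ ∀ η : List Bool, η.length < n → P p (a η) := by
  obtain ⟨j, hj⟩ := HasPat.const_param_color (fun j : Fin J.card => P (J.equivFin.symm j))
    (fun n => (h n).imp fun a ha => ⟨ha, fun η _ => by
      obtain ⟨p, hp, hpa⟩ := hP (a η)
      exact ⟨J.equivFin ⟨p, hp⟩, by simpa using hpa⟩⟩)
  exact ⟨_, (J.equivFin.symm j).2, hj⟩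

/-- In `M`, some `L`-definable relation has patterns. -/
def LPat (M : Mdl T') : Prop :=
  ∃ (k : ℕ) (δ : Type) (_ : Finite δ) (Q : ∀ N : Mdl T', (Fin k ⊕ δ → N) → Prop),
    UDef L Q ∧ HasPat fun (b : Fin k → M) (a : δ → M) => Q M (Sum.elim b a)

theorem Geo.lpat_of_thicken (hG : Geo T') {M : Mdl T'} {δ : Type} [Finite δ]
    (ψ : L.Formula (Fin 1 ⊕ δ)) {R : M → (δ → M) → Prop} {G : (δ → M) → Prop}
    (h : ∀ n, ∃ a, Pat R n a ∧ ∀ η : List Bool, η.length < n → G (a η))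
    (hR : ∀ x a, G a → R x a → ψ.Realize (Sum.elim (fun _ => x) a))
    (hfin : ∀ a a', G a → G a' → (¬ ∃ x, R x a ∧ R x a') →
      {x : M | ψ.Realize (Sum.elim (fun _ => x) a) ∧
        ψ.Realize (Sum.elim (fun _ => x) a')}.Finite) : LPat M := by
  obtain ⟨k, hk⟩ := hG.exists_bound (γ := δ ⊕ δ) (P := fun N v =>
    ψ.Realize (fun i => v (Sum.map id Sum.inl i)) ∧ ψ.Realize (fun i => v (Sum.map id Sum.inr i)))
    (((UDef.of_formula ψ).relabel _).and ((UDef.of_formula ψ).relabel _)) M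
  have hl : ∀ (x : M) (a a' : δ → M), (fun i => (Sum.elim (fun _ => x) (Sum.elim a a') :
      Fin 1 ⊕ (δ ⊕ δ) → M) (Sum.map id Sum.inl i)) = Sum.elim (fun _ => x) a := by
    intro x a a'; funext i; cases i <;> rfl
  have hr : ∀ (x : M) (a a' : δ → M), (fun i => (Sum.elim (fun _ => x) (Sum.elim a a') :
      Fin 1 ⊕ (δ ⊕ δ) → M) (Sum.map id Sum.inr i)) = Sum.elim (fun _ => x) a' := by
    intro x a a'; funext i; cases i <;> rfl
  have ht := HasPat.thicken (S := fun x a => ψ.Realize (Sum.elim (fun _ => x) a)) k h hR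
    fun a a' ha ha' hne => by
      have := hk (Sum.elim a a')
      simp only [hl, hr] at this
      exact this (hfin a a' ha ha' hne)
  refine ⟨k, δ, inferInstance, fun N v => Function.Injective (fun i => v (Sum.inl i)) ∧
    ∀ i, ψ.Realize (Sum.elim (fun _ => v (Sum.inl i)) fun j => v (Sum.inr j)), ?_, ht⟩
  refine UDef.and ?_ (UDef.allFin fun i => ?_)
  · refine (UDef.allFin (J := Fin k) fun i => UDef.allFin (J := Fin k) fun j =>
      (UDef.eq (Sum.inl i) (Sum.inl j)).imp (UDef.const (i = j))).congr fun N v => ?_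
    exact ⟨fun h i j => h i j, fun h i j hij => h hij⟩
  · refine ((UDef.of_formula ψ).relabel (Sum.elim (fun _ => Sum.inl i) Sum.inr)).congr
      fun N v => iff_of_eq (congrArg _ ?_)
    funext j; cases j <;> rfl

/-- Patterns on elements of `H` give patterns for an `L`-definable relation. -/
theorem Good.lpat_of_H {lov : Prop} (hG : Good T' lov) {M : Mdl T'} {γ : Type} [Finite γ]
    {F : ∀ N : Mdl T', (Fin 1 ⊕ γ → N) → Prop} (hF : UDef (LH L) F)
    (h : HasPat fun (b : {x // x ∈ HSet L M}) (a : γ → M) => F M (Sum.elim (fun _ => b.1) a)) :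
    LPat M := by
  have h' : HasPat fun (x : M) (a : γ → M) => x ∈ HSet L M ∧ F M (Sum.elim (fun _ => x) a) :=
    h.transport id (fun b _ => ⟨b.1, fun a ha => ⟨b.2, ha⟩⟩)
      fun x ⟨a, hx, _⟩ => ⟨⟨x, hx⟩, fun a ha => ha.2⟩
  obtain ⟨J, hJ⟩ := exists_uniform_H hG hF M
  obtain ⟨⟨m, ψ⟩, -, hp⟩ := h'.exists_color J
    (fun p a => ∃ h : Fin p.1 → M, ∀ x ∈ HSet L M, (F M (Sum.elim (fun _ => x) a) ↔
        p.2.Realize (Sum.elim (fun _ => x) (Sum.elim a h)))) hJ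
  dsimp only at hp
  refine hG.toGeo.lpat_of_thicken ψ
    (R := fun x w => x ∈ HSet L M ∧ F M (Sum.elim (fun _ => x) fun i => w (Sum.inl i)))
    (G := fun w => ∀ x ∈ HSet L M, (F M (Sum.elim (fun _ => x) fun i => w (Sum.inl i)) ↔
        ψ.Realize (Sum.elim (fun _ => x) w))) (fun n => ?_) (fun x w hw hx => (hw x hx.1).1 hx.2)
    fun w w' hw hw' hne => ?_
  · obtain ⟨a, ha, hc⟩ := hp n
    have hc' : ∀ η, ∃ h : Fin m → M, η.length < n → ∀ x ∈ HSet L M,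
        (F M (Sum.elim (fun _ => x) (a η)) ↔
        ψ.Realize (Sum.elim (fun _ => x) (Sum.elim (a η) h))) := by
      intro η
      by_cases hη : η.length < n
      · exact (hc η hη).imp fun h hh _ => hh
      · exact ⟨fun _ => Classical.choice inferInstance, fun h => (hη h).elim⟩
    choose h hh using hc'
    exact ⟨fun η => Sum.elim (a η) (h η), ha, hh⟩
  · by_contra hinf
    have hd := hG.dens (γ := (γ ⊕ Fin m) ⊕ (γ ⊕ Fin m))
      (ψ.relabel (Sum.map id Sum.inl) ⊓ ψ.relabel (Sum.map id Sum.inr)) M (Sum.elim w w')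
    have key : ∀ x : M, (ψ.relabel (Sum.map id Sum.inl) ⊓ ψ.relabel (Sum.map id Sum.inr) :
        L.Formula (Fin 1 ⊕ ((γ ⊕ Fin m) ⊕ (γ ⊕ Fin m)))).Realize
          (Sum.elim (fun _ => x) (Sum.elim w w')) ↔
        ψ.Realize (Sum.elim (fun _ => x) w) ∧ ψ.Realize (Sum.elim (fun _ => x) w') := by
      intro x
      rw [Formula.realize_inf, Formula.realize_relabel, Formula.realize_relabel]
      refine and_congr (iff_of_eq (congrArg _ ?_)) (iff_of_eq (congrArg _ ?_)) <;>
      · funext j; cases j <;> rfl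
    simp only [key] at hd
    obtain ⟨x, hx, h1, h2⟩ := hd hinf
    exact hne ⟨x, ⟨hx, (hw x hx).2 h1⟩, ⟨hx, (hw' x hx).2 h2⟩⟩

end Reduction

section Reduction

variable {L : FirstOrder.Language.{u, v}} {T' : (LH L).Theory}

/-- Patterns all of whose realizations are algebraic over the parameters and a fixed number of
elements of `H` give patterns for an `L`-definable relation. -/
theorem Good.lpat_of_sig {lov : Prop} (hG : Good T' lov) {M : Mdl T'} {γ : Type} [Finite γ]
    {m : ℕ} (χ : L.Formula (Fin 1 ⊕ (γ ⊕ Fin m))) {F : ∀ N : Mdl T', (Fin 1 ⊕ γ → N) → Prop}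
    (hF : UDef (LH L) F)
    (h : HasPat fun (b : (Fin m → {x // x ∈ HSet L M}) × M) (a : γ → M) =>
      F M (Sum.elim (fun _ => b.2) a) ∧
      χ.Realize (Sum.elim (fun _ => b.2) (Sum.elim a fun i => (b.1 i).1)) ∧
      {y : M | χ.Realize (Sum.elim (fun _ => y) (Sum.elim a fun i => (b.1 i).1))}.Finite) :
    LPat M := by
  obtain ⟨k, hk⟩ := hG.exists_bound (UDef.of_formula χ) M
  rcases fibration (fun (z : Fin m → {x // x ∈ HSet L M}) (x : M) (a : γ → M) =>
      F M (Sum.elim (fun _ => x) a) ∧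
      χ.Realize (Sum.elim (fun _ => x) (Sum.elim a fun i => (z i).1)) ∧
      {y : M | χ.Realize (Sum.elim (fun _ => y) (Sum.elim a fun i => (z i).1))}.Finite) h with
    ⟨s, 𝒵, hp⟩ | hp
  · have hP : UDef (LH L) fun (N : Mdl T') (v : Fin m ⊕ {η : List Bool // η.length < s} × γ → N) =>
        ∀ Z : 𝒵, ∃ y : Fin 1 → N, ∀ η : Z.1,
        F N (Sum.elim y fun i => v (Sum.inr (η.1, i))) ∧
        χ.Realize (Sum.elim y
          (Sum.elim (fun i => v (Sum.inr (η.1, i))) fun i => v (Sum.inl i))) ∧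
        {y : N | χ.Realize (Sum.elim (fun _ => y)
          (Sum.elim (fun i => v (Sum.inr (η.1, i))) fun i => v (Sum.inl i)))}.Finite := by
      refine UDef.allFin fun Z => UDef.ex (β := Fin 1) (P := fun N v => ∀ η : Z.1,
        F N (Sum.elim (fun i => v (Sum.inr i)) fun i => v (Sum.inl (Sum.inr (η.1, i)))) ∧
        χ.Realize (Sum.elim (fun i => v (Sum.inr i))
          (Sum.elim (fun i => v (Sum.inl (Sum.inr (η.1, i)))) fun i => v (Sum.inl (Sum.inl i)))) ∧
        {y : N | χ.Realize (Sum.elim (fun _ => y) (Sum.elim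
          (fun i => v (Sum.inl (Sum.inr (η.1, i)))) fun i => v (Sum.inl (Sum.inl i))))}.Finite)
        (UDef.allFin fun η => UDef.and ?_ (UDef.and (UDef.ofL ?_) (UDef.ofL ?_)))
      · refine (hF.relabel (Sum.elim Sum.inr fun i => Sum.inl (Sum.inr (η.1, i)))).congr
          fun N v => iff_of_eq (congrArg _ ?_)
        funext j; cases j <;> rfl
      · refine ((UDef.of_formula χ).relabel (Sum.elim Sum.inr (Sum.elim
          (fun i => Sum.inl (Sum.inr (η.1, i))) fun i => Sum.inl (Sum.inl i)))).congr
          fun N v => iff_of_eq (congrArg _ ?_)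
        funext j; rcases j with j | j | j <;> rfl
      · refine ((hG.inf (UDef.of_formula χ)).relabel (Sum.elim
          (fun i => Sum.inl (Sum.inr (η.1, i))) fun i => Sum.inl (Sum.inl i))).not.congr
          fun N v => ?_
        rw [Set.not_infinite]
        refine iff_of_eq (congrArg _ (congrArg _ (funext fun y => congrArg _ ?_)))
        funext j; rcases j with j | j | j <;> rfl
    obtain ⟨γ', _, P', hP', hpat⟩ := exists_one_variable (D := fun N x => x ∈ HSet L N)
      (UDef.memH 0) M m hP (by
        refine hp.transport (fun t p => t p.1 p.2) (fun z _ => ⟨z, fun t ht Z => ?_⟩)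
          fun z _ => ⟨z, fun t ht Z hZ => ?_⟩
        · obtain ⟨x, hx⟩ := ht Z.1 Z.2
          exact ⟨fun _ => x, fun η => hx η.1 η.2⟩
        · obtain ⟨y, hy⟩ := ht ⟨Z, hZ⟩
          refine ⟨y 0, fun η hη => ?_⟩
          have hy0 : y = fun _ => y 0 := by funext i; rw [Fin.fin_one_eq_zero i]
          have := hy ⟨η, hη⟩
          rw [hy0] at this
          exact this)
    exact hG.lpat_of_H hP' hpat
  · exfalso
    obtain ⟨z, a, ha⟩ := hp (k + 2)
    obtain ⟨b, hb, hb'⟩ := ha.exists_many (k := k) (X := {[]}) (by omega) (by simp)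
      (by rintro _ rfl _ rfl h; exact (h rfl).elim)
    obtain ⟨x, hx⟩ := ha.1 {[false]} (by simp) (by rintro _ rfl _ rfl h; exact (h rfl).elim)
    exact hk _ (hx _ rfl).2.2 ⟨b, hb, fun i => (hb' i [] rfl).2.1⟩

end Reduction

section Reduction

variable {L : FirstOrder.Language.{u, v}} {T' : (LH L).Theory}

theorem sig_relabel {γ δ : Type} (f : γ → δ) {m : ℕ} (χ : L.Formula (Fin 1 ⊕ (γ ⊕ Fin m)))
    (N : Mdl T') (w : δ → N) (x : N) :
    Sig (χ.relabel (Sum.map id (Sum.map f id))) N w x ↔ Sig χ N (w ∘ f) x := by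
  have key : ∀ (y : N) (z : Fin m → N), (χ.relabel (Sum.map id (Sum.map f id))).Realize
      (Sum.elim (fun _ => y) (Sum.elim w z)) ↔
      χ.Realize (Sum.elim (fun _ => y) (Sum.elim (w ∘ f) z)) := by
    intro y z
    rw [Formula.realize_relabel]
    refine iff_of_eq (congrArg _ ?_)
    funext j; rcases j with j | j | j <;> rfl
  simp only [Sig, key]

/-- Patterns for a relation given by the `L`-formula `ψ` outside of finitely many small sets. -/
theorem Good.lpat_of_generic {lov : Prop} (hG : Good T' lov) {M : Mdl T'} {δ : Type} [Finite δ]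
    (ψ : L.Formula (Fin 1 ⊕ δ)) (s : Finset (Σ k, L.Formula (Fin 1 ⊕ (δ ⊕ Fin k))))
    {R : M → (δ → M) → Prop} {G : (δ → M) → Prop}
    (hG' : ∀ w, G w → ∀ x, (∀ q ∈ s, ¬ Sig q.2 M w x) →
      (R x w ↔ ψ.Realize (Sum.elim (fun _ => x) w)))
    (h : ∀ n, ∃ a, Pat (fun x w => R x w ∧ ∀ q ∈ s, ¬ Sig q.2 M w x) n a ∧
      ∀ η : List Bool, η.length < n → G (a η)) : LPat M := by
  classical
  refine hG.toGeo.lpat_of_thicken ψ h (fun x w hw hx => (hG' w hw x hx.2).1 hx.1)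
    fun w w' hw hw' hne => ?_
  by_contra hinf
  let e : ∀ f : δ → δ ⊕ δ, (Σ k, L.Formula (Fin 1 ⊕ (δ ⊕ Fin k))) →
    Σ k, L.Formula (Fin 1 ⊕ ((δ ⊕ δ) ⊕ Fin k)) :=
    fun f q => ⟨q.1, q.2.relabel (Sum.map id (Sum.map f id))⟩
  have hd := hG.codens (γ := δ ⊕ δ)
    (ψ.relabel (Sum.map id Sum.inl) ⊓ ψ.relabel (Sum.map id Sum.inr))
    (s.image (e Sum.inl) ∪ s.image (e Sum.inr)) M (Sum.elim w w')
  have key : ∀ x : M, (ψ.relabel (Sum.map id Sum.inl) ⊓ ψ.relabel (Sum.map id Sum.inr) :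
      L.Formula (Fin 1 ⊕ (δ ⊕ δ))).Realize (Sum.elim (fun _ => x) (Sum.elim w w')) ↔
      ψ.Realize (Sum.elim (fun _ => x) w) ∧ ψ.Realize (Sum.elim (fun _ => x) w') := by
    intro x
    rw [Formula.realize_inf, Formula.realize_relabel, Formula.realize_relabel]
    refine and_congr (iff_of_eq (congrArg _ ?_)) (iff_of_eq (congrArg _ ?_)) <;>
    · funext j; cases j <;> rfl
  simp only [key] at hd
  obtain ⟨x, ⟨h1, h2⟩, hx⟩ := hd hinf
  have hx1 : ∀ q ∈ s, ¬ Sig q.2 M w x := fun q hq hs =>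
    hx _ (Finset.mem_union_left _ (Finset.mem_image_of_mem _ hq)) ((sig_relabel _ _ _ _ _).2 hs)
  have hx2 : ∀ q ∈ s, ¬ Sig q.2 M w' x := fun q hq hs =>
    hx _ (Finset.mem_union_right _ (Finset.mem_image_of_mem _ hq)) ((sig_relabel _ _ _ _ _).2 hs)
  exact hne ⟨x, ⟨(hG' w hw x hx1).2 h1, hx1⟩, ⟨(hG' w' hw' x hx2).2 h2, hx2⟩⟩

/-- If a subrelation has no patterns on the given parameters, the realizations of the other
patterns can be chosen out of this subrelation at some node of a finite set of parameters. -/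
theorem HasPat.of_not_subrelation {B A C : Type*} {R : B → A → Prop} {S : B → A → C → Prop} {G : A → Prop}
    (h : ∀ n, ∃ a, Pat R n a ∧ ∀ η : List Bool, η.length < n → G (a η))
    {k : ℕ} (hk : ¬ ∃ a, Pat (fun b a => R b a ∧ ∀ c, ¬ S b a c) k a ∧
      ∀ η : List Bool, η.length < k → G (a η)) :
    HasPat fun (b : B × {η : List Bool // η.length < k} × C)
      (p : A × ({η : List Bool // η.length < k} → A)) =>
        R b.1 p.1 ∧ S b.1 (p.2 b.2.1) b.2.2 := by
  intro n
  obtain ⟨a, ha, hG⟩ := h (n + k + 1)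
  obtain ⟨Q, hQ, hQa, hQb⟩ : ∃ Q : Set (List Bool), (∀ η ∈ Q, η.length < k) ∧
      IsTreeAntichain Q ∧ ∀ b, ∃ η ∈ Q, R b (a (true :: η)) →
        ∃ c, S b (a (true :: η)) c := by
    by_contra! hcon
    refine hk ⟨fun η => a (true :: η), ⟨fun X hX hXa => ?_, ?_⟩,
      fun η hη => hG _ (by simp; omega)⟩
    · exact hcon X hX hXa
    · rintro η ν hη hν hne hc ⟨b, h1, h2⟩
      exact ha.2 _ _ (by simp; omega) (by simp; omega) (by simpa using hne)
        ((comparable_cons _ _ _).2 hc) ⟨b, h1.1, h2.1⟩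
  refine ⟨fun η => (a (false :: η), fun ν => a (true :: ν)), fun X hX hXa => ?_, ?_⟩
  · obtain ⟨b, hb⟩ := ha.1 (List.cons false '' X ∪ List.cons true '' Q) (by
      rintro _ (⟨η, hη, rfl⟩ | ⟨η, hη, rfl⟩)
      · have := hX η hη
        simp; omega
      · have := hQ η hη
        simp; omega) (hXa.join hQa)
    obtain ⟨ν, hν, hS⟩ := hQb b
    obtain ⟨c, hc⟩ := hS (hb _ (Or.inr ⟨ν, hν, rfl⟩))
    exact ⟨(b, ⟨ν, hQ ν hν⟩, c), fun η hη => ⟨hb _ (Or.inl ⟨η, hη, rfl⟩), hc⟩⟩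
  · rintro η ν hη hν hne hc ⟨b, h1, h2⟩
    exact ha.2 _ _ (by simp; omega) (by simp; omega) (by simpa using hne)
      ((comparable_cons _ _ _).2 hc) ⟨b.1, h1.1, h2.1⟩

end Reduction

section Reduction

variable {L : FirstOrder.Language.{u, v}} {T' : (LH L).Theory}

/-- Patterns for a definable relation on elements give patterns for an `L`-definable relation. -/
theorem Good.lpat_of_element {lov : Prop} (hG : Good T' lov) {M : Mdl T'} {γ : Type} [Finite γ]
    {F : ∀ N : Mdl T', (Fin 1 ⊕ γ → N) → Prop} (hF : UDef (LH L) F)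
    (h : HasPat fun (x : M) (a : γ → M) => F M (Sum.elim (fun _ => x) a)) : LPat M := by
  obtain ⟨J, hJ⟩ := exists_uniform_generic hG hF M
  obtain ⟨⟨m, ψ, s⟩, -, hp⟩ := h.exists_color J
    (fun p a => ∃ h : Fin p.1 → M, ∀ x : M, (∀ q ∈ p.2.2, ¬ Sig q.2 M (Sum.elim a h) x) →
        (F M (Sum.elim (fun _ => x) a) ↔
          p.2.1.Realize (Sum.elim (fun _ => x) (Sum.elim a h)))) hJ
  dsimp only at hp
  let R : M → (γ ⊕ Fin m → M) → Prop := fun x w =>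
    F M (Sum.elim (fun _ => x) fun i => w (Sum.inl i))
  let G : (γ ⊕ Fin m → M) → Prop := fun w => ∀ x, (∀ q ∈ s, ¬ Sig q.2 M w x) →
      (R x w ↔ ψ.Realize (Sum.elim (fun _ => x) w))
  have hR : ∀ n, ∃ a, Pat R n a ∧ ∀ η : List Bool, η.length < n → G (a η) := by
    intro n
    obtain ⟨a, ha, hc⟩ := hp n
    have hc' : ∀ η, ∃ h : Fin m → M, η.length < n → G (Sum.elim (a η) h) := by
      intro η
      by_cases hη : η.length < n
      · exact (hc η hη).imp fun h hh _ => hh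
      · exact ⟨fun _ => Classical.choice inferInstance, fun h => (hη h).elim⟩
    choose h hh using hc'
    exact ⟨fun η => Sum.elim (a η) (h η), ha, hh⟩
  let C := Σ q : s, (Fin q.1.1 → {x // x ∈ HSet L M})
  let S : M → (γ ⊕ Fin m → M) → C → Prop := fun x w c =>
    c.1.1.2.Realize (Sum.elim (fun _ => x) (Sum.elim w fun i => (c.2 i).1)) ∧
    {y : M | c.1.1.2.Realize (Sum.elim (fun _ => y) (Sum.elim w fun i => (c.2 i).1))}.Finite
  have hS : ∀ x w, (∀ c, ¬ S x w c) ↔ ∀ q ∈ s, ¬ Sig q.2 M w x := by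
    intro x w
    constructor
    · rintro h q hq ⟨z, hz, h'⟩
      exact h ⟨⟨q, hq⟩, fun i => ⟨z i, hz i⟩⟩ h'
    · rintro h ⟨⟨q, hq⟩, z⟩ h'
      exact h q hq ⟨fun i => (z i).1, fun i => (z i).2, h'⟩
  by_cases hA : ∀ n, ∃ a, Pat (fun x w => R x w ∧ ∀ c, ¬ S x w c) n a ∧
      ∀ η : List Bool, η.length < n → G (a η)
  · simp only [hS] at hA
    exact hG.lpat_of_generic ψ s (fun w hw => hw) hA
  · obtain ⟨k, hk⟩ := not_forall.1 hA
    have h1 := HasPat.of_not_subrelation hR hk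
    have h2 : HasPat fun (b : ({η : List Bool // η.length < k} × s) × (C × M))
        (p : (γ ⊕ Fin m → M) × ({η : List Bool // η.length < k} → γ ⊕ Fin m → M)) =>
        b.2.1.1 = b.1.2 ∧ R b.2.2 p.1 ∧ S b.2.2 (p.2 b.1.1) b.2.1 :=
      h1.transport id (fun b _ => ⟨((b.2.1, b.2.2.1), (b.2.2, b.1)), fun p hp => ⟨rfl, hp⟩⟩)
        fun b _ => ⟨(b.2.2, b.1.1, b.2.1), fun p hp => hp.2⟩
    obtain ⟨⟨η, q⟩, h3⟩ := HasPat.const_color (fun (j : {η : List Bool // η.length < k} × s) (b : C × M)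
        (p : (γ ⊕ Fin m → M) × ({η : List Bool // η.length < k} → γ ⊕ Fin m → M)) =>
        b.1.1 = j.2 ∧ R b.2 p.1 ∧ S b.2 (p.2 j.1) b.1) h2
    refine hG.lpat_of_sig (γ := (γ ⊕ Fin m) ⊕ (γ ⊕ Fin m))
      (q.1.2.relabel (Sum.map id (Sum.map Sum.inr id)))
      (F := fun N v => F N fun i => v (Sum.map id (fun i => Sum.inl (Sum.inl i)) i))
      (hF.relabel _) ?_
    have key : ∀ (x : M) (w w' : γ ⊕ Fin m → M) (z : Fin q.1.1 → M),
        (q.1.2.relabel (Sum.map id (Sum.map Sum.inr id))).Realize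
          (Sum.elim (fun _ => x) (Sum.elim (Sum.elim w w') z)) ↔
        q.1.2.Realize (Sum.elim (fun _ => x) (Sum.elim w' z)) := by
      intro x w w' z
      rw [Formula.realize_relabel]
      refine iff_of_eq (congrArg _ ?_)
      funext j; rcases j with j | j | j <;> rfl
    have key' : ∀ (x : M) (w w' : γ ⊕ Fin m → M),
        (F M fun i => Sum.elim (fun _ => x) (Sum.elim w w')
          (Sum.map id (fun i => Sum.inl (Sum.inl i)) i)) ↔ R x w := by
      intro x w w'
      refine iff_of_eq (congrArg _ ?_)
      funext j; cases j <;> rfl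
    refine h3.transport (fun p => Sum.elim p.1 (p.2 η)) ?_ ?_
    · rintro ⟨⟨q', z⟩, x⟩ ⟨a, rfl, -⟩
      refine ⟨(z, x), fun p hp => ?_⟩
      simp only [key, key']
      exact hp.2
    · rintro ⟨z, x⟩ -
      refine ⟨(⟨q, z⟩, x), fun p hp => ⟨rfl, ?_⟩⟩
      simp only [key, key'] at hp
      exact hp

end Reduction

section Transfer

variable {L : FirstOrder.Language.{u, v}} {T' : (LH L).Theory}

theorem UDef.pat {K : FirstOrder.Language.{u, v}} [∀ N : Mdl T', K.Structure N] {k : ℕ} {δ : Type}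
    {Q : ∀ N : Mdl T', (Fin k ⊕ δ → N) → Prop} (hQ : UDef K Q) (n : ℕ) :
    UDef K fun (N : Mdl T') (v : List Bool × δ → N) =>
      Pat (fun (b : Fin k → N) (a : δ → N) => Q N (Sum.elim b a)) n fun η i => v (η, i) := by
  have hQ' : ∀ η : List Bool, UDef K fun (N : Mdl T') (v : (List Bool × δ) ⊕ Fin k → N) =>
      Q N (Sum.elim (fun i => v (Sum.inr i)) fun i => v (Sum.inl (η, i))) := fun η => by
    refine (hQ.relabel (Sum.elim Sum.inr fun i => Sum.inl (η, i))).congr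
      fun N v => iff_of_eq (congrArg _ ?_)
    funext j; cases j <;> rfl
  refine ((UDef.allFin (J := Set {η : List Bool // η.length < n}) fun X =>
    (UDef.const (IsTreeAntichain (Subtype.val '' X))).imp
      (UDef.ex (UDef.allFin (J := X) fun η => hQ' η.1.1))).and
    (UDef.allFin (J := {η : List Bool // η.length < n} × {η : List Bool // η.length < n}) fun p =>
      (UDef.const (p.1.1 ≠ p.2.1 ∧ TreeComparable p.1.1 p.2.1)).imp
        (UDef.ex ((hQ' p.1.1).and (hQ' p.2.1))).not)).congr fun N v => and_congr ?_ ?_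
  · constructor
    · intro h X hX hXa
      obtain ⟨b, hb⟩ := h {η | η.1 ∈ X} (hXa.mono (by rintro _ ⟨η, hη, rfl⟩; exact hη))
      exact ⟨b, fun η hη => hb ⟨⟨η, hX η hη⟩, hη⟩⟩
    · intro h X hX
      obtain ⟨b, hb⟩ := h (Subtype.val '' X) (by rintro _ ⟨η, -, rfl⟩; exact η.2) hX
      exact ⟨b, fun η => hb _ ⟨η.1, η.2, rfl⟩⟩
  · exact ⟨fun h η ν hη hν hne hc => h (⟨η, hη⟩, ⟨ν, hν⟩) ⟨hne, hc⟩,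
      fun h p hp => h p.1 p.2 p.1.2 p.2.2 hp.1 hp.2⟩

theorem ATPWitness.pat {K : FirstOrder.Language.{u, v}} {N : Type w} [K.Structure N] {k m : ℕ}
    {φ : K.Formula (Fin k ⊕ Fin m)} {a : List Bool → Fin m → N} (h : ATPWitness φ a) (n : ℕ) :
    Pat (fun (b : Fin k → N) (a : Fin m → N) => φ.Realize (Sum.elim b a)) n a := by
  refine ⟨fun X hX hXa => ?_, fun η ν _ _ hne hc => h.2 η ν hne hc⟩
  have hfin : X.Finite := (Set.toFinite (Set.range
    (Subtype.val : {η : List Bool // η.length < n} → List Bool))).subset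
      fun η hη => ⟨⟨η, hX η hη⟩, rfl⟩
  obtain ⟨b, hb⟩ := h.1 hfin.toFinset (by simpa using hXa)
  exact ⟨b, fun η hη => hb η (by simpa using hη)⟩

theorem atpWitness_of_pat {K : FirstOrder.Language.{u, v}} {N : Type w} [K.Structure N] {k m : ℕ}
    {φ : K.Formula (Fin k ⊕ Fin m)} {a : List Bool → Fin m → N}
    (h : ∀ n, Pat (fun (b : Fin k → N) (a : Fin m → N) => φ.Realize (Sum.elim b a)) n a) :
    ATPWitness φ a := by
  refine ⟨fun X hX => ?_, fun η ν hne hc => ?_⟩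
  · refine (h (X.sup List.length + 1)).1 X (fun η hη => ?_) hX
    exact Nat.lt_succ_of_le (Finset.le_sup (f := List.length) hη)
  · exact (h (max η.length ν.length + 1)).2 η ν (by omega) (by omega) hne hc

theorem LPat.hasATP {T : L.Theory} (hT : ∀ N : Mdl T', N ⊨ T) {M : Mdl T'} (h : LPat M) :
    T.HasATP := by
  obtain ⟨k, δ, _, Q, hQ, hp⟩ := h
  obtain ⟨m, ⟨e⟩⟩ := Finite.exists_equiv_fin δ
  obtain ⟨N, e₀, z, hz⟩ := exists_realization (γ := Empty) (β := List Bool × δ)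
    (ι := ULift ℕ) (fun n N v => Pat (fun (b : Fin k → N) (a : δ → N) => Q N (Sum.elim b a))
      n.down fun η i => v (Sum.inr (η, i)))
    (fun n => (UDef.pat (UDef.ofL hQ) n.down).relabel Sum.inr) M Empty.elim (fun s => by
      obtain ⟨a, ha⟩ := hp (s.sup ULift.down)
      exact ⟨fun p => a p.1 p.2, fun n hn => ha.mono (Finset.le_sup hn)⟩)
  obtain ⟨θ, hθ⟩ := hQ
  have := hT N
  refine ⟨Theory.ModelType.of T N, k, m, θ.relabel (Sum.map id e),
    fun η i => z (η, e.symm i), atpWitness_of_pat fun n => ?_⟩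
  refine (hz ⟨n⟩).map (fun a i => a (e.symm i)) fun b η => ?_
  rw [← hθ]
  refine Iff.trans (iff_of_eq (congrArg _ ?_)) Formula.realize_relabel.symm
  funext j; cases j <;> simp

theorem hasPat_of_hasATP {M₀ : Type (max u v)} [(LH L).Structure M₀] [Nonempty M₀]
    (M : Mdl ((LH L).completeTheory M₀)) (h : ((LH L).completeTheory M₀).HasATP) :
    ∃ (k m : ℕ) (φ : (LH L).Formula (Fin k ⊕ Fin m)),
      HasPat fun (b : Fin k → M) (a : Fin m → M) => φ.Realize (Sum.elim b a) := by
  obtain ⟨N, k, m, φ, a, ha⟩ := h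
  refine ⟨k, m, φ, fun n => ?_⟩
  by_contra! hcon
  let f : List Bool → {η : List Bool // η.length < n + 1} :=
    fun η => ⟨η.take n, by simp⟩
  have hU := ((UDef.pat (T' := (LH L).completeTheory M₀) (UDef.of_formula φ) n).relabel
    (fun p : List Bool × Fin m => (f p.1, p.2))).not
  refine UDef.transfer hU M N (fun v => hcon _) (fun p => a p.1.1 p.2) ?_
  refine ⟨fun X hX hXa => ?_, fun η ν hη hν hne hc => ?_⟩
  · obtain ⟨b, hb⟩ := (ha.pat n).1 X hX hXa
    refine ⟨b, fun η hη => ?_⟩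
    have := hX η hη
    simpa [f, List.take_of_length_le this.le] using hb η hη
  · have := (ha.pat n).2 η ν hη hν hne hc
    simpa [f, List.take_of_length_le hη.le, List.take_of_length_le hν.le] using this

theorem hasATP_of_completeTheory_hasATP (T : L.Theory) (hgeo : IsGeometric T)
    (M₀ : Type (max u v)) [(LH L).Structure M₀] [Nonempty M₀]
    (h : IsLovelyPair L M₀ T ∨ IsHStructureExp L M₀ T)
    (hA : ((LH L).completeTheory M₀).HasATP) : T.HasATP := by
  obtain ⟨hT, lov, hG⟩ := exists_good T hgeo M₀ h
  let M : Mdl ((LH L).completeTheory M₀) := Theory.ModelType.of _ M₀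
  obtain ⟨k, m, φ, hp⟩ := hasPat_of_hasATP M hA
  obtain ⟨γ, _, P, hP, hpat⟩ := exists_one_variable (D := fun _ _ => True) (UDef.const True) M k
    (UDef.of_formula φ) (hp.transport id (fun b _ => ⟨fun i => ⟨b i, trivial⟩, fun a ha => ha⟩)
      fun b _ => ⟨fun i => (b i).1, fun a ha => ha⟩)
  exact LPat.hasATP hT (hG.lpat_of_element hP (hpat.transport id
    (fun b _ => ⟨b.1, fun a ha => ha⟩) fun b _ => ⟨⟨b, trivial⟩, fun a ha => ha⟩))

end Transfer

/-- **Theorem 4.13**: Let `T` be a geometric complete theory and `T*` the theory of lovely pairs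
(resp. of H-structures) associated with `T`, realized as the complete `L_H`-theory of a lovely
pair (resp. H-structure) `M₀`.  If `T*` has ATP then `T` has ATP; equivalently, if `T` is NATP
then `T*` is NATP. -/
theorem lovely_pair_H_structure_preserve_NATP
    {L : FirstOrder.Language.{u, v}} (T : L.Theory) (hgeo : IsGeometric T)
    (M₀ : Type (max u v)) [(LH L).Structure M₀] [Nonempty M₀]
    (h : IsLovelyPair L M₀ T ∨ IsHStructureExp L M₀ T) :
    (((LH L).completeTheory M₀).HasATP → T.HasATP) ∧
    (T.IsNATP → ((LH L).completeTheory M₀).IsNATP) := by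
  exact ⟨hasATP_of_completeTheory_hasATP T hgeo M₀ h,
    fun hN hA => hN (hasATP_of_completeTheory_hasATP T hgeo M₀ h hA)⟩

end NATPPaper
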